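/- arXiv:1902.10894 — 2 statements merged into one kernel-verified Lean document; each statement's English description precedes it below -/
import Mathlib

section
/- Let X = (X(t), t ∈ ℝ) be a centered stationary Gaussian process with continuous sample paths whose covariance function R_X is strictly convex on [0, b] for some b > 0, and suppose P(min_{0≤t≤b} X(t) > u) > 0 for every u > 0. Let T* be the leftmost location of the minimum of X on [0,b], i.e. T* = argmin_{0≤t≤b} X(t) (choosing the smallest minimizer in case of ties). Then, as u → ∞, the conditional law P(T* ∈ · | min_{0≤t≤b} X(t) > u) converges weakly to ν*, the unique probability measure on [0,b] minimizing I(ν) = ∫∫ R_X(t−s) ν(ds) ν(dt). -/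
open MeasureTheory ProbabilityTheory Filter Set

/-- The energy functional `I(ν) = ∫∫ R(t-s) ν(ds) ν(dt)` for a stationary covariance
kernel `R`. -/
noncomputable def statEnergy (R : ℝ → ℝ) (ν : Measure ℝ) : ℝ :=
  ∫ s, ∫ t, R (t - s) ∂ν ∂ν

section GaussianProcess

variable {Ω : Type*}

/-- The linear combination of the values of `X` with coefficients `c`. -/
noncomputable def linComb (X : ℝ → Ω → ℝ) (c : ℝ →₀ ℝ) (ω : Ω) : ℝ :=
  c.sum fun t a => a * X t ω

/-- The covariance of `X t` with `linComb X c`, when `X` has stationary covariance `R`. -/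
noncomputable def combCov (R : ℝ → ℝ) (c : ℝ →₀ ℝ) (t : ℝ) : ℝ :=
  c.sum fun s a => a * R (t - s)

/-- A jointly measurable centered stationary Gaussian process with continuous paths. -/
structure IsStationaryGaussian [MeasurableSpace Ω] (P : Measure Ω) (X : ℝ → Ω → ℝ)
    (R : ℝ → ℝ) : Prop where
  measurable : ∀ t, Measurable (X t)
  continuous : ∀ ω, Continuous fun t => X t ω
  gaussian : ∀ c : ℝ →₀ ℝ, ∃ v : NNReal, P.map (linComb X c) = gaussianReal 0 v
  cov : ∀ s t, ∫ ω, X s ω * X t ω ∂P = R (t - s)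

theorem linComb_add (X : ℝ → Ω → ℝ) (c d : ℝ →₀ ℝ) (ω : Ω) :
    linComb X (c + d) ω = linComb X c ω + linComb X d ω :=
  Finsupp.sum_add_index' (by simp) (by intros; ring)

theorem linComb_smul (X : ℝ → Ω → ℝ) (r : ℝ) (c : ℝ →₀ ℝ) (ω : Ω) :
    linComb X (r • c) ω = r * linComb X c ω := by
  unfold linComb
  rw [Finsupp.sum_smul_index (by simp), Finsupp.mul_sum]
  simp_rw [mul_assoc]

theorem linComb_single (X : ℝ → Ω → ℝ) (t a : ℝ) (ω : Ω) :
    linComb X (Finsupp.single t a) ω = a * X t ω := by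
  simp [linComb]

theorem combCov_smul (R : ℝ → ℝ) (r : ℝ) (c : ℝ →₀ ℝ) (t : ℝ) :
    combCov R (r • c) t = r * combCov R c t := by
  unfold combCov
  rw [Finsupp.sum_smul_index (by simp), Finsupp.mul_sum]
  simp_rw [mul_assoc]

theorem combCov_single (R : ℝ → ℝ) (s a t : ℝ) :
    combCov R (Finsupp.single s a) t = a * R (t - s) := by
  simp [combCov]

/-- The Cauchy-Schwarz inequality for square-integrable random variables. -/
theorem abs_integral_mul_le [MeasurableSpace Ω] {P : Measure Ω} {Y Z : Ω → ℝ}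
    (hY : MemLp Y 2 P) (hZ : MemLp Z 2 P) :
    |∫ ω, Y ω * Z ω ∂P| ≤ Real.sqrt (∫ ω, Y ω ^ 2 ∂P) * Real.sqrt (∫ ω, Z ω ^ 2 ∂P) := by
  have key : (∫ ω, Y ω * Z ω ∂P) ^ 2 ≤ (∫ ω, Y ω ^ 2 ∂P) * ∫ ω, Z ω ^ 2 ∂P := by
    have hq : ∀ r : ℝ, 0 ≤ (∫ ω, Z ω ^ 2 ∂P) * (r * r) + 2 * (∫ ω, Y ω * Z ω ∂P) * r
        + ∫ ω, Y ω ^ 2 ∂P := by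
      intro r
      have h1 : (∫ ω, Z ω ^ 2 ∂P) * (r * r) + 2 * (∫ ω, Y ω * Z ω ∂P) * r + ∫ ω, Y ω ^ 2 ∂P
          = ∫ ω, (Y ω + r * Z ω) ^ 2 ∂P := by
        have e : ∀ ω, (Y ω + r * Z ω) ^ 2
            = (r * r) * Z ω ^ 2 + (2 * r) * (Y ω * Z ω) + Y ω ^ 2 := by intro ω; ring
        simp_rw [e]
        have i1 := hZ.integrable_sq.const_mul (r * r)
        have i2 : Integrable (fun ω => (2 * r) * (Y ω * Z ω)) P :=
          (hY.integrable_mul hZ).const_mul (2 * r)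
        rw [integral_add (by exact i1.add i2) hY.integrable_sq, integral_add i1 i2,
          integral_const_mul, integral_const_mul]
        ring
      rw [h1]; positivity
    have := discrim_le_zero hq
    simp only [discrim] at this
    nlinarith
  rw [← Real.sqrt_mul (by positivity)]
  exact Real.abs_le_sqrt key

namespace IsStationaryGaussian

variable [MeasurableSpace Ω] {P : Measure Ω} {X : ℝ → Ω → ℝ}
  {R : ℝ → ℝ} (hX : IsStationaryGaussian P X R)
include hX

theorem measurable_linComb (c : ℝ →₀ ℝ) : Measurable (linComb X c) := by
  unfold linComb Finsupp.sum
  exact Finset.measurable_fun_sum _ fun t _ => (hX.measurable t).const_mul _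

theorem memLp_linComb (c : ℝ →₀ ℝ) : MemLp (linComb X c) 2 P := by
  obtain ⟨v, hv⟩ := hX.gaussian c
  have h := memLp_id_gaussianReal' (μ := 0) (v := v) 2 (by simp)
  rw [← hv] at h
  exact (memLp_map_measure_iff (by fun_prop)
    (hX.measurable_linComb c).aemeasurable).1 h

theorem memLp (t : ℝ) : MemLp (X t) 2 P := by
  have h := hX.memLp_linComb (Finsupp.single t 1)
  have e : linComb X (Finsupp.single t 1) = X t := by
    ext ω; simp [linComb_single]
  rwa [e] at h

theorem integrable_mul (s t : ℝ) : Integrable (fun ω => X s ω * X t ω) P :=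
  (hX.memLp s).integrable_mul (hX.memLp t)

theorem integral_mul_linComb (t : ℝ) (c : ℝ →₀ ℝ) :
    ∫ ω, X t ω * linComb X c ω ∂P = combCov R c t := by
  unfold linComb combCov Finsupp.sum
  simp_rw [Finset.mul_sum]
  rw [integral_finsetSum]
  · refine Finset.sum_congr rfl fun s _ => ?_
    rw [← hX.cov s t, ← integral_const_mul]
    congr with ω; ring
  · intro s _
    refine ((hX.integrable_mul s t).const_mul (c s)).congr (.of_forall fun ω => ?_)
    simp only; ring

theorem integral_linComb_mul (c d : ℝ →₀ ℝ) :
    ∫ ω, linComb X c ω * linComb X d ω ∂P = c.sum fun t a => a * combCov R d t := by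
  simp_rw [← hX.integral_mul_linComb]
  conv_lhs => unfold linComb Finsupp.sum
  unfold Finsupp.sum
  simp_rw [Finset.sum_mul]
  rw [integral_finsetSum]
  · refine Finset.sum_congr rfl fun s _ => ?_
    rw [← integral_const_mul]
    congr with ω; simp only [linComb, Finsupp.sum]; ring
  · intro s _
    refine (((hX.memLp s).integrable_mul (hX.memLp_linComb d)).const_mul (c s)).congr
      (.of_forall fun ω => ?_)
    simp only [linComb, Finsupp.sum, Pi.mul_apply]; ring

/-- Exponential moments of a Gaussian linear combination. -/
theorem integral_exp_linComb (c : ℝ →₀ ℝ) :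
    ∫ ω, Real.exp (linComb X c ω) ∂P = Real.exp ((∫ ω, linComb X c ω ^ 2 ∂P) / 2) := by
  obtain ⟨v, hv⟩ := hX.gaussian c
  have hm := mgf_gaussianReal hv 1
  have hvar : ∫ ω, linComb X c ω ^ 2 ∂P = v := by
    have h1 : ∫ x, x ^ 2 ∂(P.map (linComb X c)) = ∫ ω, linComb X c ω ^ 2 ∂P :=
      integral_map (hX.measurable_linComb c).aemeasurable (by fun_prop)
    rw [← h1, hv]
    have h2 := variance_fun_id_gaussianReal (μ := 0) (v := v)
    rw [variance_eq_integral (by fun_prop)] at h2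
    simpa [integral_id_gaussianReal] using h2
  rw [hvar]
  simpa [mgf] using hm

theorem integrable_exp_linComb (c : ℝ →₀ ℝ) :
    Integrable (fun ω => Real.exp (linComb X c ω)) P := by
  by_contra h
  have := hX.integral_exp_linComb c
  rw [integral_undef h] at this
  exact (Real.exp_pos _).ne this

theorem cov_neg (t : ℝ) : R (-t) = R t := by
  have h1 := hX.cov 0 t
  have h2 := hX.cov t 0
  simp only [sub_zero, zero_sub] at h1 h2
  rw [← h1, ← h2]
  congr with ω; ring

theorem integral_sq (t : ℝ) : ∫ ω, X t ω ^ 2 ∂P = R 0 := by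
  have := hX.cov t t
  simpa [sq] using this

theorem cov_zero_nonneg : 0 ≤ R 0 := by
  rw [← hX.integral_sq 0]
  positivity

theorem integral_sub_sq (s t : ℝ) : ∫ ω, (X t ω - X s ω) ^ 2 ∂P = 2 * (R 0 - R (t - s)) := by
  have e : ∀ ω, (X t ω - X s ω) ^ 2 = X t ω * X t ω + X s ω * X s ω - 2 * (X s ω * X t ω) := by
    intro ω; ring
  simp_rw [e]
  rw [integral_sub (by exact (hX.integrable_mul t t).add (hX.integrable_mul s s))
    ((hX.integrable_mul s t).const_mul 2),
    integral_add (hX.integrable_mul t t) (hX.integrable_mul s s), integral_const_mul,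
    hX.cov, hX.cov, hX.cov]
  simp only [sub_self]; ring

theorem cov_le (t : ℝ) : R t ≤ R 0 := by
  have h := hX.integral_sub_sq 0 t
  have h2 : 0 ≤ ∫ ω, (X t ω - X 0 ω) ^ 2 ∂P := by positivity
  rw [h] at h2
  simp only [sub_zero] at h2
  linarith

theorem abs_cov_le (t : ℝ) : |R t| ≤ R 0 := by
  have h := abs_integral_mul_le (hX.memLp 0) (hX.memLp t)
  rw [hX.cov, hX.integral_sq, hX.integral_sq, Real.mul_self_sqrt hX.cov_zero_nonneg] at h
  simpa using h

theorem abs_cov_sub_le (s t : ℝ) :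
    |R t - R s| ≤ Real.sqrt (R 0) * Real.sqrt (2 * (R 0 - R (t - s))) := by
  have h := abs_integral_mul_le (hX.memLp 0) ((hX.memLp t).sub (hX.memLp s))
  simp only [Pi.sub_apply, mul_sub] at h
  rw [integral_sub (hX.integrable_mul 0 t) (hX.integrable_mul 0 s), hX.cov, hX.cov,
    hX.integral_sub_sq, hX.integral_sq] at h
  simpa [mul_sub] using h

theorem tendsto_cov_zero [IsProbabilityMeasure P] : Tendsto R (nhds 0) (nhds (R 0)) := by
  have key : Tendsto (fun t => ∫ ω, Real.cos (X t ω - X 0 ω) ∂P) (nhds 0)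
      (nhds (∫ ω, Real.cos (X 0 ω - X 0 ω) ∂P)) := by
    refine tendsto_integral_filter_of_dominated_convergence (fun _ => 1) ?_ ?_
      (integrable_const _) ?_
    · exact .of_forall fun t => (Real.measurable_cos.comp
        ((hX.measurable t).sub (hX.measurable 0))).aestronglyMeasurable
    · exact .of_forall fun t => .of_forall fun ω => by simpa using Real.abs_cos_le_one _
    · refine .of_forall fun ω => ?_
      exact (Real.continuous_cos.comp ((hX.continuous ω).sub continuous_const)).tendsto 0
  have hval : ∀ t, ∫ ω, Real.cos (X t ω - X 0 ω) ∂P = Real.exp (-(R 0 - R t)) := by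
    intro t
    obtain ⟨v, hv⟩ := hX.gaussian (Finsupp.single t 1 + Finsupp.single 0 (-1))
    have e : ∀ ω, linComb X (Finsupp.single t 1 + Finsupp.single 0 (-1)) ω = X t ω - X 0 ω := by
      intro ω; rw [linComb_add, linComb_single, linComb_single]; ring
    have hvar : (v : ℝ) = 2 * (R 0 - R t) := by
      have h1 : ∫ x, x ^ 2 ∂(P.map (linComb X (Finsupp.single t 1 + Finsupp.single 0 (-1))))
          = ∫ ω, (X t ω - X 0 ω) ^ 2 ∂P := by
        rw [integral_map (hX.measurable_linComb _).aemeasurable (by fun_prop)]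
        simp_rw [e]
      rw [hX.integral_sub_sq, hv] at h1
      have h2 := variance_fun_id_gaussianReal (μ := 0) (v := v)
      rw [variance_eq_integral (by fun_prop)] at h2
      simp only [integral_id_gaussianReal, sub_zero] at h2 h1
      linarith
    have hc := charFun_gaussianReal (μ := 0) (v := v) 1
    rw [← hv, charFun_apply, integral_map (hX.measurable_linComb _).aemeasurable (by fun_prop)]
      at hc
    simp_rw [e] at hc
    have hre := congrArg Complex.re hc
    rw [← RCLike.re_eq_complex_re, ← integral_re] at hre
    · simp only [RCLike.inner_apply, conj_trivial, RCLike.re_eq_complex_re, one_mul,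
        Complex.exp_ofReal_mul_I_re] at hre
      rw [hre]
      have : (((1:ℝ):ℂ) * ((0:ℝ):ℂ) * Complex.I - (v:ℂ) * ((1:ℝ):ℂ) ^ 2 / 2)
          = ((-(v:ℝ) / 2 : ℝ) : ℂ) := by
        push_cast; ring
      rw [this, Complex.exp_ofReal_re, hvar]
      congr 1; ring
    · refine Integrable.of_bound (C := 1) ?_ (.of_forall fun ω => ?_)
      · have h1 := hX.measurable t
        have h2 := hX.measurable 0
        exact Measurable.aestronglyMeasurable
          (by simp only [RCLike.inner_apply, conj_trivial]; fun_prop)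
      · rw [Complex.norm_exp_ofReal_mul_I]
  simp_rw [hval] at key
  have h2 := (Real.continuousAt_log (Real.exp_pos (-(R 0 - R 0))).ne').tendsto.comp key
  simp only [Function.comp_def, Real.log_exp] at h2
  have h3 := h2.add_const (R 0)
  simpa using h3

theorem continuous_cov [IsProbabilityMeasure P] : Continuous R := by
  rw [continuous_iff_continuousAt]
  intro s
  rw [ContinuousAt, tendsto_iff_norm_sub_tendsto_zero]
  have h0 : Tendsto (fun t => Real.sqrt (R 0) * Real.sqrt (2 * (R 0 - R (t - s)))) (nhds s)
      (nhds (Real.sqrt (R 0) * Real.sqrt (2 * (R 0 - R 0)))) := by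
    have h1 : Tendsto (fun t => t - s) (nhds s) (nhds 0) := by
      have : ContinuousAt (fun t : ℝ => t - s) s := by fun_prop
      simpa [ContinuousAt] using this
    have h2 := hX.tendsto_cov_zero.comp h1
    exact ((Real.continuous_sqrt.tendsto _).comp ((h2.const_sub (R 0)).const_mul 2)).const_mul _
  simp only [sub_self, mul_zero, Real.sqrt_zero] at h0
  exact squeeze_zero (fun t => norm_nonneg _) (fun t => hX.abs_cov_sub_le s t) h0

end IsStationaryGaussian

end GaussianProcess

section PathMinimum

/-- The infimum of `f` on `[0, b]`. -/
noncomputable def infOn (f : ℝ → ℝ) (b : ℝ) : ℝ := sInf (f '' Icc 0 b)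

theorem exists_eq_infOn {f : ℝ → ℝ} (hf : Continuous f) {b : ℝ} (hb : 0 ≤ b) :
    ∃ t ∈ Icc 0 b, f t = infOn f b := by
  obtain ⟨t, ht, h, -⟩ := isCompact_Icc.exists_sInf_image_eq_and_le
    (nonempty_Icc.2 hb) hf.continuousOn
  exact ⟨t, ht, h.symm⟩

theorem infOn_le {f : ℝ → ℝ} (hf : Continuous f) {b t : ℝ} (ht : t ∈ Icc 0 b) :
    infOn f b ≤ f t :=
  csInf_le (isCompact_Icc.image hf).bddBelow (mem_image_of_mem f ht)

theorem lt_infOn_iff {f : ℝ → ℝ} (hf : Continuous f) {b c : ℝ} (hb : 0 ≤ b) :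
    c < infOn f b ↔ ∀ t ∈ Icc 0 b, c < f t := by
  refine ⟨fun h t ht => h.trans_le (infOn_le hf ht), fun h => ?_⟩
  obtain ⟨t, ht, e⟩ := exists_eq_infOn hf hb
  exact e ▸ h t ht

/-- Minima over finite grids drawn from a dense sequence converge to the infimum. -/
theorem exists_grid {b : ℝ} (hb : 0 ≤ b) : ∃ d : ℕ → ℝ, (∀ i, d i ∈ Icc 0 b) ∧
    ∀ f : ℝ → ℝ, Continuous f → Tendsto (fun k : ℕ =>
      (Finset.univ : Finset (Fin (k + 1))).inf' Finset.univ_nonempty fun i => f (d i))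
      atTop (nhds (infOn f b)) := by
  have : Nonempty (Icc (0 : ℝ) b) := ⟨⟨0, le_rfl, hb⟩⟩
  refine ⟨fun i => TopologicalSpace.denseSeq (Icc (0 : ℝ) b) i, fun i => Subtype.prop _,
    fun f hf => ?_⟩
  have hlow : ∀ k : ℕ, infOn f b ≤ (Finset.univ : Finset (Fin (k + 1))).inf'
      Finset.univ_nonempty fun i => f (TopologicalSpace.denseSeq (Icc (0 : ℝ) b) i) := by
    intro k
    refine Finset.le_inf' _ _ fun i _ => infOn_le hf (Subtype.prop _)
  rw [tendsto_order]
  refine ⟨fun a ha => .of_forall fun k => ha.trans_le (hlow k), fun a ha => ?_⟩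
  obtain ⟨t, ht, e⟩ := exists_eq_infOn hf hb
  have hopen : IsOpen {s : Icc (0 : ℝ) b | f s < a} :=
    isOpen_lt (hf.comp continuous_subtype_val) continuous_const
  obtain ⟨i, hi⟩ := (TopologicalSpace.denseRange_denseSeq (Icc (0 : ℝ) b)).exists_mem_open
    hopen ⟨⟨t, ht⟩, by rw [mem_ofPred_eq, e]; exact ha⟩
  filter_upwards [eventually_ge_atTop i] with k hk
  exact (Finset.inf'_le (f := fun j : Fin (k + 1) =>
    f (TopologicalSpace.denseSeq (Icc (0 : ℝ) b) j))
    (Finset.mem_univ (⟨i, by omega⟩ : Fin (k + 1)))).trans_lt hi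

theorem measurable_infOn {Ω : Type*} [MeasurableSpace Ω] {X : ℝ → Ω → ℝ}
    (hm : ∀ t, Measurable (X t)) (hc : ∀ ω, Continuous fun t => X t ω) {b : ℝ} (hb : 0 ≤ b) :
    Measurable fun ω => infOn (fun t => X t ω) b := by
  obtain ⟨d, -, hd⟩ := exists_grid hb
  refine measurable_of_tendsto_metrizable (f := fun (k : ℕ) ω =>
    (Finset.univ : Finset (Fin (k + 1))).inf' Finset.univ_nonempty fun i => X (d i) ω)
    (fun k => ?_) (tendsto_pi_nhds.2 fun ω => hd _ (hc ω))
  have h : Measurable ((Finset.univ : Finset (Fin (k + 1))).inf' Finset.univ_nonempty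
      fun i => X (d i)) :=
    Finset.inf'_induction _ _ (fun _ h₁ _ h₂ => h₁.inf h₂) fun i _ => hm (d i)
  convert h using 1
  ext ω
  simp [Finset.inf'_apply]

end PathMinimum

section CameronMartin

variable {Ω : Type*} [MeasurableSpace Ω] {P : Measure Ω} {X : ℝ → Ω → ℝ} {R : ℝ → ℝ}

theorem integral_withDensity_exp (c : ℝ →₀ ℝ) (a : ℝ) (g : Ω → ℝ)
    (hlin : Measurable (linComb X c)) :
    ∫ ω, g ω ∂(P.withDensity fun ω => ENNReal.ofReal (Real.exp (linComb X c ω - a)))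
      = ∫ ω, Real.exp (linComb X c ω - a) * g ω ∂P := by
  rw [integral_withDensity_eq_integral_toReal_smul (by fun_prop) (by simp)]
  simp [ENNReal.toReal_ofReal (Real.exp_pos _).le]

namespace IsStationaryGaussian

variable (hX : IsStationaryGaussian P X R)
include hX

theorem map_withDensity_linComb [IsProbabilityMeasure P] (c d : ℝ →₀ ℝ) :
    (P.withDensity fun ω => ENNReal.ofReal
        (Real.exp (linComb X c ω - (∫ ω, linComb X c ω ^ 2 ∂P) / 2))).map (linComb X d)
      = P.map fun ω => linComb X d ω + ∫ ω, linComb X d ω * linComb X c ω ∂P := by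
  set v := ∫ ω, linComb X c ω ^ 2 ∂P with hv
  set r := ∫ ω, linComb X d ω * linComb X c ω ∂P with hr
  set Q := P.withDensity fun ω => ENNReal.ofReal (Real.exp (linComb X c ω - v / 2)) with hQ
  have hmc := hX.measurable_linComb c
  have hmd := hX.measurable_linComb d
  have hfin : IsFiniteMeasure Q := by
    refine isFiniteMeasure_withDensity_ofReal ?_
    simp_rw [Real.exp_sub]
    exact ((hX.integrable_exp_linComb c).div_const _).hasFiniteIntegral
  have hmgf : mgf (fun ω => linComb X d ω + r) P = mgf (linComb X d) Q := by
    ext z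
    have e1 : ∀ ω, Real.exp (z * (linComb X d ω + r))
        = Real.exp (linComb X (z • d) ω) * Real.exp (z * r) := by
      intro ω; rw [linComb_smul, ← Real.exp_add]; ring_nf
    have e2 : ∀ ω, Real.exp (linComb X c ω - v / 2) * Real.exp (z * linComb X d ω)
        = Real.exp (linComb X (z • d + c) ω) * Real.exp (-(v / 2)) := by
      intro ω
      rw [linComb_add, linComb_smul, ← Real.exp_add, ← Real.exp_add]; ring_nf
    simp only [mgf]
    rw [integral_withDensity_exp c _ _ hmc]
    simp_rw [e1, e2]
    rw [integral_mul_const, integral_mul_const, hX.integral_exp_linComb,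
      hX.integral_exp_linComb, ← Real.exp_add, ← Real.exp_add]
    congr 1
    have i1 := (hX.memLp_linComb (z • d)).integrable_sq
    have i2 := (hX.memLp_linComb c).integrable_sq
    have i3 : Integrable (fun ω => 2 * z * (linComb X d ω * linComb X c ω)) P :=
      ((hX.memLp_linComb d).integrable_mul (hX.memLp_linComb c)).const_mul (2 * z)
    have e3 : ∀ ω, linComb X (z • d + c) ω ^ 2 = linComb X (z • d) ω ^ 2
        + linComb X c ω ^ 2 + 2 * z * (linComb X d ω * linComb X c ω) := by
      intro ω; rw [linComb_add, linComb_smul]; ring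
    simp_rw [e3]
    rw [integral_add (by exact i1.add i2) i3, integral_add i1 i2, integral_const_mul, ← hv, ← hr]
    ring
  have hset : interior (integrableExpSet (fun ω => linComb X d ω + r) P) = univ := by
    have : integrableExpSet (fun ω => linComb X d ω + r) P = univ := by
      refine eq_univ_of_forall fun z => ?_
      have e1 : ∀ ω, Real.exp (z * (linComb X d ω + r))
          = Real.exp (linComb X (z • d) ω) * Real.exp (z * r) := by
        intro ω; rw [linComb_smul, ← Real.exp_add]; ring_nf
      simp only [integrableExpSet, mem_ofPred_eq]
      simp_rw [e1]
      exact (hX.integrable_exp_linComb _).mul_const _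
    rw [this, interior_univ]
  have hmr : Measurable fun ω => linComb X d ω + r := hmd.add_const r
  refine (Measure.ext_of_complexMGF_eq hmr.aemeasurable hmd.aemeasurable ?_).symm
  ext z
  have := eqOn_complexMGF_of_mgf hmgf
  rw [hset] at this
  exact this (mem_univ _)

/-- The Cameron-Martin theorem for finitely many values of a Gaussian process. -/
theorem map_withDensity_pi [IsProbabilityMeasure P] {ι : Type*} [Fintype ι] (t : ι → ℝ)
    (c : ℝ →₀ ℝ) :
    (P.withDensity fun ω => ENNReal.ofReal
        (Real.exp (linComb X c ω - (∫ ω, linComb X c ω ^ 2 ∂P) / 2))).map (fun ω i => X (t i) ω)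
      = P.map fun ω i => X (t i) ω + combCov R c (t i) := by
  classical
  have hmt := fun i => hX.measurable (t i)
  have hmc := hX.measurable_linComb c
  have hfin : IsFiniteMeasure (P.withDensity fun ω => ENNReal.ofReal
        (Real.exp (linComb X c ω - (∫ ω, linComb X c ω ^ 2 ∂P) / 2))) := by
    refine isFiniteMeasure_withDensity_ofReal ?_
    simp_rw [Real.exp_sub]
    exact ((hX.integrable_exp_linComb c).div_const _).hasFiniteIntegral
  have hm1 : Measurable fun ω i => X (t i) ω := measurable_pi_lambda _ hmt
  have hm2 : Measurable fun ω i => X (t i) ω + combCov R c (t i) :=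
    measurable_pi_lambda _ fun i => (hmt i).add_const _
  refine Measure.ext_of_charFunDual ?_
  ext L
  rw [charFunDual_eq_charFun_map_one, charFunDual_eq_charFun_map_one,
    Measure.map_map (by fun_prop) hm1, Measure.map_map (by fun_prop) hm2]
  set d : ℝ →₀ ℝ := ∑ i, Finsupp.single (t i) (L (Pi.single i 1)) with hd
  have hL : ∀ x : ι → ℝ, L x = ∑ i, L (Pi.single i 1) * x i := by
    intro x
    conv_lhs => rw [pi_eq_sum_univ' x]
    simp [mul_comm]
  have hsum : ∀ g : ℝ → ℝ, (d.sum fun s a => a * g s) = ∑ i, L (Pi.single i 1) * g (t i) := by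
    intro g
    rw [hd, ← Finsupp.sum_finsetSum_index (by simp) (by intros; ring)]
    simp
  have e1 : (L ∘ fun ω i => X (t i) ω) = linComb X d := by
    ext ω
    simp only [Function.comp_apply]
    rw [hL, linComb, hsum fun s => X s ω]
  have e2 : (L ∘ fun ω i => X (t i) ω + combCov R c (t i))
      = fun ω => linComb X d ω + ∫ ω, linComb X d ω * linComb X c ω ∂P := by
    ext ω
    simp only [Function.comp_apply]
    rw [hL, linComb, hsum fun s => X s ω, hX.integral_linComb_mul, hsum, ← Finset.sum_add_distrib]
    simp_rw [mul_add]
  rw [e1, e2, hX.map_withDensity_linComb c d]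

end IsStationaryGaussian
end CameronMartin

section Excess

variable {Ω : Type*} [MeasurableSpace Ω] {P : Measure Ω} {X : ℝ → Ω → ℝ} {R : ℝ → ℝ} {b : ℝ}

/-- The minimum of the path of `X` on `[0, b]`. -/
noncomputable def pathMin (X : ℝ → Ω → ℝ) (b : ℝ) (ω : Ω) : ℝ := infOn (fun t => X t ω) b

/-- The mean excess of the minimum of `X` on `[0, b]` over the level `u`. -/
noncomputable def meanExcess (P : Measure Ω) (X : ℝ → Ω → ℝ) (b u : ℝ) : ℝ :=
  ∫ ω, max (pathMin X b ω - u) 0 ∂P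

namespace IsStationaryGaussian

variable (hX : IsStationaryGaussian P X R)
include hX

theorem continuous_combCov [IsProbabilityMeasure P] (c : ℝ →₀ ℝ) : Continuous (combCov R c) := by
  have := hX.continuous_cov
  unfold combCov Finsupp.sum
  fun_prop

theorem measurable_pathMin (hb : 0 ≤ b) : Measurable (pathMin X b) :=
  measurable_infOn hX.measurable hX.continuous hb

theorem pathMin_le (ω : Ω) {t : ℝ} (ht : t ∈ Icc 0 b) : pathMin X b ω ≤ X t ω :=
  infOn_le (hX.continuous ω) ht

theorem excess_le (hb : 0 ≤ b) (u : ℝ) (ω : Ω) :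
    max (pathMin X b ω - u) 0 ≤ |X 0 ω| + |u| := by
  have h := hX.pathMin_le ω (left_mem_Icc.2 hb)
  refine max_le ?_ (by positivity)
  linarith [le_abs_self (X 0 ω), neg_abs_le u]

theorem memLp_excess [IsProbabilityMeasure P] (hb : 0 ≤ b) (u : ℝ) :
    MemLp (fun ω => max (pathMin X b ω - u) 0) 2 P := by
  have hm := hX.measurable_pathMin hb
  refine MemLp.mono (g := fun ω => |X 0 ω| + |u|) ((hX.memLp 0).abs.add (memLp_const |u|))
    (by fun_prop) (.of_forall fun ω => ?_)
  rw [Real.norm_of_nonneg (le_max_right _ _)]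
  exact (hX.excess_le hb u ω).trans (le_abs_self _)

theorem integrable_excess [IsProbabilityMeasure P] (hb : 0 ≤ b) (u : ℝ) :
    Integrable (fun ω => max (pathMin X b ω - u) 0) P :=
  (hX.memLp_excess hb u).integrable (by norm_num)

theorem memLp_exp_linComb (c : ℝ →₀ ℝ) :
    MemLp (fun ω => Real.exp (linComb X c ω)) 2 P := by
  have := hX.measurable_linComb c
  rw [memLp_two_iff_integrable_sq (by fun_prop)]
  refine (hX.integrable_exp_linComb ((2 : ℝ) • c)).congr (.of_forall fun ω => ?_)
  simp only [linComb_smul]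
  rw [← Real.exp_nat_mul]
  norm_num

theorem integrable_exp_mul_excess [IsProbabilityMeasure P] (hb : 0 ≤ b) (c : ℝ →₀ ℝ) (u : ℝ) :
    Integrable (fun ω => Real.exp (linComb X c ω) * max (pathMin X b ω - u) 0) P :=
  (hX.memLp_exp_linComb c).integrable_mul (hX.memLp_excess hb u)

theorem integral_exp_mul_excess_le [IsProbabilityMeasure P] (hb : 0 ≤ b) (c : ℝ →₀ ℝ) (u : ℝ) :
    ∫ ω, Real.exp (linComb X c ω - (∫ ω, linComb X c ω ^ 2 ∂P) / 2)
        * max (pathMin X b ω - u) 0 ∂P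
      ≤ ∫ ω, max (infOn (fun t => X t ω + combCov R c t) b - u) 0 ∂P := by
  obtain ⟨d, hd, hlim⟩ := exists_grid hb
  have hmt := hX.measurable
  have hφ := hX.continuous_combCov c
  let F : ∀ k : ℕ, (Fin (k + 1) → ℝ) → ℝ := fun k x =>
    max ((Finset.univ : Finset (Fin (k + 1))).inf' Finset.univ_nonempty x - u) 0
  have hF : ∀ k, Measurable (F k) := by
    intro k
    have h : Measurable ((Finset.univ : Finset (Fin (k + 1))).inf' Finset.univ_nonempty
        fun i (x : Fin (k + 1) → ℝ) => x i) :=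
      Finset.inf'_induction _ _ (fun _ h₁ _ h₂ => h₁.inf h₂) fun i _ => measurable_pi_apply i
    have h2 : Measurable fun x : Fin (k + 1) → ℝ =>
        (Finset.univ : Finset (Fin (k + 1))).inf' Finset.univ_nonempty x := by
      convert h using 1
      ext x
      simp [Finset.inf'_apply]
    exact (h2.sub_const u).max measurable_const
  have hbound : ∀ (k : ℕ) ω, ‖F k fun i => X (d i) ω + combCov R c (d i)‖
      ≤ |X (d 0) ω| + (|combCov R c (d 0)| + |u|) := by
    intro k ω
    rw [Real.norm_of_nonneg (le_max_right _ _)]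
    refine max_le ?_ (by positivity)
    have h := Finset.inf'_le (fun i : Fin (k + 1) => X (d i) ω + combCov R c (d i))
      (Finset.mem_univ 0)
    simp only [Fin.val_zero] at h
    linarith [le_abs_self (X (d 0) ω), neg_abs_le u, le_abs_self (combCov R c (d 0))]
  have hconv : Tendsto (fun k : ℕ => ∫ ω, F k (fun i => X (d i) ω + combCov R c (d i)) ∂P)
      atTop (nhds (∫ ω, max (infOn (fun t => X t ω + combCov R c t) b - u) 0 ∂P)) := by
    refine tendsto_integral_of_dominated_convergence
      (fun ω => |X (d 0) ω| + (|combCov R c (d 0)| + |u|))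
      (fun k => ((hF k).comp (measurable_pi_lambda _ fun i =>
        (hmt (d i)).add_const _)).aestronglyMeasurable)
      (((hX.memLp (d 0)).integrable (by norm_num)).abs.add (integrable_const _))
      (fun k => .of_forall (hbound k)) (.of_forall fun ω => ?_)
    exact ((hlim _ ((hX.continuous ω).add hφ)).sub_const u).max tendsto_const_nhds
  refine ge_of_tendsto' hconv fun k => ?_
  have h1 := hX.map_withDensity_pi (fun i : Fin (k + 1) => d i) c
  have hmc := hX.measurable_linComb c
  have hm₁ : Measurable fun ω (i : Fin (k + 1)) => X (d i) ω :=
    measurable_pi_lambda _ fun i => hmt (d i)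
  have hm₂ : Measurable fun ω (i : Fin (k + 1)) => X (d i) ω + combCov R c (d i) :=
    measurable_pi_lambda _ fun i => (hmt (d i)).add_const _
  have h2 : ∫ ω, F k (fun i => X (d i) ω + combCov R c (d i)) ∂P
      = ∫ ω, Real.exp (linComb X c ω - (∫ ω, linComb X c ω ^ 2 ∂P) / 2)
        * F k (fun i => X (d i) ω) ∂P := by
    rw [← integral_withDensity_exp c _ _ hmc, ← integral_map
      (φ := fun ω (i : Fin (k + 1)) => X (d i) ω + combCov R c (d i)) (f := F k)
      hm₂.aemeasurable (hF k).aestronglyMeasurable, ← h1, integral_map hm₁.aemeasurable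
      (hF k).aestronglyMeasurable]
  rw [h2]
  have hFm : MemLp (fun ω => F k (fun i => X (d i) ω)) 2 P := by
    refine MemLp.mono (g := fun ω => |X (d 0) ω| + |u|) ((hX.memLp (d 0)).abs.add (memLp_const |u|))
      ((hF k).comp (measurable_pi_lambda _ fun i => (hmt (d i)))).aestronglyMeasurable
      (.of_forall fun ω => ?_)
    rw [Real.norm_of_nonneg (le_max_right _ _)]
    refine le_trans (max_le ?_ (by positivity)) (le_abs_self _)
    have h := Finset.inf'_le (fun i : Fin (k + 1) => X (d i) ω) (Finset.mem_univ 0)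
    simp only [Fin.val_zero] at h
    linarith [le_abs_self (X (d 0) ω), neg_abs_le u]
  simp_rw [Real.exp_sub, div_mul_eq_mul_div]
  refine integral_mono ((hX.integrable_exp_mul_excess hb c u).div_const _)
    (((hX.memLp_exp_linComb c).integrable_mul hFm).div_const _) fun ω => ?_
  have h3 : pathMin X b ω ≤ (Finset.univ : Finset (Fin (k + 1))).inf' Finset.univ_nonempty
      fun i => X (d i) ω := Finset.le_inf' _ _ fun i _ => hX.pathMin_le ω (hd i)
  simp only [F]
  gcongr

end IsStationaryGaussian
end Excess

section IntegrationByParts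

variable {Ω : Type*} [MeasurableSpace Ω] {P : Measure Ω} {X : ℝ → Ω → ℝ} {R : ℝ → ℝ} {b : ℝ}

theorem max_add_sub_max_le {a δ D u m : ℝ} (hδ : |δ| ≤ D) (ha : a = m - (u + 2 * D)) :
    max (a + δ) 0 ≤ max a 0 + (if u < m then δ else 0)
      + 2 * D * (Ioc u (u + 3 * D)).indicator 1 m := by
  obtain ⟨h1, h2⟩ := abs_le.1 hδ
  by_cases hm : u < m
  · rw [if_pos hm]
    by_cases hm2 : m ≤ u + 3 * D
    · rw [indicator_of_mem (show m ∈ Ioc u (u + 3 * D) from ⟨hm, hm2⟩)]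
      simp only [Pi.one_apply, mul_one]
      refine max_le ?_ ?_
      · linarith [le_max_left a 0]
      · linarith [le_max_right a 0]
    · rw [indicator_of_notMem (fun h => hm2 h.2)]
      refine max_le ?_ ?_
      · linarith [le_max_left a 0]
      · linarith [le_max_left a 0]
  · rw [if_neg hm, indicator_of_notMem (fun h => hm h.1)]
    refine max_le ?_ ?_
    · linarith [le_max_right a 0]
    · linarith [le_max_right a 0]

namespace IsStationaryGaussian

variable (hX : IsStationaryGaussian P X R)
include hX

theorem tendsto_integral_indicator_Ioc [IsProbabilityMeasure P] (hb : 0 ≤ b) (u : ℝ) :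
    Tendsto (fun e : ℝ => ∫ ω, (Ioc u (u + 3 * e)).indicator (1 : ℝ → ℝ) (pathMin X b ω) ∂P)
      (nhds 0) (nhds 0) := by
  have hm := hX.measurable_pathMin hb
  have key : Tendsto
      (fun e : ℝ => ∫ ω, (Ioc u (u + 3 * e)).indicator (1 : ℝ → ℝ) (pathMin X b ω) ∂P)
      (nhds 0) (nhds (∫ _, (0 : ℝ) ∂P)) := by
    refine tendsto_integral_filter_of_dominated_convergence (fun _ => 1) ?_ ?_
      (integrable_const _) ?_
    · refine .of_forall fun e => ?_
      exact ((measurable_one.indicator measurableSet_Ioc).comp hm).aestronglyMeasurable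
    · refine .of_forall fun e => .of_forall fun ω => ?_
      exact (norm_indicator_le_norm_self (1 : ℝ → ℝ) _).trans (by simp)
    · refine .of_forall fun ω => ?_
      refine tendsto_const_nhds.congr' ?_
      by_cases h : u < pathMin X b ω
      · have : ∀ᶠ e : ℝ in nhds 0, u + 3 * e < pathMin X b ω := by
          have hc : ContinuousAt (fun e : ℝ => u + 3 * e) 0 := by fun_prop
          exact hc.eventually_lt continuousAt_const (by simpa using h)
        filter_upwards [this] with e he
        rw [indicator_of_notMem (fun h => absurd h.2 (not_le.2 he))]
      · refine .of_forall fun e => ?_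
        simp only
        rw [indicator_of_notMem (fun h' => h h'.1)]
  simpa using key

/-- Gaussian integration by parts for the excess of the path minimum. -/
theorem integral_mul_excess [IsProbabilityMeasure P] (hb : 0 ≤ b) {T : Ω → ℝ}
    (hTm : Measurable T) (hT : ∀ ω, T ω ∈ Icc 0 b) (hTX : ∀ ω, X (T ω) ω = pathMin X b ω)
    (s u : ℝ) :
    ∫ ω, X s ω * max (pathMin X b ω - u) 0 ∂P
      = ∫ ω, (if u < pathMin X b ω then R (T ω - s) else 0) ∂P := by
  have hm := hX.measurable_pathMin hb
  have hR := hX.continuous_cov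
  have hXs := hX.memLp s
  have hXm := hX.measurable s
  have hRb := hX.abs_cov_le
  set C := R 0 with hC
  have hC0 : 0 ≤ C := hX.cov_zero_nonneg
  set A := ∫ ω, X s ω * max (pathMin X b ω - u) 0 ∂P with hA
  set B := ∫ ω, (if u < pathMin X b ω then R (T ω - s) else 0) ∂P with hB
  set M := ∫ ω, |X s ω| ∂P with hM
  set G := ∫ ω, max (pathMin X b ω - u) 0 ∂P with hG
  have hset : MeasurableSet {ω | u < pathMin X b ω} := measurableSet_lt measurable_const hm
  have iB : Integrable (fun ω => if u < pathMin X b ω then R (T ω - s) else 0) P := by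
    refine Integrable.of_bound (C := C) ?_ (.of_forall fun ω => ?_)
    · exact (Measurable.ite hset (hR.measurable.comp (hTm.sub_const s))
        measurable_const).aestronglyMeasurable
    · split_ifs
      · exact hRb _
      · simpa using hC0
  have key : ∀ ε : ℝ, ε * A ≤ ε * B + |ε| * |ε| * (2 * C * M + C * G / 2)
      + 2 * (C * |ε|) *
        ∫ ω, (Ioc u (u + 3 * (C * |ε|))).indicator (1 : ℝ → ℝ) (pathMin X b ω) ∂P := by
    intro ε
    set D := C * |ε| with hD
    have hD0 : 0 ≤ D := by positivity
    set u' := u + 2 * D with hu'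
    have cm := hX.integral_exp_mul_excess_le hb (Finsupp.single s ε) u'
    simp_rw [linComb_single, combCov_single, mul_pow] at cm
    rw [integral_const_mul, hX.integral_sq, ← hC] at cm
    have iE := hX.integrable_excess hb u'
    have iXE : Integrable (fun ω => X s ω * max (pathMin X b ω - u') 0) P :=
      hXs.integrable_mul (hX.memLp_excess hb u')
    have iXE0 : Integrable (fun ω => X s ω * max (pathMin X b ω - u) 0) P :=
      hXs.integrable_mul (hX.memLp_excess hb u)
    have iI : Integrable
        (fun ω => (Ioc u (u + 3 * D)).indicator (1 : ℝ → ℝ) (pathMin X b ω)) P := by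
      refine Integrable.of_bound (C := 1) ?_ (.of_forall fun ω => ?_)
      · exact ((measurable_one.indicator measurableSet_Ioc).comp hm).aestronglyMeasurable
      · exact (norm_indicator_le_norm_self (1 : ℝ → ℝ) _).trans (by simp)
    have low : ∫ ω, max (pathMin X b ω - u') 0 ∂P
        - ε ^ 2 * C / 2 * ∫ ω, max (pathMin X b ω - u') 0 ∂P
        + ε * ∫ ω, X s ω * max (pathMin X b ω - u') 0 ∂P
        ≤ ∫ ω, Real.exp (ε * X s ω - ε ^ 2 * C / 2) * max (pathMin X b ω - u') 0 ∂P := by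
      rw [← integral_const_mul, ← integral_const_mul, ← integral_sub iE (iE.const_mul _),
        ← integral_add (by exact iE.sub (iE.const_mul _)) (iXE.const_mul _)]
      refine integral_mono ((iE.sub (iE.const_mul _)).add (iXE.const_mul _)) ?_ fun ω => ?_
      · have := hX.integrable_exp_mul_excess hb (Finsupp.single s ε) u'
        simp_rw [linComb_single] at this
        simp_rw [Real.exp_sub, div_mul_eq_mul_div]
        exact this.div_const _
      · have h1 := Real.add_one_le_exp (ε * X s ω - ε ^ 2 * C / 2)
        have h2 := mul_le_mul_of_nonneg_right h1 (le_max_right (pathMin X b ω - u') 0)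
        simp only
        linarith
    have high : ∫ ω, max (infOn (fun t => X t ω + ε * R (t - s)) b - u') 0 ∂P
        ≤ ∫ ω, max (pathMin X b ω - u') 0 ∂P + ε * B
          + 2 * D * ∫ ω, (Ioc u (u + 3 * D)).indicator (1 : ℝ → ℝ) (pathMin X b ω) ∂P := by
      rw [hB, ← integral_const_mul, ← integral_const_mul, ← integral_add iE (iB.const_mul _),
        ← integral_add (by exact iE.add (iB.const_mul _)) (iI.const_mul _)]
      refine integral_mono_of_nonneg (.of_forall fun ω => le_max_right _ _)
        ((iE.add (iB.const_mul _)).add (iI.const_mul _)) (.of_forall fun ω => ?_)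
      have hcont : Continuous fun t => X t ω + ε * R (t - s) :=
        (hX.continuous ω).add (continuous_const.mul (hR.comp (continuous_id.sub continuous_const)))
      have h1 : infOn (fun t => X t ω + ε * R (t - s)) b
          ≤ pathMin X b ω + ε * R (T ω - s) := by
        rw [← hTX ω]; exact infOn_le hcont (hT ω)
      have hδ : |ε * R (T ω - s)| ≤ D := by
        rw [abs_mul, hD, mul_comm]
        exact mul_le_mul_of_nonneg_right (hRb _) (abs_nonneg _)
      have h2 := max_add_sub_max_le (u := u) (m := pathMin X b ω) hδ rfl
      have h3 : max (infOn (fun t => X t ω + ε * R (t - s)) b - u') 0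
          ≤ max (pathMin X b ω - (u + 2 * D) + ε * R (T ω - s)) 0 :=
        max_le_max (by linarith) le_rfl
      refine (h3.trans h2).trans (le_of_eq ?_)
      simp only [mul_ite, mul_zero, hu']
    have hGu : ∫ ω, max (pathMin X b ω - u') 0 ∂P ≤ G := by
      refine integral_mono iE (hX.integrable_excess hb u) fun ω => ?_
      exact max_le_max (by linarith) le_rfl
    have hAu : |∫ ω, X s ω * max (pathMin X b ω - u') 0 ∂P - A| ≤ 2 * D * M := by
      rw [hA, ← integral_sub iXE iXE0, hM, ← integral_const_mul]
      refine (abs_integral_le_integral_abs).trans (integral_mono_of_nonneg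
        (.of_forall fun ω => abs_nonneg _) ((hXs.integrable (by norm_num)).abs.const_mul _)
        (.of_forall fun ω => ?_))
      have h1 : |max (pathMin X b ω - u') 0 - max (pathMin X b ω - u) 0| ≤ 2 * D := by
        refine (abs_max_sub_max_le_abs _ _ _).trans ?_
        rw [hu', abs_le]; constructor <;> linarith
      simp only
      rw [← mul_sub, abs_mul, mul_comm]
      exact mul_le_mul_of_nonneg_right h1 (abs_nonneg _)
    have h5 : |ε| * |ε| = ε ^ 2 := by rw [abs_mul_abs_self]; ring
    have h6 : ε * A ≤ ε * ∫ ω, X s ω * max (pathMin X b ω - u') 0 ∂P + |ε| * (2 * D * M) := by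
      have h7 := mul_le_mul_of_nonneg_left hAu (abs_nonneg ε)
      rw [← abs_mul] at h7
      have := neg_le_of_abs_le h7
      linarith
    have h8 : ε ^ 2 * C / 2 * ∫ ω, max (pathMin X b ω - u') 0 ∂P ≤ ε ^ 2 * C / 2 * G := by
      gcongr
    have h9 : |ε| * (2 * D * M) = |ε| * |ε| * (2 * C * M) := by rw [hD]; ring
    have h10 : |ε| * |ε| * (2 * C * M + C * G / 2)
        = |ε| * |ε| * (2 * C * M) + ε ^ 2 * C / 2 * G := by
      rw [h5]; ring
    linarith
  have hlim : Tendsto (fun e : ℝ => e * (2 * C * M + C * G / 2) + 2 * C *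
      ∫ ω, (Ioc u (u + 3 * (C * e))).indicator (1 : ℝ → ℝ) (pathMin X b ω) ∂P)
      (nhdsWithin 0 (Ioi 0)) (nhds (0 * (2 * C * M + C * G / 2) + 2 * C * 0)) := by
    refine Tendsto.mono_left ?_ nhdsWithin_le_nhds
    refine (tendsto_id.mul_const _).add (Tendsto.const_mul _ ?_)
    have h1 : Tendsto (fun e : ℝ => C * e) (nhds 0) (nhds 0) := by
      have : ContinuousAt (fun e : ℝ => C * e) 0 := by fun_prop
      simpa [ContinuousAt] using this
    exact (hX.tendsto_integral_indicator_Ioc hb u).comp h1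
  have hfin : |A - B| ≤ 0 * (2 * C * M + C * G / 2) + 2 * C * 0 := by
    refine ge_of_tendsto hlim ?_
    filter_upwards [self_mem_nhdsWithin] with e he
    have he : 0 < e := he
    have k1 := key e
    have k2 := key (-e)
    rw [abs_neg] at k2
    rw [abs_of_pos he] at k1 k2
    set J := ∫ ω, (Ioc u (u + 3 * (C * e))).indicator (1 : ℝ → ℝ) (pathMin X b ω) ∂P
    rw [abs_le]
    constructor <;> refine le_of_mul_le_mul_left ?_ he <;> nlinarith
  simp only [zero_mul, mul_zero, add_zero] at hfin
  exact sub_eq_zero.1 (abs_eq_zero.1 (le_antisymm hfin (abs_nonneg _)))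

end IsStationaryGaussian
end IntegrationByParts

section Energy

variable {Ω : Type*} [MeasurableSpace Ω] {P : Measure Ω} {X : ℝ → Ω → ℝ} {R : ℝ → ℝ} {b : ℝ}

section SecondOrder

variable [IsProbabilityMeasure P] {Z : ℝ → Ω → ℝ} {C : ℝ}

theorem integrable_mul_prod (hZ : Measurable (Function.uncurry Z)) (hL : ∀ t, MemLp (Z t) 2 P)
    (hC : ∀ t, ∫ ω, Z t ω ^ 2 ∂P ≤ C) (ν μ : Measure ℝ) [IsFiniteMeasure ν] [IsFiniteMeasure μ] :
    Integrable (fun q : (ℝ × ℝ) × Ω => Z q.1.1 q.2 * Z q.1.2 q.2) ((ν.prod μ).prod P) := by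
  have hm : Measurable fun q : (ℝ × ℝ) × Ω => Z q.1.1 q.2 * Z q.1.2 q.2 :=
    (hZ.comp ((measurable_fst.comp measurable_fst).prodMk measurable_snd)).mul
      (hZ.comp ((measurable_snd.comp measurable_fst).prodMk measurable_snd))
  rw [integrable_prod_iff hm.aestronglyMeasurable]
  refine ⟨.of_forall fun p => (hL p.1).integrable_mul (hL p.2), ?_⟩
  refine Integrable.of_bound (C := C) ?_ (.of_forall fun p => ?_)
  · exact (hm.norm.stronglyMeasurable.integral_prod_right (ν := P)).aestronglyMeasurable
  · rw [Real.norm_of_nonneg (by positivity)]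
    have h : ∫ ω, ‖Z p.1 ω * Z p.2 ω‖ ∂P ≤ ∫ ω, (Z p.1 ω ^ 2 / 2 + Z p.2 ω ^ 2 / 2) ∂P := by
      refine integral_mono ((hL p.1).integrable_mul (hL p.2)).norm
        (((hL p.1).integrable_sq.div_const 2).add ((hL p.2).integrable_sq.div_const 2))
        fun ω => ?_
      simp only [norm_mul, Real.norm_eq_abs]
      nlinarith [sq_nonneg (|Z p.1 ω| - |Z p.2 ω|), sq_abs (Z p.1 ω), sq_abs (Z p.2 ω)]
    rw [integral_add ((hL p.1).integrable_sq.div_const 2) ((hL p.2).integrable_sq.div_const 2),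
      integral_div, integral_div] at h
    linarith [hC p.1, hC p.2]

theorem memLp_integral (hZ : Measurable (Function.uncurry Z)) (hL : ∀ t, MemLp (Z t) 2 P)
    (hC : ∀ t, ∫ ω, Z t ω ^ 2 ∂P ≤ C) (ν : Measure ℝ) [IsFiniteMeasure ν] :
    MemLp (fun ω => ∫ t, Z t ω ∂ν) 2 P := by
  have hm : StronglyMeasurable fun ω => ∫ t, Z t ω ∂ν :=
    (hZ.comp measurable_swap).stronglyMeasurable.integral_prod_right' (ν := ν)
  rw [memLp_two_iff_integrable_sq hm.aestronglyMeasurable]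
  refine (integrable_mul_prod hZ hL hC ν ν).integral_prod_right.congr (.of_forall fun ω => ?_)
  simp only
  rw [integral_prod_mul (fun t => Z t ω) (fun t => Z t ω), sq]

theorem integral_integral_mul_integral (hZ : Measurable (Function.uncurry Z))
    (hL : ∀ t, MemLp (Z t) 2 P) (hC : ∀ t, ∫ ω, Z t ω ^ 2 ∂P ≤ C)
    (ν μ : Measure ℝ) [IsFiniteMeasure ν] [IsFiniteMeasure μ] :
    ∫ ω, (∫ s, Z s ω ∂ν) * (∫ t, Z t ω ∂μ) ∂P
      = ∫ s, ∫ t, (∫ ω, Z s ω * Z t ω ∂P) ∂μ ∂ν := by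
  have hi := integrable_mul_prod hZ hL hC ν μ
  simp_rw [← integral_prod_mul (fun s => Z s _) (fun t => Z t _)]
  rw [← integral_integral_swap (f := fun (p : ℝ × ℝ) ω => Z p.1 ω * Z p.2 ω) hi,
    integral_prod _ hi.integral_prod_left]

end SecondOrder

/-- A probability measure concentrated on `[0, b]`. -/
structure IsProbOn (b : ℝ) (ν : Measure ℝ) : Prop where
  isProbabilityMeasure : IsProbabilityMeasure ν
  compl_eq_zero : ν (Icc 0 b)ᶜ = 0

/-- The potential of the measure `ν` for the kernel `R`. -/
noncomputable def potential (R : ℝ → ℝ) (ν : Measure ℝ) (s : ℝ) : ℝ := ∫ t, R (t - s) ∂ν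

/-- The mutual energy of two measures for the kernel `R`. -/
noncomputable def mutualEnergy (R : ℝ → ℝ) (ν μ : Measure ℝ) : ℝ := ∫ s, potential R μ s ∂ν

theorem statEnergy_eq_mutualEnergy (R : ℝ → ℝ) (ν : Measure ℝ) :
    statEnergy R ν = mutualEnergy R ν ν := rfl

theorem mutualEnergy_dirac (R : ℝ → ℝ) (ν : Measure ℝ) (x : ℝ) :
    mutualEnergy R (Measure.dirac x) ν = potential R ν x := by
  simp [mutualEnergy]

theorem IsProbOn.ae_mem {ν : Measure ℝ} (h : IsProbOn b ν) : ∀ᵐ t ∂ν, t ∈ Icc 0 b :=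
  h.compl_eq_zero

theorem IsProbOn.dirac {x : ℝ} (hx : x ∈ Icc 0 b) : IsProbOn b (Measure.dirac x) :=
  ⟨inferInstance, by
    rw [Measure.dirac_apply' _ measurableSet_Icc.compl]
    simp [hx.1, hx.2]⟩

theorem IsProbOn.mix {ν μ : Measure ℝ} (hν : IsProbOn b ν) (hμ : IsProbOn b μ) {c : NNReal}
    (hc : c ≤ 1) : IsProbOn b ((1 - c) • ν + c • μ) := by
  have := hν.1
  have := hμ.1
  refine ⟨⟨?_⟩, ?_⟩
  · simp only [Measure.coe_add, Measure.coe_nnreal_smul_apply, Pi.add_apply, measure_univ, mul_one]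
    rw [← ENNReal.coe_add, tsub_add_cancel_of_le hc, ENNReal.coe_one]
  · simp [hν.2, hμ.2]

namespace IsStationaryGaussian

variable (hX : IsStationaryGaussian P X R)
include hX

theorem measurable_uncurry : Measurable (Function.uncurry X) :=
  measurable_uncurry_of_continuous_of_measurable hX.continuous hX.measurable

theorem abs_potential_le (ν : Measure ℝ) [IsProbabilityMeasure ν] (s : ℝ) :
    |potential R ν s| ≤ R 0 := by
  have := norm_integral_le_of_norm_le_const (μ := ν) (f := fun t => R (t - s))
    (.of_forall fun t => hX.abs_cov_le (t - s))
  simpa [potential] using this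

variable [IsProbabilityMeasure P]

theorem integrable_kernel (ν : Measure ℝ) [IsFiniteMeasure ν] (s : ℝ) :
    Integrable (fun t => R (t - s)) ν := by
  have := hX.continuous_cov
  exact Integrable.of_bound (by fun_prop) (R 0) (.of_forall fun t => hX.abs_cov_le _)

theorem continuous_potential (ν : Measure ℝ) [IsFiniteMeasure ν] : Continuous (potential R ν) := by
  have := hX.continuous_cov
  refine continuous_of_dominated (bound := fun _ => R 0) (fun s => ?_)
    (fun s => .of_forall fun t => hX.abs_cov_le _) (integrable_const _)
    (.of_forall fun t => by fun_prop)
  fun_prop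

theorem integrable_potential (ν μ : Measure ℝ) [IsProbabilityMeasure ν] [IsFiniteMeasure μ] :
    Integrable (potential R ν) μ :=
  Integrable.of_bound (hX.continuous_potential ν).aestronglyMeasurable (R 0)
    (.of_forall fun t => hX.abs_potential_le ν t)

theorem integral_integral_path_mul (ν μ : Measure ℝ) [IsFiniteMeasure ν] [IsFiniteMeasure μ] :
    ∫ ω, (∫ s, X s ω ∂ν) * (∫ t, X t ω ∂μ) ∂P = mutualEnergy R ν μ := by
  rw [integral_integral_mul_integral hX.measurable_uncurry hX.memLp
    (fun t => (hX.integral_sq t).le)]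
  simp_rw [hX.cov]
  rfl

theorem memLp_integral_path (ν : Measure ℝ) [IsFiniteMeasure ν] :
    MemLp (fun ω => ∫ t, X t ω ∂ν) 2 P :=
  memLp_integral hX.measurable_uncurry hX.memLp (fun t => (hX.integral_sq t).le) ν

theorem mutualEnergy_comm (ν μ : Measure ℝ) [IsFiniteMeasure ν] [IsFiniteMeasure μ] :
    mutualEnergy R ν μ = mutualEnergy R μ ν := by
  rw [← hX.integral_integral_path_mul, ← hX.integral_integral_path_mul]
  simp_rw [mul_comm]

theorem integral_path_sub_sq (ν μ : Measure ℝ) [IsFiniteMeasure ν] [IsFiniteMeasure μ] :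
    ∫ ω, ((∫ t, X t ω ∂ν) - ∫ t, X t ω ∂μ) ^ 2 ∂P
      = mutualEnergy R ν ν - 2 * mutualEnergy R ν μ + mutualEnergy R μ μ := by
  have h1 := hX.memLp_integral_path ν
  have h2 := hX.memLp_integral_path μ
  have e : ∀ ω, ((∫ t, X t ω ∂ν) - ∫ t, X t ω ∂μ) ^ 2
      = (∫ t, X t ω ∂ν) * (∫ t, X t ω ∂ν) - 2 * ((∫ t, X t ω ∂ν) * ∫ t, X t ω ∂μ)
        + (∫ t, X t ω ∂μ) * (∫ t, X t ω ∂μ) := by intro ω; ring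
  simp_rw [e]
  have i2 : Integrable (fun ω => 2 * ((∫ t, X t ω ∂ν) * ∫ t, X t ω ∂μ)) P :=
    (h1.integrable_mul h2).const_mul 2
  have i1 : Integrable (fun ω => (∫ t, X t ω ∂ν) * (∫ t, X t ω ∂ν)) P := h1.integrable_mul h1
  have i3 : Integrable (fun ω => (∫ t, X t ω ∂μ) * (∫ t, X t ω ∂μ)) P := h2.integrable_mul h2
  rw [integral_add (by exact i1.sub i2) i3, integral_sub i1 i2, integral_const_mul,
    hX.integral_integral_path_mul, hX.integral_integral_path_mul, hX.integral_integral_path_mul]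

/-- Measures at zero energy distance have the same potential. -/
theorem potential_eq_of_energy_le (ν μ : Measure ℝ) [IsFiniteMeasure ν] [IsFiniteMeasure μ]
    (h : mutualEnergy R ν ν - 2 * mutualEnergy R ν μ + mutualEnergy R μ μ ≤ 0) (x : ℝ) :
    potential R ν x = potential R μ x := by
  have h1 := hX.memLp_integral_path ν
  have h2 := hX.memLp_integral_path μ
  rw [← hX.integral_path_sub_sq] at h
  have h3 := abs_integral_mul_le (hX.memLp x) (h1.sub h2)
  simp only [Pi.sub_apply] at h3
  rw [Real.sqrt_eq_zero'.2 h, mul_zero] at h3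
  have h4 := abs_eq_zero.1 (le_antisymm h3 (abs_nonneg _))
  simp_rw [mul_sub] at h4
  have i1 : Integrable (fun ω => X x ω * (∫ t, X t ω ∂ν)) P := (hX.memLp x).integrable_mul h1
  have i2 : Integrable (fun ω => X x ω * (∫ t, X t ω ∂μ)) P := (hX.memLp x).integrable_mul h2
  rw [integral_sub i1 i2] at h4
  have e : ∀ ρ : Measure ℝ, IsFiniteMeasure ρ →
      ∫ ω, X x ω * (∫ t, X t ω ∂ρ) ∂P = potential R ρ x := by
    intro ρ hρ
    rw [← mutualEnergy_dirac R ρ x, ← hX.integral_integral_path_mul]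
    simp
  rw [e ν inferInstance, e μ inferInstance] at h4
  linarith

theorem mutualEnergy_mix (ν μ : Measure ℝ) [IsProbabilityMeasure ν] [IsProbabilityMeasure μ]
    {c : NNReal} (hc : c ≤ 1) :
    statEnergy R ((1 - c) • ν + c • μ) = (1 - c) ^ 2 * statEnergy R ν
      + 2 * (1 - c) * c * mutualEnergy R ν μ + c ^ 2 * statEnergy R μ := by
  have hp : ∀ s, potential R ((1 - c) • ν + c • μ) s
      = (1 - c) * potential R ν s + c * potential R μ s := by
    intro s
    unfold potential
    rw [integral_add_measure ((hX.integrable_kernel ν s).smul_measure_nnreal)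
      ((hX.integrable_kernel μ s).smul_measure_nnreal), integral_smul_nnreal_measure,
      integral_smul_nnreal_measure, NNReal.smul_def, NNReal.smul_def, NNReal.coe_sub hc]
    simp
  have i : ∀ ρ : Measure ℝ, IsProbabilityMeasure ρ → Integrable
      (fun s => (1 - c) * potential R ν s + c * potential R μ s) ρ := fun ρ hρ =>
    ((hX.integrable_potential ν ρ).const_mul _).add ((hX.integrable_potential μ ρ).const_mul _)
  rw [statEnergy_eq_mutualEnergy, mutualEnergy]
  simp_rw [hp]
  rw [integral_add_measure ((i ν inferInstance).smul_measure_nnreal)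
      ((i μ inferInstance).smul_measure_nnreal), integral_smul_nnreal_measure,
      integral_smul_nnreal_measure, NNReal.smul_def, NNReal.smul_def, NNReal.coe_sub hc,
      integral_add ((hX.integrable_potential ν ν).const_mul _)
        ((hX.integrable_potential μ ν).const_mul _),
      integral_add ((hX.integrable_potential ν μ).const_mul _)
        ((hX.integrable_potential μ μ).const_mul _), integral_const_mul, integral_const_mul,
      integral_const_mul, integral_const_mul]
  have h := hX.mutualEnergy_comm μ ν
  simp only [mutualEnergy] at h
  rw [h, statEnergy_eq_mutualEnergy, statEnergy_eq_mutualEnergy]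
  simp only [mutualEnergy, smul_eq_mul, NNReal.coe_one]
  ring

/-- The first-order optimality condition for a measure of minimal energy. -/
theorem energy_le_mutualEnergy {ν μ : Measure ℝ} (hν : IsProbOn b ν) (hμ : IsProbOn b μ)
    (hopt : ∀ ρ : Measure ℝ, IsProbOn b ρ → statEnergy R ν ≤ statEnergy R ρ) :
    statEnergy R ν ≤ mutualEnergy R ν μ := by
  have := hν.1
  have := hμ.1
  by_contra! hlt
  set I := statEnergy R ν
  set J := statEnergy R μ
  set B := mutualEnergy R ν μ
  have key : ∀ c : ℝ, 0 < c → c ≤ 1 → 2 * (I - B) ≤ c * (I - 2 * B + J) := by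
    intro c hc0 hc1
    have hc : (⟨c, hc0.le⟩ : NNReal) ≤ 1 := hc1
    have h := hopt _ (hν.mix hμ hc)
    rw [hX.mutualEnergy_mix ν μ hc] at h
    have h : I ≤ (1 - c) ^ 2 * I + 2 * (1 - c) * c * B + c ^ 2 * J := h
    refine le_of_mul_le_mul_left ?_ hc0
    nlinarith
  have h1 := key 1 one_pos le_rfl
  have hD : 0 < I - 2 * B + J := by linarith
  have h2 := key (min 1 ((I - B) / (I - 2 * B + J)))
    (lt_min one_pos (div_pos (by linarith) hD)) (min_le_left _ _)
  have h3 := mul_le_mul_of_nonneg_right (min_le_right 1 ((I - B) / (I - 2 * B + J))) hD.le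
  rw [div_mul_cancel₀ _ hD.ne'] at h3
  linarith

end IsStationaryGaussian
end Energy

section SecondDifference

/-- The negative of the second difference of `R` with step `ε`. -/
noncomputable def negSecondDiff (R : ℝ → ℝ) (ε r : ℝ) : ℝ := 2 * R r - R (r + ε) - R (r - ε)

theorem ConvexOn.negSecondDiff_nonpos {R : ℝ → ℝ} {b ε r : ℝ} (hR : ConvexOn ℝ (Icc 0 b) R)
    (h1 : 0 ≤ ε) (h2 : ε ≤ r) (h3 : r ≤ b - ε) : negSecondDiff R ε r ≤ 0 := by
  have hr₁ : r + ε ∈ Icc 0 b := ⟨by linarith, by linarith⟩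
  have hr₂ : r - ε ∈ Icc 0 b := ⟨by linarith, by linarith⟩
  have h := hR.2 hr₁ hr₂ (show (0 : ℝ) ≤ 1 / 2 by norm_num) (show (0 : ℝ) ≤ 1 / 2 by norm_num)
    (by norm_num)
  simp only [smul_eq_mul] at h
  rw [show 1 / 2 * (r + ε) + 1 / 2 * (r - ε) = r by ring] at h
  unfold negSecondDiff
  linarith

theorem intervalIntegral_negSecondDiff {R : ℝ → ℝ} (hR : Continuous R) (ε c d : ℝ) :
    ∫ r in c..d, negSecondDiff R ε r
      = (∫ x in (c - ε)..c, (R (x + ε) - R x)) - ∫ x in (d - ε)..d, (R (x + ε) - R x) := by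
  have hS : Continuous fun x => R (x + ε) - R x := by fun_prop
  have e : ∀ r, negSecondDiff R ε r = (R ((r - ε) + ε) - R (r - ε)) - (R (r + ε) - R r) := by
    intro r; unfold negSecondDiff; rw [sub_add_cancel]; ring
  simp_rw [e]
  have hS' : Continuous fun x => R (x - ε + ε) - R (x - ε) := by fun_prop
  rw [intervalIntegral.integral_sub (hS'.intervalIntegrable _ _) (hS.intervalIntegrable _ _),
    intervalIntegral.integral_comp_sub_right (fun x => R (x + ε) - R x)]
  have h1 := intervalIntegral.integral_add_adjacent_intervals
    (hS.intervalIntegrable (c - ε) c (μ := volume)) (hS.intervalIntegrable c (d - ε))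
  have h2 := intervalIntegral.integral_add_adjacent_intervals
    (hS.intervalIntegrable c (d - ε) (μ := volume)) (hS.intervalIntegrable (d - ε) d)
  linarith

theorem StrictConvexOn.exists_intervalIntegral_negSecondDiff_le {R : ℝ → ℝ} {b c d : ℝ}
    (hR : StrictConvexOn ℝ (Icc 0 b) R) (hcont : Continuous R) (hc : 0 < c) (hcd : c < d)
    (hd : d < b) :
    ∃ k > 0, ∀ᶠ ε : ℝ in nhdsWithin 0 (Ioi 0),
      ∫ r in c..d, negSecondDiff R ε r ≤ -(k * ε ^ 2) := by
  set e := (d - c) / 4 with he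
  have he0 : 0 < e := by rw [he]; linarith
  have hcv := hR.convexOn
  set m₁ := (R (c + 2 * e) - R (c + e)) / e with hm₁
  set m₂ := (R (c + 3 * e) - R (c + 2 * e)) / e with hm₂
  have hmem : ∀ x, 0 ≤ x → x ≤ b → x ∈ Icc 0 b := fun x h1 h2 => ⟨h1, h2⟩
  have hm : m₁ < m₂ := by
    have := hR.slope_strict_mono_adjacent (x := c + e) (y := c + 2 * e) (z := c + 3 * e)
      (hmem _ (by linarith) (by linarith)) (hmem _ (by linarith) (by linarith))
      (by linarith) (by linarith)
    rw [show c + 2 * e - (c + e) = e by ring, show c + 3 * e - (c + 2 * e) = e by ring] at this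
    exact this
  refine ⟨m₂ - m₁, by linarith, ?_⟩
  have hev : ∀ᶠ ε : ℝ in nhdsWithin 0 (Ioi 0), ε < min (min c e) (b - d) :=
    nhdsWithin_le_nhds (eventually_lt_nhds (lt_min (lt_min hc he0) (by linarith)))
  filter_upwards [hev, self_mem_nhdsWithin] with ε h1 h2
  have h2 : 0 < ε := h2
  obtain ⟨h3, h4⟩ := lt_min_iff.1 h1
  obtain ⟨h5, h6⟩ := lt_min_iff.1 h3
  have hS : Continuous fun x => R (x + ε) - R x := by fun_prop
  have up : ∀ x ∈ Icc (c - ε) c, R (x + ε) - R x ≤ ε * m₁ := by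
    intro x hx
    have s1 := hcv.slope_mono_adjacent (x := x) (y := x + ε) (z := c + e)
      (hmem _ (by linarith [hx.1]) (by linarith [hx.2])) (hmem _ (by linarith) (by linarith))
      (by linarith) (by linarith [hx.2])
    have s2 := hcv.slope_mono_adjacent (x := x + ε) (y := c + e) (z := c + 2 * e)
      (hmem _ (by linarith [hx.1]) (by linarith [hx.2])) (hmem _ (by linarith) (by linarith))
      (by linarith [hx.2]) (by linarith)
    have s3 := s1.trans s2
    rw [show c + 2 * e - (c + e) = e by ring, add_sub_cancel_left, div_le_iff₀ h2] at s3
    linarith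
  have low : ∀ x ∈ Icc (d - ε) d, ε * m₂ ≤ R (x + ε) - R x := by
    intro x hx
    have s1 := hcv.slope_mono_adjacent (x := c + 3 * e) (y := x) (z := x + ε)
      (hmem _ (by linarith) (by linarith)) (hmem _ (by linarith [hx.1]) (by linarith [hx.2]))
      (by linarith [hx.1]) (by linarith [hx.2])
    have s2 := hcv.slope_mono_adjacent (x := c + 2 * e) (y := c + 3 * e) (z := x)
      (hmem _ (by linarith) (by linarith)) (hmem _ (by linarith [hx.1]) (by linarith [hx.2]))
      (by linarith) (by linarith [hx.1])
    have s3 := s2.trans s1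
    rw [show c + 3 * e - (c + 2 * e) = e by ring, add_sub_cancel_left, le_div_iff₀ h2] at s3
    linarith
  rw [intervalIntegral_negSecondDiff hcont]
  have i1 := intervalIntegral.integral_mono_on (show c - ε ≤ c by linarith)
    (hS.intervalIntegrable _ _) intervalIntegrable_const up (μ := volume)
  have i2 := intervalIntegral.integral_mono_on (show d - ε ≤ d by linarith)
    intervalIntegrable_const (hS.intervalIntegrable _ _) low (μ := volume)
  simp only [intervalIntegral.integral_const, sub_sub_cancel, smul_eq_mul] at i1 i2
  nlinarith

namespace IsStationaryGaussian

variable {Ω : Type*} [MeasurableSpace Ω] {P : Measure Ω} {X : ℝ → Ω → ℝ} {R : ℝ → ℝ}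
  (hX : IsStationaryGaussian P X R)
include hX

theorem integral_increment_mul (ε s t : ℝ) :
    ∫ ω, (X (s + ε) ω - X s ω) * (X (t + ε) ω - X t ω) ∂P = negSecondDiff R ε (t - s) := by
  have e : ∀ ω, (X (s + ε) ω - X s ω) * (X (t + ε) ω - X t ω)
      = X (s + ε) ω * X (t + ε) ω - X (s + ε) ω * X t ω
        - (X s ω * X (t + ε) ω - X s ω * X t ω) := by intro ω; ring
  have i := hX.integrable_mul
  simp_rw [e]
  rw [integral_sub (by exact (i _ _).sub (i _ _)) (by exact (i _ _).sub (i _ _)),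
    integral_sub (i _ _) (i _ _), integral_sub (i _ _) (i _ _), hX.cov, hX.cov, hX.cov, hX.cov]
  unfold negSecondDiff
  rw [show t + ε - (s + ε) = t - s by ring, show t - (s + ε) = t - s - ε by ring,
    show t + ε - s = t - s + ε by ring]
  ring

theorem negSecondDiff_le (ε r : ℝ) : negSecondDiff R ε r ≤ 2 * (R 0 - R ε) := by
  have h := abs_integral_mul_le ((hX.memLp (0 + ε)).sub (hX.memLp 0))
    ((hX.memLp (r + ε)).sub (hX.memLp r))
  simp only [Pi.sub_apply] at h
  rw [hX.integral_increment_mul, hX.integral_sub_sq, hX.integral_sub_sq, zero_add, sub_zero,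
    sub_zero, add_sub_cancel_left, Real.mul_self_sqrt (by linarith [hX.cov_le ε])] at h
  exact (le_abs_self _).trans h

theorem negSecondDiff_neg (ε r : ℝ) : negSecondDiff R ε (-r) = negSecondDiff R ε r := by
  unfold negSecondDiff
  rw [hX.cov_neg, ← hX.cov_neg (-r + ε), ← hX.cov_neg (-r - ε)]
  ring_nf

end IsStationaryGaussian
end SecondDifference

section NullProfile

/-- A right-continuous function of bounded variation supported in `[0, b)` whose potential for
the kernel `R` is constant on the line. -/
structure IsNullProfile (R : ℝ → ℝ) (b : ℝ) (g : ℝ → ℝ) : Prop where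
  measurable : Measurable g
  bounded : ∃ M, ∀ t, |g t| ≤ M
  eq_zero : ∀ t ∉ Ico 0 b, g t = 0
  right_continuous : ∀ t, ContinuousWithinAt g (Ici t) t
  variation : ∃ C, ∀ r, ∫ s, |g (s + r) - g s| ≤ C * |r|
  potential : ∃ k, ∀ x, ∫ t, g t * R (t - x) = k

theorem integrable_of_bounded_of_support {g : ℝ → ℝ} {a b M : ℝ} (hm : Measurable g)
    (hM : ∀ t, |g t| ≤ M) (h0 : ∀ t ∉ Icc a b, g t = 0) : Integrable g := by
  rw [← integrableOn_iff_integrable_of_support_subset (s := Icc a b)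
    (fun t ht => by by_contra h; exact ht (h0 t h))]
  exact Integrable.of_bound (C := M) hm.aestronglyMeasurable (.of_forall hM)

namespace IsNullProfile

variable {R : ℝ → ℝ} {b : ℝ} {g h : ℝ → ℝ}

theorem eq_zero_of_notMem_Icc (hg : IsNullProfile R b g) : ∀ t ∉ Icc 0 b, g t = 0 :=
  fun t ht => hg.eq_zero t fun h => ht (Ico_subset_Icc_self h)

theorem integrable (hg : IsNullProfile R b g) : Integrable g := by
  obtain ⟨M, hM⟩ := hg.bounded
  exact integrable_of_bounded_of_support hg.measurable hM hg.eq_zero_of_notMem_Icc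

theorem integrable_mul_kernel (hg : IsNullProfile R b g) (hR : Continuous R) {C : ℝ}
    (hC : ∀ t, |R t| ≤ C) (x : ℝ) : Integrable fun t => g t * R (t - x) :=
  hg.integrable.mul_bdd (c := C) (by fun_prop) (.of_forall fun t => hC _)

theorem add (hg : IsNullProfile R b g) (hh : IsNullProfile R b h) (hR : Continuous R) {C : ℝ}
    (hC : ∀ t, |R t| ≤ C) : IsNullProfile R b fun t => g t + h t where
  measurable := hg.measurable.add hh.measurable
  bounded := by
    obtain ⟨M, hM⟩ := hg.bounded
    obtain ⟨N, hN⟩ := hh.bounded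
    exact ⟨M + N, fun t => (abs_add_le _ _).trans (add_le_add (hM t) (hN t))⟩
  eq_zero t ht := by rw [hg.eq_zero t ht, hh.eq_zero t ht, add_zero]
  right_continuous t := (hg.right_continuous t).add (hh.right_continuous t)
  variation := by
    obtain ⟨M, hM⟩ := hg.variation
    obtain ⟨N, hN⟩ := hh.variation
    refine ⟨M + N, fun r => ?_⟩
    have i1 := ((hg.integrable.comp_add_right r).sub hg.integrable).abs
    have i2 := ((hh.integrable.comp_add_right r).sub hh.integrable).abs
    calc ∫ s, |g (s + r) + h (s + r) - (g s + h s)|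
        ≤ ∫ s, (|g (s + r) - g s| + |h (s + r) - h s|) := by
          refine integral_mono_of_nonneg (.of_forall fun s => abs_nonneg _) (i1.add i2)
            (.of_forall fun s => ?_)
          simp only
          rw [add_sub_add_comm]
          exact abs_add_le _ _
      _ = (∫ s, |g (s + r) - g s|) + ∫ s, |h (s + r) - h s| := integral_add i1 i2
      _ ≤ (M + N) * |r| := by rw [add_mul]; exact add_le_add (hM r) (hN r)
  potential := by
    obtain ⟨k, hk⟩ := hg.potential
    obtain ⟨l, hl⟩ := hh.potential
    refine ⟨k + l, fun x => ?_⟩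
    simp_rw [add_mul]
    rw [integral_add (hg.integrable_mul_kernel hR hC x) (hh.integrable_mul_kernel hR hC x),
      hk, hl]

theorem const_mul (hg : IsNullProfile R b g) (a : ℝ) : IsNullProfile R b fun t => a * g t where
  measurable := hg.measurable.const_mul a
  bounded := by
    obtain ⟨M, hM⟩ := hg.bounded
    exact ⟨|a| * M, fun t => by rw [abs_mul]; exact mul_le_mul_of_nonneg_left (hM t) (abs_nonneg a)⟩
  eq_zero t ht := by rw [hg.eq_zero t ht, mul_zero]
  right_continuous t := (hg.right_continuous t).const_mul a
  variation := by
    obtain ⟨M, hM⟩ := hg.variation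
    refine ⟨|a| * M, fun r => ?_⟩
    simp_rw [← mul_sub, abs_mul]
    rw [integral_const_mul, mul_assoc]
    exact mul_le_mul_of_nonneg_left (hM r) (abs_nonneg a)
  potential := by
    obtain ⟨k, hk⟩ := hg.potential
    refine ⟨a * k, fun x => ?_⟩
    simp_rw [mul_assoc]
    rw [integral_const_mul, hk]

end IsNullProfile

/-- Twice the negative part of `g s * g t`. -/
noncomputable def signDefect (g : ℝ → ℝ) (s t : ℝ) : ℝ := |g s| * |g t| - g s * g t

section SignDefect

variable {R : ℝ → ℝ} {b M : ℝ} {g : ℝ → ℝ}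

theorem signDefect_nonneg (g : ℝ → ℝ) (s t : ℝ) : 0 ≤ signDefect g s t := by
  unfold signDefect
  rw [← abs_mul]
  linarith [le_abs_self (g s * g t)]

theorem signDefect_le_sq (hM : ∀ t, |g t| ≤ M) (s t : ℝ) : signDefect g s t ≤ 2 * M ^ 2 := by
  have h1 : |g s| * |g t| ≤ M * M :=
    mul_le_mul (hM s) (hM t) (abs_nonneg _) ((abs_nonneg _).trans (hM s))
  have h2 := neg_abs_le (g s * g t)
  rw [abs_mul] at h2
  unfold signDefect
  nlinarith

theorem signDefect_le_abs_sub (hM : ∀ t, |g t| ≤ M) (s t : ℝ) :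
    signDefect g s t ≤ 2 * M * |g t - g s| := by
  have hM0 : 0 ≤ M := (abs_nonneg _).trans (hM s)
  unfold signDefect
  rw [← abs_mul]
  rcases le_total 0 (g s * g t) with h | h
  · rw [abs_of_nonneg h, sub_self]; positivity
  · rw [abs_of_nonpos h]
    have h1 : |g s| ≤ |g t - g s| := by
      refine sq_le_sq.1 ?_
      nlinarith [sq_nonneg (g t)]
    have h2 : -(g s * g t) ≤ |g s| * |g t| := by rw [← abs_mul]; exact neg_le_abs _
    have h3 : |g s| * |g t| ≤ |g t - g s| * M :=
      mul_le_mul h1 (hM t) (abs_nonneg _) (abs_nonneg _)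
    linarith

theorem measurable_signDefect (hm : Measurable g) :
    Measurable fun p : ℝ × ℝ => signDefect g p.1 p.2 := by
  unfold signDefect
  fun_prop

theorem signDefect_eq_zero (h0 : ∀ t ∉ Ico 0 b, g t = 0) {s t : ℝ}
    (h : ¬ (s ∈ Ico 0 b ∧ t ∈ Ico 0 b)) : signDefect g s t = 0 := by
  unfold signDefect
  by_cases hs : s ∈ Ico 0 b
  · simp [h0 t fun ht => h ⟨hs, ht⟩]
  · simp [h0 s hs]

/-- The correlation at lag `r` of the sign defect of `g`. -/
noncomputable def lagDefect (g : ℝ → ℝ) (r : ℝ) : ℝ := ∫ s, signDefect g s (s + r)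

theorem lagDefect_nonneg (g : ℝ → ℝ) (r : ℝ) : 0 ≤ lagDefect g r :=
  integral_nonneg fun _ => signDefect_nonneg g _ _

theorem lagDefect_le (hM : ∀ t, |g t| ≤ M) (h0 : ∀ t ∉ Ico 0 b, g t = 0) (r : ℝ) :
    lagDefect g r ≤ 2 * M ^ 2 * max (b - |r|) 0 := by
  set S := Ico (max 0 (-r)) (min b (b - r)) with hS
  have hSv : volume.real S = max (b - |r|) 0 := by
    rw [hS, Real.volume_real_Ico]
    congr 1
    rcases le_total 0 r with h | h
    · rw [abs_of_nonneg h, max_eq_left (by linarith), min_eq_right (by linarith)]; ring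
    · rw [abs_of_nonpos h, max_eq_right (by linarith), min_eq_left (by linarith)]
  have hmS : MeasurableSet S := measurableSet_Ico
  have h1 : lagDefect g r ≤ ∫ s, S.indicator (fun _ => 2 * M ^ 2) s := by
    refine integral_mono_of_nonneg (.of_forall fun s => signDefect_nonneg g _ _)
      ((integrable_indicator_iff hmS).2 (integrableOn_const (by rw [hS]; simp)))
      (.of_forall fun s => ?_)
    by_cases hs : s ∈ S
    · rw [indicator_of_mem hs]; exact signDefect_le_sq hM _ _
    · rw [indicator_of_notMem hs]
      refine (signDefect_eq_zero h0 fun h => hs ?_).le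
      obtain ⟨⟨h1, h2⟩, h3, h4⟩ := h
      exact ⟨max_le h1 (by linarith), lt_min h2 (by linarith)⟩
  rw [integral_indicator_const _ hmS, hSv, smul_eq_mul, mul_comm] at h1
  exact h1

theorem lagDefect_le_variation (hg : IsNullProfile R b g) (hM : ∀ t, |g t| ≤ M) {C : ℝ}
    (hC : ∀ r, ∫ s, |g (s + r) - g s| ≤ C * |r|) (r : ℝ) :
    lagDefect g r ≤ 2 * M * C * |r| := by
  have hM0 : 0 ≤ M := (abs_nonneg _).trans (hM 0)
  have i1 := ((hg.integrable.comp_add_right r).sub hg.integrable).abs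
  have h1 : lagDefect g r ≤ ∫ s, 2 * M * |g (s + r) - g s| :=
    integral_mono_of_nonneg (.of_forall fun s => signDefect_nonneg g _ _) (i1.const_mul _)
      (.of_forall fun s => signDefect_le_abs_sub hM _ _)
  rw [integral_const_mul] at h1
  calc lagDefect g r ≤ 2 * M * ∫ s, |g (s + r) - g s| := h1
    _ ≤ 2 * M * (C * |r|) := by gcongr; exact hC r
    _ = 2 * M * C * |r| := by ring

theorem integrable_signDefect_lag (hg : IsNullProfile R b g) (r : ℝ) :
    Integrable fun s => signDefect g s (s + r) := by
  obtain ⟨M, hM⟩ := hg.bounded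
  refine integrable_of_bounded_of_support (a := 0) (b := b) (M := 2 * M ^ 2)
    ((measurable_signDefect hg.measurable).comp (measurable_id.prodMk (measurable_add_const r)))
    (fun s => ?_) (fun s hs => signDefect_eq_zero hg.eq_zero
      fun h => hs (Ico_subset_Icc_self h.1))
  rw [abs_of_nonneg (signDefect_nonneg g _ _)]
  exact signDefect_le_sq hM _ _

/-- If a null profile takes values of both signs, its lag defect is bounded below on an
interval of lags. -/
theorem exists_le_lagDefect (hg : IsNullProfile R b g) {p q : ℝ} (hpq : p < q)
    (h : g p * g q < 0) :
    ∃ c d κ : ℝ, 0 < c ∧ c < d ∧ d < b ∧ 0 < κ ∧ ∀ r ∈ Icc c d, κ ≤ lagDefect g r := by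
  have hp : p ∈ Ico 0 b := by
    by_contra hp; rw [hg.eq_zero p hp, zero_mul] at h; exact lt_irrefl _ h
  have hq : q ∈ Ico 0 b := by
    by_contra hq; rw [hg.eq_zero q hq, mul_zero] at h; exact lt_irrefl _ h
  set α := -(g p * g q) / 2 with hα
  have hα0 : 0 < α := by rw [hα]; linarith
  have ht : Tendsto (fun z : ℝ × ℝ => g z.1 * g z.2) (nhdsWithin p (Ici p) ×ˢ nhdsWithin q (Ici q))
      (nhds (g p * g q)) :=
    ((hg.right_continuous p).tendsto.comp tendsto_fst).mul
      ((hg.right_continuous q).tendsto.comp tendsto_snd)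
  have hev := ht.eventually_lt_const (show g p * g q < -α by rw [hα]; linarith)
  obtain ⟨⟨p', q'⟩, ⟨hp', hq'⟩, hpr⟩ :=
    ((nhdsGE_basis p).prod (nhdsGE_basis q)).eventually_iff.1 hev
  simp only at hp' hq' hpr
  set δ := min (min (p' - p) (q' - q)) (b - q) with hδ
  have hδ0 : 0 < δ := lt_min (lt_min (by linarith) (by linarith)) (by linarith [hq.2])
  have hδ1 : δ ≤ p' - p := (min_le_left _ _).trans (min_le_left _ _)
  have hδ2 : δ ≤ q' - q := (min_le_left _ _).trans (min_le_right _ _)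
  have hδ3 : δ ≤ b - q := min_le_right _ _
  have hmS : MeasurableSet (Ico p (p + δ / 2)) := measurableSet_Ico
  refine ⟨q - p, q - p + δ / 2, α * δ, by linarith, by linarith, by linarith [hp.1], by positivity,
    fun r hr => ?_⟩
  have h1 : ∫ s, (Ico p (p + δ / 2)).indicator (fun _ => 2 * α) s ≤ lagDefect g r := by
    refine integral_mono ((integrable_indicator_iff hmS).2 (integrableOn_const (by simp)))
      (integrable_signDefect_lag hg r) fun s => ?_
    by_cases hs : s ∈ Ico p (p + δ / 2)
    · rw [indicator_of_mem hs]
      have := @hpr (s, s + r) ⟨⟨hs.1, by linarith [hs.2]⟩,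
        ⟨by linarith [hs.1, hr.1], by linarith [hs.2, hr.2]⟩⟩
      simp only at this
      unfold signDefect
      rw [← abs_mul, abs_of_neg (by linarith)]
      linarith
    · rw [indicator_of_notMem hs]; exact signDefect_nonneg g _ _
  rw [integral_indicator_const _ hmS, Real.volume_real_Ico_of_le (by linarith), smul_eq_mul] at h1
  linarith

end SignDefect
end NullProfile

section Perron

variable {Ω : Type*} [MeasurableSpace Ω] {P : Measure Ω} {X : ℝ → Ω → ℝ} {R : ℝ → ℝ} {b : ℝ}
  {g : ℝ → ℝ}

namespace IsStationaryGaussian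

variable (hX : IsStationaryGaussian P X R)
include hX

theorem abs_negSecondDiff_le (ε r : ℝ) : |negSecondDiff R ε r| ≤ 4 * R 0 := by
  have h1 := abs_le.1 (hX.abs_cov_le r)
  have h2 := abs_le.1 (hX.abs_cov_le (r + ε))
  have h3 := abs_le.1 (hX.abs_cov_le (r - ε))
  unfold negSecondDiff
  rw [abs_le]
  constructor <;> linarith

variable [IsProbabilityMeasure P]

theorem continuous_negSecondDiff (ε : ℝ) : Continuous (negSecondDiff R ε) := by
  have := hX.continuous_cov
  unfold negSecondDiff
  fun_prop

theorem integral_abs_mul_negSecondDiff_nonneg (hg : IsNullProfile R b g) (ε : ℝ) :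
    0 ≤ ∫ s, ∫ t, |g s| * |g t| * negSecondDiff R ε (t - s) := by
  obtain ⟨M, hM⟩ := hg.bounded
  have hgm := hg.measurable
  have h0 : ∀ t ∉ Icc 0 b, |g t| = 0 := fun t ht => by rw [hg.eq_zero_of_notMem_Icc t ht, abs_zero]
  let Z : ℝ → Ω → ℝ := fun t ω => |g t| * (X (t + ε) ω - X t ω)
  have hXm := hX.measurable_uncurry
  have hZm : Measurable (Function.uncurry Z) := by
    refine (hgm.abs.comp measurable_fst).mul (Measurable.sub ?_ hXm)
    exact hXm.comp ((measurable_fst.add_const ε).prodMk measurable_snd)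
  have hZL : ∀ t, MemLp (Z t) 2 P := fun t =>
    ((hX.memLp (t + ε)).sub (hX.memLp t)).const_mul _
  have hZC : ∀ t, ∫ ω, Z t ω ^ 2 ∂P ≤ M ^ 2 * (2 * (R 0 - R ε)) := by
    intro t
    simp only [Z, mul_pow]
    rw [integral_const_mul, hX.integral_sub_sq, add_sub_cancel_left]
    have := hX.cov_le ε
    have h1 : |g t| ^ 2 ≤ M ^ 2 := pow_le_pow_left₀ (abs_nonneg _) (hM t) 2
    exact mul_le_mul_of_nonneg_right h1 (by linarith)
  have key := integral_integral_mul_integral hZm hZL hZC (volume.restrict (Icc 0 b))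
    (volume.restrict (Icc 0 b))
  have hK : ∀ s t, ∫ ω, Z s ω * Z t ω ∂P = |g s| * |g t| * negSecondDiff R ε (t - s) := by
    intro s t
    rw [← hX.integral_increment_mul, ← integral_const_mul]
    congr with ω
    simp only [Z]; ring
  simp_rw [hK] at key
  have h1 : ∀ s, ∫ t in Icc 0 b, |g s| * |g t| * negSecondDiff R ε (t - s)
      = ∫ t, |g s| * |g t| * negSecondDiff R ε (t - s) := fun s =>
    setIntegral_eq_integral_of_forall_compl_eq_zero fun t ht => by rw [h0 t ht]; ring
  simp_rw [h1] at key
  rw [setIntegral_eq_integral_of_forall_compl_eq_zero (fun s hs => by simp [h0 s hs])] at key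
  rw [← key]
  exact integral_nonneg fun ω => mul_self_nonneg _

theorem integral_mul_negSecondDiff_eq_zero (hg : IsNullProfile R b g) (ε : ℝ) :
    ∫ s, ∫ t, g s * g t * negSecondDiff R ε (t - s) = 0 := by
  obtain ⟨k, hk⟩ := hg.potential
  have i := hg.integrable_mul_kernel hX.continuous_cov hX.abs_cov_le
  have h : ∀ s, ∫ t, g s * g t * negSecondDiff R ε (t - s) = 0 := by
    intro s
    have e : ∀ t, g s * g t * negSecondDiff R ε (t - s)
        = g s * (2 * (g t * R (t - s)) - g t * R (t - (s - ε)) - g t * R (t - (s + ε))) := by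
      intro t
      unfold negSecondDiff
      rw [show t - (s - ε) = t - s + ε by ring, show t - (s + ε) = t - s - ε by ring]
      ring
    simp_rw [e]
    rw [integral_const_mul, integral_sub (by exact ((i s).const_mul 2).sub (i (s - ε)))
      (i (s + ε)), integral_sub ((i s).const_mul 2) (i (s - ε)), integral_const_mul, hk, hk, hk]
    ring
  simp [h]

theorem integral_negSecondDiff_mul_lagDefect (hg : IsNullProfile R b g) (ε : ℝ) :
    Integrable (fun r => negSecondDiff R ε r * lagDefect g r) ∧
      0 ≤ ∫ r, negSecondDiff R ε r * lagDefect g r := by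
  have hD := hX.continuous_negSecondDiff ε
  have hDb := hX.abs_negSecondDiff_le ε
  have hDm : AEStronglyMeasurable (fun p : ℝ × ℝ => negSecondDiff R ε (p.2 - p.1))
      (volume.prod volume) := Continuous.aestronglyMeasurable (by fun_prop)
  have i1 : Integrable (fun p : ℝ × ℝ => |g p.1| * |g p.2| * negSecondDiff R ε (p.2 - p.1))
      (volume.prod volume) :=
    (hg.integrable.abs.mul_prod hg.integrable.abs).mul_bdd hDm (.of_forall fun p => hDb _)
  have i2 : Integrable (fun p : ℝ × ℝ => g p.1 * g p.2 * negSecondDiff R ε (p.2 - p.1))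
      (volume.prod volume) :=
    (hg.integrable.mul_prod hg.integrable).mul_bdd hDm (.of_forall fun p => hDb _)
  let f : ℝ × ℝ → ℝ := fun p => signDefect g p.1 p.2 * negSecondDiff R ε (p.2 - p.1)
  have e : ∀ p : ℝ × ℝ, f p = |g p.1| * |g p.2| * negSecondDiff R ε (p.2 - p.1)
      - g p.1 * g p.2 * negSecondDiff R ε (p.2 - p.1) := by
    intro p; simp only [f, signDefect]; ring
  have hf : Integrable f (volume.prod volume) :=
    (i1.sub i2).congr (.of_forall fun p => (e p).symm)
  have hf0 : 0 ≤ ∫ p, f p ∂(volume.prod volume) := by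
    simp_rw [e]
    rw [integral_sub i1 i2, integral_prod _ i1, integral_prod _ i2,
      hX.integral_mul_negSecondDiff_eq_zero hg, sub_zero]
    exact hX.integral_abs_mul_negSecondDiff_nonneg hg ε
  have hmp := measurePreserving_prod_add (G := ℝ) volume volume
  have hf' : Integrable (fun p : ℝ × ℝ => f (p.1, p.1 + p.2)) (volume.prod volume) :=
    hmp.integrable_comp_of_integrable hf
  have hf2 : ∀ s r, f (s, s + r) = negSecondDiff R ε r * signDefect g s (s + r) := by
    intro s r; simp only [f, add_sub_cancel_left]; ring
  have hval : ∀ r, ∫ s, f (s, s + r) = negSecondDiff R ε r * lagDefect g r := by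
    intro r; simp_rw [hf2]; rw [integral_const_mul]; rfl
  constructor
  · refine hf'.integral_prod_right.congr (.of_forall hval)
  · have h1 : ∫ p : ℝ × ℝ, f (p.1, p.1 + p.2) ∂(volume.prod volume)
        = ∫ p, f p ∂(volume.prod volume) :=
      MeasurePreserving.integral_comp' (f := MeasurableEquiv.shearAddRight ℝ) hmp f
    rw [← h1, integral_prod_symm _ hf'] at hf0
    simpa only [hval] using hf0

end IsStationaryGaussian

/-- A null profile has constant sign. -/
theorem IsStationaryGaussian.mul_nonneg_of_isNullProfile [IsProbabilityMeasure P]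
    (hX : IsStationaryGaussian P X R) (hR : StrictConvexOn ℝ (Icc 0 b) R)
    (hg : IsNullProfile R b g) (p q : ℝ) : 0 ≤ g p * g q := by
  wlog hpq : p < q generalizing p q
  · rcases (not_lt.1 hpq).eq_or_lt with h | h
    · rw [h]; exact mul_self_nonneg _
    · rw [mul_comm]; exact this q p h
  by_contra! hneg
  obtain ⟨c, d, κ, hc, hcd, hd, hκ, hψ⟩ := exists_le_lagDefect hg hpq hneg
  have hcont := hX.continuous_cov
  obtain ⟨k, hk, hev⟩ := hR.exists_intervalIntegral_negSecondDiff_le hcont hc hcd hd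
  obtain ⟨M, hM⟩ := hg.bounded
  obtain ⟨C, hC⟩ := hg.variation
  have hM0 : 0 ≤ M := (abs_nonneg _).trans (hM 0)
  set A := 2 * M * |C| + 2 * M ^ 2 with hA
  have hA0 : 0 ≤ A := by positivity
  have ψ0 := lagDefect_nonneg g
  have ψ1 : ∀ r, lagDefect g r ≤ A * |r| := by
    intro r
    refine (lagDefect_le_variation hg hM hC r).trans ?_
    have h1 : 2 * M * C * |r| ≤ 2 * M * |C| * |r| := by gcongr; exact le_abs_self C
    have h2 : 0 ≤ 2 * M ^ 2 * |r| := by positivity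
    rw [hA]; linarith
  have ψ2 : ∀ r, lagDefect g r ≤ A * max (b - |r|) 0 := by
    intro r
    refine (lagDefect_le hM hg.eq_zero r).trans ?_
    gcongr
    rw [hA]
    have : 0 ≤ 2 * M * |C| := by positivity
    linarith
  have hDlim : Tendsto (fun ε => 8 * A * (R 0 - R ε)) (nhdsWithin 0 (Ioi 0)) (nhds 0) := by
    have : ContinuousAt (fun ε => 8 * A * (R 0 - R ε)) 0 := by fun_prop
    have h := this.tendsto
    simp only [sub_self, mul_zero] at h
    exact h.mono_left nhdsWithin_le_nhds
  have hsmall : ∀ᶠ ε : ℝ in nhdsWithin 0 (Ioi 0), ε < min c (b - d) :=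
    nhdsWithin_le_nhds (eventually_lt_nhds (lt_min hc (by linarith)))
  obtain ⟨ε, ⟨h1, h2⟩, h3, h4⟩ := ((hev.and hsmall).and
    ((hDlim.eventually_lt_const (mul_pos hκ hk)).and self_mem_nhdsWithin)).exists
  have h4 : 0 < ε := h4
  obtain ⟨h5, h6⟩ := lt_min_iff.1 h2
  set D := negSecondDiff R ε with hD
  have hD0 : ∀ r, D r ≤ 2 * (R 0 - R ε) := hX.negSecondDiff_le ε
  have hDabs : ∀ r, D |r| = D r := by
    intro r
    rcases abs_choice r with h | h
    · rw [h]
    · rw [h]; exact hX.negSecondDiff_neg ε r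
  set L := A * ε * (2 * (R 0 - R ε)) with hL
  have hRε := hX.cov_le ε
  have hL0 : 0 ≤ L := mul_nonneg (by positivity) (by linarith)
  have hDc : Continuous D := hX.continuous_negSecondDiff ε
  let S₁ : Set ℝ := Ioo (-ε) ε
  let S₂ : Set ℝ := Ioc (b - ε) b
  let S₃ : Set ℝ := Ico (-b) (-(b - ε))
  let B : ℝ → ℝ := fun r => S₁.indicator (fun _ => L) r + S₂.indicator (fun _ => L) r
    + S₃.indicator (fun _ => L) r + (Ioc c d).indicator (fun r => κ * D r) r
  have j1 : Integrable (S₁.indicator fun _ => L) :=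
    (integrable_indicator_iff measurableSet_Ioo).2 (integrableOn_const (by simp))
  have j2 : Integrable (S₂.indicator fun _ => L) :=
    (integrable_indicator_iff measurableSet_Ioc).2 (integrableOn_const (by simp))
  have j3 : Integrable (S₃.indicator fun _ => L) :=
    (integrable_indicator_iff measurableSet_Ico).2 (integrableOn_const (by simp))
  have j4 : Integrable ((Ioc c d).indicator fun r => κ * D r) :=
    (integrable_indicator_iff measurableSet_Ioc).2
      ((continuous_const.mul hDc).integrableOn_Ioc)
  obtain ⟨hint, hnn⟩ := hX.integral_negSecondDiff_mul_lagDefect hg ε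
  have hB : ∫ r, D r * lagDefect g r ≤ ∫ r, B r := by
    refine integral_mono hint (((j1.add j2).add j3).add j4) fun r => ?_
    have n1 : 0 ≤ S₁.indicator (fun _ => L) r := indicator_nonneg (fun _ _ => hL0) r
    have n2 : 0 ≤ S₂.indicator (fun _ => L) r := indicator_nonneg (fun _ _ => hL0) r
    have n3 : 0 ≤ S₃.indicator (fun _ => L) r := indicator_nonneg (fun _ _ => hL0) r
    have small : lagDefect g r ≤ A * ε → D r * lagDefect g r ≤ L := by
      intro h
      calc D r * lagDefect g r ≤ (2 * (R 0 - R ε)) * lagDefect g r :=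
            mul_le_mul_of_nonneg_right (hD0 r) (ψ0 r)
        _ ≤ (2 * (R 0 - R ε)) * (A * ε) := mul_le_mul_of_nonneg_left h (by linarith)
        _ = L := by rw [hL]; ring
    simp only [B]
    rcases lt_or_ge |r| ε with hr | hr
    · have hr' := abs_lt.1 hr
      rw [indicator_of_mem (show r ∈ S₁ from hr') (fun _ => L),
        indicator_of_notMem (show r ∉ Ioc c d from fun h => by linarith [h.1, hr'.2])]
      have := small ((ψ1 r).trans (mul_le_mul_of_nonneg_left hr.le hA0))
      linarith
    rcases le_or_gt |r| (b - ε) with hr2 | hr2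
    · have hDn : D r ≤ 0 := by
        rw [← hDabs]
        exact hR.convexOn.negSecondDiff_nonpos h4.le hr hr2
      by_cases hcd' : r ∈ Ioc c d
      · rw [indicator_of_mem hcd']
        have := mul_le_mul_of_nonpos_left (hψ r (Ioc_subset_Icc_self hcd')) hDn
        linarith
      · rw [indicator_of_notMem hcd']
        have := mul_nonpos_of_nonpos_of_nonneg hDn (ψ0 r)
        linarith
    have hcd' : r ∉ Ioc c d := fun h => by
      rw [abs_of_pos (by linarith [h.1])] at hr2
      linarith [h.2]
    rw [indicator_of_notMem hcd']
    rcases le_or_gt |r| b with hr3 | hr3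
    · have := small ((ψ2 r).trans (mul_le_mul_of_nonneg_left
        (max_le (by linarith) h4.le) hA0))
      rcases le_total 0 r with h0 | h0
      · rw [abs_of_nonneg h0] at hr2 hr3
        rw [indicator_of_mem (show r ∈ S₂ from ⟨hr2, hr3⟩) (fun _ => L)]
        linarith
      · rw [abs_of_nonpos h0] at hr2 hr3
        rw [indicator_of_mem (show r ∈ S₃ from ⟨by linarith, by linarith⟩) (fun _ => L)]
        linarith
    · have h0 : lagDefect g r = 0 := by
        refine le_antisymm ((ψ2 r).trans ?_) (ψ0 r)
        rw [max_eq_right (by linarith), mul_zero]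
      rw [h0, mul_zero]
      linarith
  have hval : ∫ r, B r = 4 * ε * L + κ * ∫ r in c..d, D r := by
    simp only [B]
    rw [integral_add (by exact (j1.add j2).add j3) j4, integral_add (by exact j1.add j2) j3,
      integral_add j1 j2, integral_indicator_const _ measurableSet_Ioo,
      integral_indicator_const _ measurableSet_Ioc, integral_indicator_const _ measurableSet_Ico,
      integral_indicator measurableSet_Ioc, Real.volume_real_Ioo_of_le (by linarith),
      Real.volume_real_Ioc_of_le (by linarith), Real.volume_real_Ico_of_le (by linarith),
      integral_const_mul, intervalIntegral.integral_of_le hcd.le]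
    simp only [smul_eq_mul]
    ring
  have h7 : κ * ∫ r in c..d, D r ≤ κ * -(k * ε ^ 2) := mul_le_mul_of_nonneg_left h1 hκ.le
  have h8 : 4 * ε * L = ε ^ 2 * (8 * A * (R 0 - R ε)) := by rw [hL]; ring
  have h9 : ε ^ 2 * (8 * A * (R 0 - R ε)) < ε ^ 2 * (κ * k) :=
    mul_lt_mul_of_pos_left h3 (by positivity)
  linarith

end Perron

section DistributionFunction

variable {R : ℝ → ℝ} {b : ℝ} {ν μ : Measure ℝ}

theorem lintegral_measure_Ioc (ν : Measure ℝ) [IsProbabilityMeasure ν] (r : ℝ) :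
    ∫⁻ s, ν (Ioc s (s + r)) = ENNReal.ofReal r := by
  have hE : MeasurableSet {p : ℝ × ℝ | p.1 < p.2 ∧ p.2 ≤ p.1 + r} :=
    (measurableSet_lt measurable_fst measurable_snd).inter
      (measurableSet_le measurable_snd (measurable_fst.add_const r))
  have h1 := Measure.prod_apply (μ := volume) (ν := ν) hE
  have h2 := Measure.prod_apply_symm (μ := volume) (ν := ν) hE
  have e1 : ∀ s : ℝ, Prod.mk s ⁻¹' {p : ℝ × ℝ | p.1 < p.2 ∧ p.2 ≤ p.1 + r} = Ioc s (s + r) :=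
    fun s => rfl
  have e2 : ∀ t : ℝ, (fun s => (s, t)) ⁻¹' {p : ℝ × ℝ | p.1 < p.2 ∧ p.2 ≤ p.1 + r}
      = Ico (t - r) t := by
    intro t; ext s
    show s < t ∧ t ≤ s + r ↔ t - r ≤ s ∧ s < t
    rw [sub_le_iff_le_add, and_comm]
  simp_rw [e1] at h1
  simp_rw [e2, Real.volume_Ico, sub_sub_cancel] at h2
  rw [← h1, h2]
  simp

theorem measureReal_Iic_sub (ν : Measure ℝ) [IsFiniteMeasure ν] {s t : ℝ} (h : s ≤ t) :
    ν.real (Iic t) - ν.real (Iic s) = ν.real (Ioc s t) := by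
  have e : Ioc s t = Iic t \ Iic s := by ext r; simp [and_comm]
  rw [e, measureReal_sdiff (Iic_subset_Iic.2 h) measurableSet_Iic]

theorem measurable_measureReal_Iic (ν : Measure ℝ) [IsFiniteMeasure ν] :
    Measurable fun t => ν.real (Iic t) :=
  Monotone.measurable fun _ _ h => measureReal_mono (Iic_subset_Iic.2 h)

theorem integral_sub_measureReal_Iic (ν : Measure ℝ) [IsProbabilityMeasure ν] {r : ℝ}
    (hr : 0 ≤ r) : Integrable (fun s => ν.real (Iic (s + r)) - ν.real (Iic s)) ∧
      ∫ s, (ν.real (Iic (s + r)) - ν.real (Iic s)) = r := by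
  have e : ∀ s, ν.real (Iic (s + r)) - ν.real (Iic s) = ν.real (Ioc s (s + r)) := fun s =>
    measureReal_Iic_sub ν (by linarith)
  have hm : Measurable fun s => ν.real (Ioc s (s + r)) := by
    simp_rw [← e]
    exact ((measurable_measureReal_Iic ν).comp (measurable_add_const r)).sub
      (measurable_measureReal_Iic ν)
  have hl : ∫⁻ s, ENNReal.ofReal (ν.real (Ioc s (s + r))) = ENNReal.ofReal r := by
    simp_rw [fun s => ofReal_measureReal (μ := ν) (s := Ioc s (s + r))]
    exact lintegral_measure_Ioc ν r
  simp_rw [e]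
  refine ⟨⟨hm.aestronglyMeasurable, ?_⟩, ?_⟩
  · rw [hasFiniteIntegral_iff_ofReal (.of_forall fun s => measureReal_nonneg), hl]
    exact ENNReal.ofReal_lt_top
  · rw [integral_eq_lintegral_of_nonneg_ae (.of_forall fun s => measureReal_nonneg)
      hm.aestronglyMeasurable, hl, ENNReal.toReal_ofReal hr]

theorem continuousWithinAt_measureReal_Iic (ν : Measure ℝ) [IsProbabilityMeasure ν] (t : ℝ) :
    ContinuousWithinAt (fun t => ν.real (Iic t)) (Ici t) t := by
  exact ((cdf ν).right_continuous t).congr (fun s _ => (cdf_eq_real ν s).symm)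
    (cdf_eq_real ν t).symm

theorem IsProbOn.measureReal_Iic_of_neg (h : IsProbOn b ν) {t : ℝ} (ht : t < 0) :
    ν.real (Iic t) = 0 := by
  rw [measureReal_def, measure_mono_null (fun s hs => ?_) h.compl_eq_zero, ENNReal.toReal_zero]
  exact fun h => (h.1.trans hs).not_gt ht

theorem IsProbOn.measureReal_Iic_of_ge (h : IsProbOn b ν) {t : ℝ} (ht : b ≤ t) :
    ν.real (Iic t) = 1 := by
  have := h.1
  have h1 : ∀ᵐ s ∂ν, s ∈ Iic t := h.ae_mem.mono fun s hs => hs.2.trans ht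
  rw [measureReal_def, (prob_compl_eq_zero_iff measurableSet_Iic).1 h1, ENNReal.toReal_one]

theorem IsProbOn.intervalIntegral_measureReal_Iic_mul (h : IsProbOn b ν) (hb : 0 ≤ b) {φ : ℝ → ℝ}
    (hφ : Continuous φ) {C : ℝ} (hC : ∀ t, |φ t| ≤ C) :
    ∫ t in 0..b, ν.real (Iic t) * φ t = ∫ s, (∫ t in s..b, φ t) ∂ν := by
  have := h.1
  have e1 : ∀ t, ν.real (Iic t) * φ t = ∫ s, (Iic t).indicator (fun _ => φ t) s ∂ν := by
    intro t
    rw [integral_indicator_const _ measurableSet_Iic, smul_eq_mul]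
  have e2 : ∀ s ∈ Icc 0 b, (∫ t in s..b, φ t)
      = ∫ t in Ioc 0 b, (Iic t).indicator (fun _ => φ t) s := by
    intro s hs
    rw [intervalIntegral.integral_of_le hs.2, ← integral_Icc_eq_integral_Ioc,
      ← integral_Icc_eq_integral_Ioc]
    have : ∀ t, (Iic t).indicator (fun _ => φ t) s = (Ici s).indicator φ t := fun t => rfl
    simp_rw [this]
    rw [setIntegral_indicator measurableSet_Ici]
    congr 2
    ext t
    exact ⟨fun h => ⟨⟨hs.1.trans h.1, h.2⟩, h.1⟩, fun h => ⟨h.2, h.1.2⟩⟩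
  rw [intervalIntegral.integral_of_le hb]
  simp_rw [e1]
  rw [integral_integral_swap]
  · exact integral_congr_ae (h.ae_mem.mono fun s hs => (e2 s hs).symm)
  · have hm : Measurable (Function.uncurry fun t s => (Iic t).indicator (fun _ => φ t) s) := by
      have : (Function.uncurry fun t s => (Iic t).indicator (fun _ => φ t) s)
          = {p : ℝ × ℝ | p.2 ≤ p.1}.indicator fun p => φ p.1 := rfl
      rw [this]
      exact (hφ.measurable.comp measurable_fst).indicator
        (measurableSet_le measurable_snd measurable_fst)
    refine Integrable.of_bound hm.aestronglyMeasurable C (.of_forall fun p => ?_)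
    show ‖(Iic p.1).indicator (fun _ => φ p.1) p.2‖ ≤ C
    exact (norm_indicator_le_norm_self _ _).trans (hC _)

variable {Ω : Type*} [MeasurableSpace Ω] {P : Measure Ω} [IsProbabilityMeasure P] {X : ℝ → Ω → ℝ}

namespace IsStationaryGaussian

variable (hX : IsStationaryGaussian P X R)
include hX

theorem intervalIntegral_measureReal_Iic_mul (hb : 0 ≤ b) (h : IsProbOn b ν) (x : ℝ) :
    ∫ t in 0..b, ν.real (Iic t) * R (t - x)
      = (∫ t in 0..(b - x), R t) - (∫ s, (∫ t in 0..s, R t) ∂ν) + ∫ r in 0..x, potential R ν r := by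
  have := h.1
  have hR := hX.continuous_cov
  have hi : ∀ p q, IntervalIntegrable R volume p q := fun p q => hR.intervalIntegrable p q
  have hcont : Continuous fun s => ∫ t in 0..s, R t :=
    intervalIntegral.continuous_primitive (fun p q => hi p q) 0
  rw [h.intervalIntegral_measureReal_Iic_mul hb (φ := fun t => R (t - x)) (by fun_prop)
    (C := R 0) (fun t => hX.abs_cov_le _)]
  have hswap : ∫ r in 0..x, potential R ν r = ∫ s, (∫ r in 0..x, R (s - r)) ∂ν := by
    unfold potential
    have : Integrable (Function.uncurry fun r t => R (t - r))
        ((volume.restrict (uIoc 0 x)).prod ν) := by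
      have : IsFiniteMeasure (volume.restrict (uIoc 0 x)) :=
        ⟨by rw [Measure.restrict_apply_univ, uIoc]; exact measure_Ioc_lt_top⟩
      exact
      Integrable.of_bound (by fun_prop) (R 0) (.of_forall fun p => hX.abs_cov_le _)
    exact intervalIntegral_integral_swap this
  have e : ∀ s, (∫ t in s..b, R (t - x)) = (∫ t in 0..(b - x), R t) - (∫ t in 0..s, R t)
      + ∫ r in 0..x, R (s - r) := by
    intro s
    rw [intervalIntegral.integral_comp_sub_right, intervalIntegral.integral_comp_sub_left]
    have h1 := intervalIntegral.integral_add_adjacent_intervals (hi 0 (s - x)) (hi (s - x) (b - x))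
    have h2 := intervalIntegral.integral_add_adjacent_intervals (hi 0 (s - x)) (hi (s - x) s)
    rw [sub_zero]
    linarith
  have hbd : ∀ᵐ s ∂ν, ‖∫ t in 0..s, R t‖ ≤ R 0 * b := by
    filter_upwards [h.ae_mem] with s hs
    refine (intervalIntegral.norm_integral_le_of_norm_le_const
      (fun t _ => hX.abs_cov_le t)).trans ?_
    rw [sub_zero, abs_of_nonneg hs.1]
    exact mul_le_mul_of_nonneg_left hs.2 hX.cov_zero_nonneg
  have i1 : Integrable (fun s => ∫ t in 0..s, R t) ν :=
    Integrable.of_bound hcont.aestronglyMeasurable _ hbd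
  have i2 : Integrable (fun s => ∫ r in 0..x, R (s - r)) ν := by
    refine Integrable.of_bound (C := R 0 * |x - 0|) ?_ (.of_forall fun s =>
      intervalIntegral.norm_integral_le_of_norm_le_const (fun t _ => hX.abs_cov_le _))
    exact (intervalIntegral.continuous_parametric_intervalIntegral_of_continuous' (by fun_prop)
      0 x).aestronglyMeasurable
  simp_rw [e]
  rw [integral_add (by exact (integrable_const _).sub i1) i2, integral_sub (integrable_const _) i1,
    hswap, integral_const]
  simp

/-- The difference of the distribution functions of two measures with the same potential. -/
theorem isNullProfile_sub (hb : 0 ≤ b) (hν : IsProbOn b ν) (hμ : IsProbOn b μ)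
    (hp : ∀ x, potential R ν x = potential R μ x) :
    IsNullProfile R b fun t => ν.real (Iic t) - μ.real (Iic t) := by
  have := hν.1
  have := hμ.1
  have hz : ∀ t ∉ Ico 0 b, ν.real (Iic t) - μ.real (Iic t) = 0 := by
    intro t ht
    rcases lt_or_ge t 0 with h | h
    · rw [hν.measureReal_Iic_of_neg h, hμ.measureReal_Iic_of_neg h, sub_zero]
    · have h' : b ≤ t := by by_contra! h'; exact ht ⟨h, h'⟩
      rw [hν.measureReal_Iic_of_ge h', hμ.measureReal_Iic_of_ge h', sub_self]
  refine ⟨(measurable_measureReal_Iic ν).sub (measurable_measureReal_Iic μ), ⟨1, fun t => ?_⟩,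
    hz, fun t => (continuousWithinAt_measureReal_Iic ν t).sub
      (continuousWithinAt_measureReal_Iic μ t), ⟨2, ?_⟩, ?_⟩
  · have := measureReal_nonneg (μ := ν) (s := Iic t)
    have := measureReal_nonneg (μ := μ) (s := Iic t)
    have := measureReal_le_one (μ := ν) (s := Iic t)
    have := measureReal_le_one (μ := μ) (s := Iic t)
    rw [abs_le]; constructor <;> linarith
  · have key : ∀ r, 0 ≤ r → ∫ s, |ν.real (Iic (s + r)) - μ.real (Iic (s + r))
        - (ν.real (Iic s) - μ.real (Iic s))| ≤ 2 * |r| := by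
      intro r hr
      obtain ⟨i1, h1⟩ := integral_sub_measureReal_Iic ν hr
      obtain ⟨i2, h2⟩ := integral_sub_measureReal_Iic μ hr
      calc _ ≤ ∫ s, ((ν.real (Iic (s + r)) - ν.real (Iic s))
            + (μ.real (Iic (s + r)) - μ.real (Iic s))) := by
            refine integral_mono_of_nonneg (.of_forall fun s => abs_nonneg _) (i1.add i2)
              (.of_forall fun s => ?_)
            have h3 : ν.real (Iic s) ≤ ν.real (Iic (s + r)) :=
              measureReal_mono (Iic_subset_Iic.2 (by linarith))
            have h4 : μ.real (Iic s) ≤ μ.real (Iic (s + r)) :=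
              measureReal_mono (Iic_subset_Iic.2 (by linarith))
            simp only
            rw [abs_le]; constructor <;> linarith
        _ = 2 * |r| := by rw [integral_add i1 i2, h1, h2, abs_of_nonneg hr]; ring
    intro r
    rcases le_total 0 r with hr | hr
    · exact key r hr
    · have h := key (-r) (by linarith)
      rw [← integral_add_right_eq_self _ r] at h
      simp only [add_neg_cancel_right, abs_neg] at h
      refine le_of_eq_of_le (integral_congr_ae (.of_forall fun s => ?_)) h
      exact abs_sub_comm _ _
  · refine ⟨(∫ s, (∫ t in 0..s, R t) ∂μ) - ∫ s, (∫ t in 0..s, R t) ∂ν, fun x => ?_⟩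
    have hR := hX.continuous_cov
    have hi : ∀ ρ : Measure ℝ, IsProbabilityMeasure ρ →
        IntervalIntegrable (fun t => ρ.real (Iic t) * R (t - x)) volume 0 b := by
      intro ρ _
      refine (Monotone.intervalIntegrable fun _ _ h =>
        measureReal_mono (Iic_subset_Iic.2 h)).mul_continuousOn (by fun_prop)
    have h0 : ∫ t, (ν.real (Iic t) - μ.real (Iic t)) * R (t - x)
        = ∫ t in 0..b, (ν.real (Iic t) - μ.real (Iic t)) * R (t - x) := by
      rw [intervalIntegral.integral_of_le hb, ← integral_Icc_eq_integral_Ioc,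
        setIntegral_eq_integral_of_forall_compl_eq_zero]
      intro t ht
      rw [hz t fun h => ht (Ico_subset_Icc_self h), zero_mul]
    rw [h0]
    simp_rw [sub_mul]
    rw [intervalIntegral.integral_sub (hi ν inferInstance) (hi μ inferInstance),
      hX.intervalIntegral_measureReal_Iic_mul hb hν, hX.intervalIntegral_measureReal_Iic_mul hb hμ]
    simp_rw [hp]
    ring

end IsStationaryGaussian
end DistributionFunction

section Uniqueness

variable {R : ℝ → ℝ} {b : ℝ} {g : ℝ → ℝ}

theorem eq_zero_of_ae_eq_zero_of_rightContinuous (h : g =ᵐ[volume] 0)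
    (hc : ∀ t, ContinuousWithinAt g (Ici t) t) (t : ℝ) : g t = 0 := by
  by_contra hne
  have h1 : ∀ᶠ s in nhdsWithin t (Ici t), g s ≠ 0 := (hc t).eventually_ne hne
  obtain ⟨e, he, hsub⟩ := mem_nhdsGE_iff_exists_Ico_subset.1 h1
  have h2 : volume (Ico t e) = 0 := by
    refine measure_mono_null (fun s hs => ?_) h
    exact hsub hs
  rw [Real.volume_Ico] at h2
  exact (ENNReal.ofReal_pos.2 (sub_pos.2 he)).ne' h2

theorem IsNullProfile.eq_zero_of_integral_eq_zero (hg : IsNullProfile R b g)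
    (hs : ∀ p q, 0 ≤ g p * g q) (h0 : ∫ t, g t = 0) (t : ℝ) : g t = 0 := by
  by_contra hne
  have h1 : ∫ s, g t * g s = 0 := by rw [integral_const_mul, h0, mul_zero]
  rw [integral_eq_zero_iff_of_nonneg (fun s => hs t s) (hg.integrable.const_mul _)] at h1
  refine hne (eq_zero_of_ae_eq_zero_of_rightContinuous (h1.mono fun s hs => ?_)
    hg.right_continuous t)
  exact (mul_eq_zero.1 hs).resolve_left hne

/-- A Grönwall inequality for bounded functions. -/
theorem le_zero_of_le_mul_intervalIntegral {M C : ℝ} (hgi : Integrable g) (hM : ∀ t, g t ≤ M)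
    (hC : 0 ≤ C) (h : ∀ t ∈ Icc 0 b, g t ≤ C * ∫ r in 0..t, g r) :
    ∀ t ∈ Icc 0 b, g t ≤ 0 := by
  have key : ∀ n : ℕ, ∀ t ∈ Icc 0 b, g t ≤ M * ((C * t) ^ n / n.factorial) := by
    intro n
    induction n with
    | zero => intro t _; simpa using hM t
    | succ n ih =>
      intro t ht
      refine (h t ht).trans ?_
      have h1 : ∫ r in 0..t, g r ≤ ∫ r in 0..t, M * ((C * r) ^ n / n.factorial) := by
        refine intervalIntegral.integral_mono_on ht.1 hgi.intervalIntegrable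
          (Continuous.intervalIntegrable (by fun_prop) _ _) fun r hr => ?_
        exact ih r ⟨hr.1, hr.2.trans ht.2⟩
      refine (mul_le_mul_of_nonneg_left h1 hC).trans_eq ?_
      have e : ∀ r : ℝ, M * ((C * r) ^ n / n.factorial) = M * C ^ n / n.factorial * r ^ n := by
        intro r; rw [mul_pow]; ring
      simp_rw [e]
      rw [intervalIntegral.integral_const_mul, integral_pow, Nat.factorial_succ]
      push_cast
      have : (n.factorial : ℝ) ≠ 0 := by positivity
      field_simp
      simp
      ring
  intro t ht
  have hl := (FloorSemiring.tendsto_pow_div_factorial_atTop (C * t)).const_mul M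
  rw [mul_zero] at hl
  exact ge_of_tendsto' hl fun n => key n t ht

variable {Ω : Type*} [MeasurableSpace Ω] {P : Measure Ω} [IsProbabilityMeasure P] {X : ℝ → Ω → ℝ}
  {ν μ : Measure ℝ}

/-- The normalized measure with nonnegative density `g`. -/
theorem isProbOn_withDensity (hgi : Integrable g) (hg0 : ∀ t, 0 ≤ g t)
    (hz : ∀ t ∉ Icc 0 b, g t = 0) (h1 : ∫ t, g t = 1) :
    IsProbOn b (volume.withDensity fun t => ENNReal.ofReal (g t)) := by
  refine ⟨⟨?_⟩, ?_⟩
  · rw [withDensity_apply _ MeasurableSet.univ, Measure.restrict_univ,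
      ← ofReal_integral_eq_lintegral_ofReal hgi (.of_forall hg0), h1, ENNReal.ofReal_one]
  · rw [withDensity_apply _ measurableSet_Icc.compl,
      setLIntegral_congr_fun (g := 0) measurableSet_Icc.compl fun t ht => by simp [hz t ht]]
    simp

theorem measureReal_withDensity_Iic (hgi : Integrable g) (hg0 : ∀ t, 0 ≤ g t)
    (hz : ∀ t < 0, g t = 0) {t : ℝ} (ht : 0 ≤ t) :
    (volume.withDensity fun t => ENNReal.ofReal (g t)).real (Iic t) = ∫ r in 0..t, g r := by
  rw [measureReal_def, withDensity_apply _ measurableSet_Iic,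
    ← ofReal_integral_eq_lintegral_ofReal hgi.integrableOn (.of_forall hg0),
    ENNReal.toReal_ofReal (integral_nonneg hg0), intervalIntegral.integral_of_le ht,
    ← integral_Icc_eq_integral_Ioc]
  refine setIntegral_eq_of_subset_of_forall_sdiff_eq_zero measurableSet_Iic
    (fun r hr => hr.2) fun r hr => hz r ?_
  by_contra! h
  exact hr.2 ⟨h, hr.1⟩

namespace IsStationaryGaussian

variable (hX : IsStationaryGaussian P X R)
include hX

theorem eq_of_potential_eq_of_le (hb : 0 ≤ b) (hR : StrictConvexOn ℝ (Icc 0 b) R)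
    (hν : IsProbOn b ν) (hμ : IsProbOn b μ)
    (hopt : ∀ ρ, IsProbOn b ρ → statEnergy R ν ≤ statEnergy R ρ)
    (hp : ∀ x, potential R ν x = potential R μ x)
    (hle : ∀ t, μ.real (Iic t) ≤ ν.real (Iic t)) (t : ℝ) : ν.real (Iic t) = μ.real (Iic t) := by
  have := hν.1
  have := hμ.1
  set G : ℝ → ℝ := fun t => ν.real (Iic t) - μ.real (Iic t) with hGdef
  have hG : IsNullProfile R b G := hX.isNullProfile_sub hb hν hμ hp
  have hG0 : ∀ t, 0 ≤ G t := fun t => sub_nonneg.2 (hle t)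
  have hG1 : ∀ t, G t ≤ 1 := fun t => by
    have := measureReal_nonneg (μ := μ) (s := Iic t)
    have := measureReal_le_one (μ := ν) (s := Iic t)
    simp only [hGdef]; linarith
  suffices h : G t = 0 from sub_eq_zero.1 h
  by_contra hne
  have hI : 0 < ∫ t, G t := (integral_nonneg hG0).lt_of_ne' fun h =>
    hne (hG.eq_zero_of_integral_eq_zero (fun p q => mul_nonneg (hG0 p) (hG0 q)) h t)
  set K := (∫ t, G t)⁻¹ with hK
  have hK0 : 0 < K := inv_pos.2 hI
  have hKG := hG.const_mul K
  have hKG0 : ∀ t, 0 ≤ K * G t := fun t => mul_nonneg hK0.le (hG0 t)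
  have hKG1 : ∫ t, K * G t = 1 := by rw [integral_const_mul, hK, inv_mul_cancel₀ hI.ne']
  set γ := volume.withDensity fun t => ENNReal.ofReal (K * G t) with hγdef
  have hγ : IsProbOn b γ := isProbOn_withDensity hKG.integrable hKG0 hKG.eq_zero_of_notMem_Icc hKG1
  have := hγ.1
  obtain ⟨k, hk⟩ := hKG.potential
  have hpγ : ∀ x, potential R γ x = k := by
    intro x
    rw [← hk x, potential, hγdef, integral_withDensity_eq_integral_toReal_smul
      (by have := hKG.measurable; fun_prop) (.of_forall fun t => ENNReal.ofReal_lt_top)]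
    simp_rw [ENNReal.toReal_ofReal (hKG0 _), smul_eq_mul]
  have hme : ∀ ρ : Measure ℝ, IsProbabilityMeasure ρ → mutualEnergy R ρ γ = k := by
    intro ρ _
    simp [mutualEnergy, hpγ]
  have hpot : ∀ x, potential R γ x = potential R ν x := by
    refine hX.potential_eq_of_energy_le γ ν ?_
    have h1 := hX.energy_le_mutualEnergy hν hγ hopt
    rw [hX.mutualEnergy_comm γ ν, ← statEnergy_eq_mutualEnergy R ν, hme γ inferInstance]
    rw [hme ν inferInstance] at h1 ⊢
    linarith
  have hH := hX.isNullProfile_sub hb hγ hν hpot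
  set a := -(∫ t, (γ.real (Iic t) - ν.real (Iic t))) * K with ha
  have hHG := hH.add (hG.const_mul a) hX.continuous_cov hX.abs_cov_le
  have hzero := hHG.eq_zero_of_integral_eq_zero (hX.mul_nonneg_of_isNullProfile hR hHG) (by
    rw [integral_add hH.integrable (hG.const_mul a).integrable, integral_const_mul, ha, hK,
      mul_assoc, inv_mul_cancel₀ hI.ne']
    ring)
  have hΓ : ∀ t, 0 ≤ t → γ.real (Iic t) = K * ∫ r in 0..t, G r := by
    intro t ht
    rw [← intervalIntegral.integral_const_mul]
    exact measureReal_withDensity_Iic hKG.integrable hKG0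
      (fun t ht => hKG.eq_zero t fun h => h.1.not_gt ht) ht
  have hmem : t ∈ Icc 0 b := by
    by_contra h
    exact hne (hG.eq_zero_of_notMem_Icc t h)
  rcases le_or_gt a (1 / 2) with h | h
  · refine (hG0 t).lt_of_ne' hne |>.not_ge (le_zero_of_le_mul_intervalIntegral hG.integrable hG1
      (C := 2 * K) (by positivity) (fun s hs => ?_) t hmem)
    have h1 := hzero s
    have h2 := measureReal_nonneg (μ := μ) (s := Iic s)
    rw [hΓ s hs.1] at h1
    have h3 : (1 - a) * G s ≤ K * ∫ r in 0..s, G r := by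
      have : G s = ν.real (Iic s) - μ.real (Iic s) := rfl
      nlinarith
    nlinarith [hG0 s]
  · have hrefl : Integrable fun s => G (b - s) := hG.integrable.comp_sub_left b
    have := le_zero_of_le_mul_intervalIntegral hrefl (fun s => hG1 (b - s)) (b := b)
      (C := 2 * K) (by positivity) (fun s hs => ?_) (b - t) ⟨by linarith [hmem.2], by
        linarith [hmem.1]⟩
    · rw [sub_sub_cancel] at this
      exact ((hG0 t).lt_of_ne' hne).not_ge this
    · have h1 := hzero (b - s)
      have h2 := measureReal_le_one (μ := ν) (s := Iic (b - s))
      have h4 := hγ.measureReal_Iic_of_ge le_rfl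
      rw [hΓ _ (by linarith [hs.2])] at h1
      rw [hΓ _ hb] at h4
      have h5 := intervalIntegral.integral_add_adjacent_intervals
        (hG.integrable.intervalIntegrable (a := 0) (b := b - s))
        (hG.integrable.intervalIntegrable (a := b - s) (b := b))
      rw [intervalIntegral.integral_comp_sub_left, sub_zero]
      rw [← h5] at h4
      have h3 : a * G (b - s) ≤ K * ∫ r in (b - s)..b, G r := by linarith
      nlinarith [hG0 (b - s)]

/-- The measure of minimal energy is unique. -/
theorem eq_of_energy_le (hb : 0 ≤ b) (hR : StrictConvexOn ℝ (Icc 0 b) R)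
    (hν : IsProbOn b ν) (hμ : IsProbOn b μ)
    (hopt : ∀ ρ, IsProbOn b ρ → statEnergy R ν ≤ statEnergy R ρ)
    (hle : statEnergy R μ ≤ statEnergy R ν) : μ = ν := by
  have := hν.1
  have := hμ.1
  have hp : ∀ x, potential R ν x = potential R μ x := by
    refine hX.potential_eq_of_energy_le ν μ ?_
    have h1 := hX.energy_le_mutualEnergy hν hμ hopt
    rw [← statEnergy_eq_mutualEnergy, ← statEnergy_eq_mutualEnergy]
    linarith
  have hsign := hX.mul_nonneg_of_isNullProfile hR (hX.isNullProfile_sub hb hν hμ hp)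
  have hF : ∀ t, ν.real (Iic t) = μ.real (Iic t) := by
    by_cases h : ∀ t, μ.real (Iic t) ≤ ν.real (Iic t)
    · exact hX.eq_of_potential_eq_of_le hb hR hν hμ hopt hp h
    · push Not at h
      obtain ⟨q, hq⟩ := h
      intro t
      refine (hX.eq_of_potential_eq_of_le hb hR hμ hν (fun ρ hρ => hle.trans (hopt ρ hρ))
        (fun x => (hp x).symm) (fun s => ?_) t).symm
      have := hsign s q
      by_contra! hs
      nlinarith
  refine (Measure.ext_of_Iic ν μ fun t => ?_).symm
  have := hF t
  rwa [measureReal_def, measureReal_def, ENNReal.toReal_eq_toReal_iff' (measure_ne_top _ _)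
    (measure_ne_top _ _)] at this

end IsStationaryGaussian
end Uniqueness

section Equilibrium

variable {R : ℝ → ℝ} {b : ℝ} {ν : Measure ℝ}
  {Ω : Type*} [MeasurableSpace Ω] {P : Measure Ω} [IsProbabilityMeasure P] {X : ℝ → Ω → ℝ}

theorem IsProbOn.integrable_of_continuous (hν : IsProbOn b ν) {f : ℝ → ℝ} (hf : Continuous f) :
    Integrable f ν := by
  have := hν.1
  rw [← Measure.restrict_eq_self_of_ae_mem hν.ae_mem]
  exact hf.continuousOn.integrableOn_Icc

namespace IsStationaryGaussian

variable (hX : IsStationaryGaussian P X R)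
include hX

theorem statEnergy_pos (hν : IsProbOn b ν) (hpos : 0 < P {ω | 1 < pathMin X b ω}) :
    0 < statEnergy R ν := by
  have := hν.1
  rw [statEnergy_eq_mutualEnergy, ← hX.integral_integral_path_mul]
  refine (integral_nonneg fun ω => mul_self_nonneg _).lt_of_ne' fun h => ?_
  rw [integral_eq_zero_iff_of_nonneg (fun ω => mul_self_nonneg _)
    ((hX.memLp_integral_path ν).integrable_mul (hX.memLp_integral_path ν))] at h
  refine hpos.ne' (measure_mono_null (t := {ω | ¬ _}) (fun ω hω h0 => ?_) h)
  have h1 : (1 : ℝ) ≤ ∫ t, X t ω ∂ν := by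
    calc (1 : ℝ) = ∫ t, 1 ∂ν := by simp
      _ ≤ _ := integral_mono_ae (integrable_const _)
        (hν.integrable_of_continuous (hX.continuous ω))
        (hν.ae_mem.mono fun t ht => (le_of_lt hω).trans (hX.pathMin_le ω ht))
  have h2 : (∫ t, X t ω ∂ν) * (∫ t, X t ω ∂ν) = 0 := h0
  nlinarith

theorem eq_zero_of_isProbOn_map_add (hb : 0 ≤ b) (hR : StrictConvexOn ℝ (Icc 0 b) R)
    (hν : IsProbOn b ν) (hopt : ∀ ρ, IsProbOn b ρ → statEnergy R ν ≤ statEnergy R ρ) {d : ℝ}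
    (hd : IsProbOn b (ν.map (· + d))) : d = 0 := by
  have := hν.1
  have hRc := hX.continuous_cov
  have hpot : ∀ s, potential R (ν.map (· + d)) (s + d) = potential R ν s := by
    intro s
    unfold potential
    rw [integral_map (by fun_prop) (by fun_prop)]
    simp
  have hen : statEnergy R (ν.map (· + d)) = statEnergy R ν := by
    have := hd.1
    rw [statEnergy_eq_mutualEnergy, mutualEnergy, integral_map (by fun_prop)
      (hX.continuous_potential _).aestronglyMeasurable]
    simp_rw [hpot]
    rfl
  have h := hX.eq_of_energy_le hb hR hν hd hopt hen.le
  have h1 : ∫ t, t ∂(ν.map (· + d)) = (∫ t, t ∂ν) + d := by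
    rw [integral_map (by fun_prop) (by fun_prop), integral_add
      (hν.integrable_of_continuous continuous_id') (integrable_const _)]
    simp
  rw [h] at h1
  linarith

/-- The potential of the measure of minimal energy is constant on the interval. -/
theorem potential_eq_statEnergy (hb : 0 ≤ b) (hR : StrictConvexOn ℝ (Icc 0 b) R)
    (hν : IsProbOn b ν) (hopt : ∀ ρ, IsProbOn b ρ → statEnergy R ν ≤ statEnergy R ρ) {x : ℝ}
    (hx : x ∈ Icc 0 b) : potential R ν x = statEnergy R ν := by
  have := hν.1
  set S := statEnergy R ν with hS
  have hge : ∀ x ∈ Icc 0 b, S ≤ potential R ν x := by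
    intro x hx
    have h := hX.energy_le_mutualEnergy hν (IsProbOn.dirac hx) hopt
    rwa [hX.mutualEnergy_comm, mutualEnergy_dirac] at h
  have hae : ∀ᵐ t ∂ν, potential R ν t ≤ S := by
    have h0 : ∫ t, (potential R ν t - S) ∂ν = 0 := by
      rw [integral_sub (hX.integrable_potential ν ν) (integrable_const _)]
      simp [hS, statEnergy, potential]
    rw [integral_eq_zero_iff_of_nonneg_ae (hν.ae_mem.mono fun t ht => sub_nonneg.2 (hge t ht))
      ((hX.integrable_potential ν ν).sub (integrable_const _))] at h0
    exact h0.mono fun t ht => (sub_eq_zero.1 ht).le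
  refine le_antisymm ?_ (hge x hx)
  by_contra! hlt
  have hcl : IsClosed {t | potential R ν t ≤ S} :=
    isClosed_le (hX.continuous_potential ν) continuous_const
  set K := Icc 0 b ∩ {t | potential R ν t ≤ S} with hK
  have hKc : IsCompact K := isCompact_Icc.inter_right hcl
  have hKae : ∀ᵐ t ∂ν, t ∈ K := by filter_upwards [hν.ae_mem, hae] with t h1 h2 using ⟨h1, h2⟩
  have hKne : K.Nonempty := by
    obtain ⟨t, ht⟩ := hKae.exists
    exact ⟨t, ht⟩
  have hxK : x ∉ K := fun h => hlt.not_ge h.2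
  have hshift : ∀ d, (∀ t ∈ K, t + d ∈ Icc 0 b) → d = 0 := by
    intro d hd
    refine hX.eq_zero_of_isProbOn_map_add hb hR hν hopt (d := d)
      ⟨Measure.isProbabilityMeasure_map (by fun_prop), ?_⟩
    rw [Measure.map_apply (by fun_prop) measurableSet_Icc.compl]
    exact measure_mono_null (fun t ht h => ht (hd t h)) hKae
  rcases (K ∩ Iic x).eq_empty_or_nonempty with h1 | h1
  · obtain ⟨p, hp, hpm⟩ := hKc.exists_isLeast hKne
    have hxp : x < p := by
      by_contra! h
      exact (h1 ▸ (⟨hp, h⟩ : p ∈ K ∩ Iic x) : p ∈ (∅ : Set ℝ)).elim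
    have := hshift (-p) fun t ht =>
      ⟨by linarith [hpm ht], by linarith [ht.1.2, hx.1]⟩
    linarith [hx.1]
  rcases (K ∩ Ici x).eq_empty_or_nonempty with h2 | h2
  · obtain ⟨q, hq, hqm⟩ := hKc.exists_isGreatest hKne
    have hxq : q < x := by
      by_contra! h
      exact (h2 ▸ (⟨hq, h⟩ : q ∈ K ∩ Ici x) : q ∈ (∅ : Set ℝ)).elim
    have := hshift (b - q) fun t ht =>
      ⟨by linarith [ht.1.1, hx.2], by linarith [hqm ht]⟩
    linarith [hx.2]
  obtain ⟨p, hp, hpm⟩ := (hKc.inter_right isClosed_Iic).exists_isGreatest h1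
  obtain ⟨q, hq, hqm⟩ := (hKc.inter_right isClosed_Ici).exists_isLeast h2
  have hpx : p < x := lt_of_le_of_ne hp.2 fun h => hxK (h ▸ hp.1)
  have hxq : x < q := lt_of_le_of_ne hq.2 fun h => hxK (h ▸ hq.1)
  have hpq : 0 < q - p := by linarith
  set α := (q - x) / (q - p) with hα
  set β := (x - p) / (q - p) with hβ
  have hα0 : 0 ≤ α := div_nonneg (by linarith) hpq.le
  have hβ0 : 0 ≤ β := div_nonneg (by linarith) hpq.le
  have hαβ : α + β = 1 := by rw [hα, hβ]; field_simp; ring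
  have hcomb : α * p + β * q = x := by rw [hα, hβ]; field_simp; ring
  have hpt : ∀ᵐ t ∂ν, R (t - x) ≤ α * R (t - p) + β * R (t - q) := by
    filter_upwards [hKae] with t ht
    have hside : t ≤ p ∨ q ≤ t := by
      rcases le_total t x with h | h
      · exact .inl (hpm ⟨ht, h⟩)
      · exact .inr (hqm ⟨ht, h⟩)
    have hx' : x = α * p + β * q := hcomb.symm
    rcases hside with h | h
    · have := hR.convexOn.2 (x := p - t) (y := q - t) ⟨by linarith, by linarith [hp.1.1.2, ht.1.1]⟩
        ⟨by linarith, by linarith [hq.1.1.2, ht.1.1]⟩ hα0 hβ0 hαβ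
      simp only [smul_eq_mul] at this
      have e : α * (p - t) + β * (q - t) = -(t - x) := by
        linear_combination hcomb - t * hαβ
      rwa [e, hX.cov_neg, ← neg_sub t p, hX.cov_neg, ← neg_sub t q, hX.cov_neg] at this
    · have := hR.convexOn.2 (x := t - p) (y := t - q) ⟨by linarith, by linarith [hp.1.1.1, ht.1.2]⟩
        ⟨by linarith, by linarith [hq.1.1.1, ht.1.2]⟩ hα0 hβ0 hαβ
      simp only [smul_eq_mul] at this
      have e : α * (t - p) + β * (t - q) = t - x := by
        linear_combination t * hαβ - hcomb
      rwa [e] at this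
  have hfin : potential R ν x ≤ α * potential R ν p + β * potential R ν q := by
    unfold potential
    rw [← integral_const_mul, ← integral_const_mul, ← integral_add
      ((hX.integrable_kernel ν p).const_mul α) ((hX.integrable_kernel ν q).const_mul β)]
    exact integral_mono_ae (hX.integrable_kernel ν x) (((hX.integrable_kernel ν p).const_mul α).add
      ((hX.integrable_kernel ν q).const_mul β)) hpt
  have h3 : potential R ν p ≤ S := hp.1.2
  have h4 : potential R ν q ≤ S := hq.1.2
  have h5 : α * S + β * S = S := by rw [← add_mul, hαβ, one_mul]
  linarith [mul_le_mul_of_nonneg_left h3 hα0, mul_le_mul_of_nonneg_left h4 hβ0]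

end IsStationaryGaussian
end Equilibrium

section Weight

/-- A finitely supported probability weight on `[0, b]`. -/
structure IsWeight (b : ℝ) (c : ℝ →₀ ℝ) : Prop where
  nonneg : ∀ s, 0 ≤ c s
  mem_Icc : ∀ s ∈ c.support, s ∈ Icc 0 b
  sum_eq : (c.sum fun _ a => a) = 1

variable {R : ℝ → ℝ} {b : ℝ} {c : ℝ →₀ ℝ} {ν : Measure ℝ}
  {Ω : Type*} [MeasurableSpace Ω] {P : Measure Ω} {X : ℝ → Ω → ℝ}

namespace IsWeight

theorem sum_mul_le (hc : IsWeight b c) {f : ℝ → ℝ} {M : ℝ} (h : ∀ s ∈ Icc 0 b, f s ≤ M) :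
    (c.sum fun s a => a * f s) ≤ M := by
  calc (c.sum fun s a => a * f s) ≤ c.sum fun _ a => a * M :=
        Finset.sum_le_sum fun s hs =>
          mul_le_mul_of_nonneg_left (h s (hc.mem_Icc s hs)) (hc.nonneg s)
    _ = M := by rw [← Finsupp.sum_mul, hc.sum_eq, one_mul]

theorem le_sum_mul (hc : IsWeight b c) {f : ℝ → ℝ} {M : ℝ} (h : ∀ s ∈ Icc 0 b, M ≤ f s) :
    M ≤ c.sum fun s a => a * f s := by
  calc M = c.sum fun _ a => a * M := by rw [← Finsupp.sum_mul, hc.sum_eq, one_mul]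
    _ ≤ _ := Finset.sum_le_sum fun s hs =>
          mul_le_mul_of_nonneg_left (h s (hc.mem_Icc s hs)) (hc.nonneg s)

theorem pathMin_le_linComb (hc : IsWeight b c) (hX : IsStationaryGaussian P X R) (ω : Ω) :
    pathMin X b ω ≤ linComb X c ω :=
  hc.le_sum_mul fun _ hs => hX.pathMin_le ω hs

end IsWeight

/-- The potential of a measure is uniformly approximated by those of finite weights. -/
theorem IsStationaryGaussian.exists_isWeight [IsProbabilityMeasure P]
    (hX : IsStationaryGaussian P X R) (hb : 0 ≤ b) (hν : IsProbOn b ν) {η : ℝ} (hη : 0 < η) :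
    ∃ c, IsWeight b c ∧ ∀ x ∈ Icc 0 b, |combCov R c x - potential R ν x| ≤ η := by
  have := hν.1
  have hR := hX.continuous_cov
  have huc : UniformContinuousOn R (Icc (-b) b) :=
    isCompact_Icc.uniformContinuousOn_of_continuous hR.continuousOn
  obtain ⟨δ, hδ, hRδ⟩ := Metric.uniformContinuousOn_iff.1 huc η hη
  set ε := δ / 2 with hε
  have hε0 : 0 < ε := by positivity
  set N := ⌊b / ε⌋₊ + 1 with hN
  set w : ℕ → ℝ := fun n => ν.real {s | ⌊s / ε⌋₊ = n} with hw
  set c : ℝ →₀ ℝ := ∑ n ∈ Finset.range N, Finsupp.single (n * ε) (w n) with hc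
  have hmeas : Measurable fun s : ℝ => ⌊s / ε⌋₊ := Nat.measurable_floor.comp (by fun_prop)
  have hfloor : ∀ s ∈ Icc 0 b, ⌊s / ε⌋₊ ∈ Finset.range N := by
    intro s hs
    rw [Finset.mem_range, hN, Nat.lt_succ_iff]
    exact Nat.floor_mono (by gcongr; exact hs.2)
  have hnode : ∀ n ∈ Finset.range N, (n : ℝ) * ε ∈ Icc 0 b := by
    intro n hn
    rw [Finset.mem_range, hN, Nat.lt_succ_iff, Nat.le_floor_iff (by positivity),
      le_div_iff₀ hε0] at hn
    exact ⟨by positivity, hn⟩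
  have hsum : ∀ f : ℝ → ℝ, (c.sum fun s a => a * f s) = ∫ s, f (⌊s / ε⌋₊ * ε) ∂ν := by
    intro f
    have e : ∀ᵐ s ∂ν, f (⌊s / ε⌋₊ * ε)
        = ∑ n ∈ Finset.range N, {s | ⌊s / ε⌋₊ = n}.indicator (fun _ => f (n * ε)) s := by
      filter_upwards [hν.ae_mem] with s hs
      rw [Finset.sum_eq_single_of_mem _ (hfloor s hs)]
      · rw [indicator_of_mem]; rfl
      · intro n _ hn
        rw [indicator_of_notMem]
        exact fun h => hn h.symm
    have hms : ∀ n : ℕ, MeasurableSet {s : ℝ | ⌊s / ε⌋₊ = n} := fun n =>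
      hmeas (measurableSet_singleton n)
    rw [integral_congr_ae e, integral_finsetSum _ fun n _ =>
      (integrable_const _).indicator (hms n), hc, ← Finsupp.sum_finsetSum_index (by simp)
      (by intros; ring)]
    refine Finset.sum_congr rfl fun n _ => ?_
    rw [Finsupp.sum_single_index (by simp), integral_indicator_const _ (hms n), smul_eq_mul]
  refine ⟨c, ⟨fun s => ?_, fun s hs => ?_, ?_⟩, fun x hx => ?_⟩
  · rw [hc, Finsupp.finsetSum_apply]
    refine Finset.sum_nonneg fun n _ => ?_
    rw [Finsupp.single_apply]
    split_ifs
    exacts [measureReal_nonneg, le_rfl]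
  · by_contra hns
    refine Finsupp.mem_support_iff.1 hs ?_
    rw [hc, Finsupp.finsetSum_apply]
    refine Finset.sum_eq_zero fun n hn => ?_
    rw [Finsupp.single_apply, if_neg]
    rintro rfl
    exact hns (hnode n hn)
  · simpa using hsum fun _ => 1
  · have h1 := hsum fun s => R (s - x)
    have h2 : combCov R c x = c.sum fun s a => a * R (s - x) := by
      unfold combCov
      simp_rw [← hX.cov_neg (x - _), neg_sub]
    rw [h2, h1, potential]
    have i1 : Integrable (fun s : ℝ => R (⌊s / ε⌋₊ * ε - x)) ν :=
      Integrable.of_bound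
        (hR.measurable.comp (((measurable_from_nat (f := fun n : ℕ => (n : ℝ))).comp
        hmeas).mul_const ε |>.sub_const x)).aestronglyMeasurable (R 0)
        (.of_forall fun s => hX.abs_cov_le _)
    rw [← integral_sub i1 (hX.integrable_kernel ν x)]
    have := norm_integral_le_of_norm_le_const (μ := ν) (C := η)
      (f := fun s => R (⌊s / ε⌋₊ * ε - x) - R (s - x)) ?_
    · simpa using this
    · filter_upwards [hν.ae_mem] with s hs
      have h3 := hnode _ (hfloor s hs)
      refine (hRδ _ ⟨by linarith [h3.1, hx.2], by linarith [h3.2, hx.1]⟩ _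
        ⟨by linarith [hs.1, hx.2], by linarith [hs.2, hx.1]⟩ ?_).le
      rw [Real.dist_eq, sub_sub_sub_cancel_right]
      have h4 := Nat.floor_le (a := s / ε) (div_nonneg hs.1 hε0.le)
      have h5 := Nat.lt_floor_add_one (s / ε)
      rw [le_div_iff₀ hε0] at h4
      rw [div_lt_iff₀ hε0] at h5
      rw [abs_lt]
      constructor <;> nlinarith

end Weight

section Estimates

variable {R : ℝ → ℝ} {b : ℝ} {c : ℝ →₀ ℝ}
  {Ω : Type*} [MeasurableSpace Ω] {P : Measure Ω} [IsProbabilityMeasure P] {X : ℝ → Ω → ℝ}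

namespace IsStationaryGaussian

variable (hX : IsStationaryGaussian P X R)
include hX

theorem exists_le_meanExcess (hb : 0 ≤ b) (hpos : 0 < P {ω | 1 < pathMin X b ω}) {L : ℝ}
    (hL0 : 0 < L) (hL : ∀ x ∈ Icc 0 b, L ≤ combCov R c x) :
    ∃ K p : ℝ, 0 < p ∧ ∀ u, 0 ≤ u →
      p * Real.exp (-(u / L * K) - (u / L) ^ 2 * (∫ ω, linComb X c ω ^ 2 ∂P) / 2)
        ≤ meanExcess P X b u := by
  have hm := hX.measurable_pathMin hb
  have hY := hX.measurable_linComb c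
  set v := ∫ ω, linComb X c ω ^ 2 ∂P
  obtain ⟨K, hK⟩ : ∃ K : ℕ, 0 < P {ω | 1 < pathMin X b ω ∧ linComb X c ω ≤ K} := by
    by_contra! h
    refine hpos.ne' (measure_mono_null (t := ⋃ K : ℕ, {ω | 1 < pathMin X b ω ∧ linComb X c ω ≤ K})
      (fun ω hω => ?_) (measure_iUnion_null fun K => nonpos_iff_eq_zero.1 (h K)))
    obtain ⟨K, hK⟩ := exists_nat_ge (linComb X c ω)
    exact mem_iUnion.2 ⟨K, hω, hK⟩
  set A := {ω | 1 < pathMin X b ω ∧ linComb X c ω ≤ K} with hA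
  have hAm : MeasurableSet A :=
    (measurableSet_lt measurable_const hm).inter (measurableSet_le hY measurable_const)
  refine ⟨K, P.real A, ENNReal.toReal_pos hK.ne' (measure_ne_top _ _), fun u hu => ?_⟩
  have hl : 0 ≤ u / L := div_nonneg hu hL0.le
  have h1 := hX.integral_exp_mul_excess_le hb (-(u / L) • c) 0
  simp only [linComb_smul, mul_pow, neg_sq, integral_const_mul, combCov_smul, sub_zero] at h1
  have hint : Integrable (fun ω => Real.exp (-(u / L) * linComb X c ω - (u / L) ^ 2 * v / 2)
      * max (pathMin X b ω) 0) P := by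
    have := (hX.integrable_exp_mul_excess hb (-(u / L) • c) 0).const_mul
      (Real.exp (-((u / L) ^ 2 * v / 2)))
    refine this.congr (.of_forall fun ω => ?_)
    simp only [linComb_smul, sub_zero]
    rw [sub_eq_neg_add, Real.exp_add]
    ring
  refine le_trans ?_ (h1.trans ?_)
  · calc P.real A * Real.exp (-(u / L * K) - (u / L) ^ 2 * v / 2)
        = ∫ ω, A.indicator (fun _ => Real.exp (-(u / L * K) - (u / L) ^ 2 * v / 2)) ω ∂P := by
          rw [integral_indicator_const _ hAm, smul_eq_mul]
      _ ≤ _ := by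
          refine integral_mono ((integrable_const _).indicator hAm) hint fun ω => ?_
          by_cases h : ω ∈ A
          · rw [indicator_of_mem h]
            have h2 : (1 : ℝ) ≤ max (pathMin X b ω) 0 := h.1.le.trans (le_max_left _ _)
            have h3 : u / L * linComb X c ω ≤ u / L * K := mul_le_mul_of_nonneg_left h.2 hl
            refine le_trans ?_ (le_mul_of_one_le_right (Real.exp_pos _).le h2)
            exact Real.exp_le_exp.2 (by linarith)
          · rw [indicator_of_notMem h]
            positivity
  · have hφ := hX.continuous_combCov (-(u / L) • c)
    simp only [funext fun t => combCov_smul R (-(u / L)) c t] at hφ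
    have hle : ∀ ω, infOn (fun t => X t ω + -(u / L) * combCov R c t) b ≤ pathMin X b ω - u := by
      intro ω
      obtain ⟨t, ht, e⟩ := exists_eq_infOn (hX.continuous ω) hb
      refine (infOn_le ((hX.continuous ω).add hφ) ht).trans ?_
      have h2 : u / L * L = u := div_mul_cancel₀ u hL0.ne'
      have h3 := mul_le_mul_of_nonneg_left (hL t ht) hl
      have e : X t ω = pathMin X b ω := e
      show X t ω + -(u / L) * combCov R c t ≤ _
      rw [e]
      linarith
    refine integral_mono_of_nonneg (.of_forall fun ω => le_max_right _ _)
      (hX.integrable_excess hb u) (.of_forall fun ω => max_le_max (hle ω) le_rfl)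

theorem integral_linComb_mul_excess_le (hb : 0 ≤ b) (d : ℝ →₀ ℝ) {l u : ℝ} (hl : 0 < l)
    (hu : 0 ≤ u) (a : ℝ) :
    ∫ ω, linComb X d ω * max (pathMin X b ω - u) 0 ∂P
      ≤ a * meanExcess P X b u + l⁻¹ * Real.exp (-(l * a) + l ^ 2 * (∫ ω, linComb X d ω ^ 2 ∂P) / 2
        + l * combCov R d 0 + R 0 / 2) := by
  set w := ∫ ω, linComb X d ω ^ 2 ∂P
  have hE := hX.integral_exp_linComb (l • d + Finsupp.single 0 1)
  have hEi := hX.integrable_exp_linComb (l • d + Finsupp.single 0 1)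
  simp only [linComb_add, linComb_smul, linComb_single, one_mul] at hE hEi
  have hvar : ∫ ω, (l * linComb X d ω + X 0 ω) ^ 2 ∂P
      = l ^ 2 * w + 2 * (l * combCov R d 0) + R 0 := by
    have e : ∀ ω, (l * linComb X d ω + X 0 ω) ^ 2 = l ^ 2 * linComb X d ω ^ 2
        + (2 * l) * (X 0 ω * linComb X d ω) + X 0 ω ^ 2 := by intro ω; ring
    have i1 := (hX.memLp_linComb d).integrable_sq.const_mul (l ^ 2)
    have i2 : Integrable (fun ω => (2 * l) * (X 0 ω * linComb X d ω)) P :=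
      ((hX.memLp 0).integrable_mul (hX.memLp_linComb d)).const_mul (2 * l)
    simp_rw [e]
    rw [integral_add (by exact i1.add i2) (hX.memLp 0).integrable_sq, integral_add i1 i2,
      integral_const_mul, integral_const_mul, hX.integral_mul_linComb, hX.integral_sq]
    ring
  rw [hvar] at hE
  have hpt : ∀ ω, linComb X d ω * max (pathMin X b ω - u) 0 ≤ a * max (pathMin X b ω - u) 0
      + l⁻¹ * Real.exp (-(l * a)) * Real.exp (l * linComb X d ω + X 0 ω) := by
    intro ω
    have h0 : 0 ≤ max (pathMin X b ω - u) 0 := le_max_right _ _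
    have h1 : max (pathMin X b ω - u) 0 ≤ Real.exp (X 0 ω) := by
      refine max_le ?_ (Real.exp_pos _).le
      linarith [Real.add_one_le_exp (X 0 ω), hX.pathMin_le ω (left_mem_Icc.2 hb)]
    have h2 : linComb X d ω - a ≤ l⁻¹ * Real.exp (l * (linComb X d ω - a)) := by
      rw [inv_mul_eq_div, le_div_iff₀ hl]
      linarith [Real.add_one_le_exp (l * (linComb X d ω - a))]
    have h3 : (linComb X d ω - a) * max (pathMin X b ω - u) 0
        ≤ l⁻¹ * Real.exp (l * (linComb X d ω - a)) * Real.exp (X 0 ω) :=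
      (mul_le_mul_of_nonneg_right h2 h0).trans (mul_le_mul_of_nonneg_left h1 (by positivity))
    have h4 : l⁻¹ * Real.exp (l * (linComb X d ω - a)) * Real.exp (X 0 ω)
        = l⁻¹ * Real.exp (-(l * a)) * Real.exp (l * linComb X d ω + X 0 ω) := by
      rw [mul_assoc, mul_assoc, ← Real.exp_add, ← Real.exp_add]
      ring_nf
    rw [← h4]
    linarith
  have i3 := (hX.integrable_excess hb u).const_mul a
  have i4 := hEi.const_mul (l⁻¹ * Real.exp (-(l * a)))
  have i5 : Integrable (fun ω => linComb X d ω * max (pathMin X b ω - u) 0) P :=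
    (hX.memLp_linComb d).integrable_mul (hX.memLp_excess hb u)
  refine (integral_mono i5 (i3.add i4) hpt).trans_eq ?_
  rw [integral_add' i3 i4, integral_const_mul, integral_const_mul, hE, mul_assoc, ← Real.exp_add,
    meanExcess]
  congr 3
  ring

omit [IsProbabilityMeasure P] in
theorem integral_linComb_sq_le (hc : IsWeight b c) {M : ℝ}
    (hM : ∀ x ∈ Icc 0 b, combCov R c x ≤ M) : ∫ ω, linComb X c ω ^ 2 ∂P ≤ M := by
  simp_rw [sq]
  rw [hX.integral_linComb_mul]
  exact hc.sum_mul_le hM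

omit [IsProbabilityMeasure P] in
theorem integral_mix_sq (c : ℝ →₀ ℝ) (θ s : ℝ) :
    ∫ ω, linComb X ((1 - θ) • c + Finsupp.single s θ) ω ^ 2 ∂P
      = (1 - θ) ^ 2 * (∫ ω, linComb X c ω ^ 2 ∂P) + 2 * θ * (1 - θ) * combCov R c s
        + θ ^ 2 * R 0 := by
  have e : ∀ ω, linComb X ((1 - θ) • c + Finsupp.single s θ) ω ^ 2
      = (1 - θ) ^ 2 * linComb X c ω ^ 2
        + (2 * θ * (1 - θ)) * (X s ω * linComb X c ω) + θ ^ 2 * X s ω ^ 2 := by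
    intro ω
    rw [linComb_add, linComb_smul, linComb_single]
    ring
  have i1 := (hX.memLp_linComb c).integrable_sq.const_mul ((1 - θ) ^ 2)
  have i2 : Integrable (fun ω => (2 * θ * (1 - θ)) * (X s ω * linComb X c ω)) P :=
    ((hX.memLp s).integrable_mul (hX.memLp_linComb c)).const_mul _
  simp_rw [e]
  rw [integral_add (by exact i1.add i2) ((hX.memLp s).integrable_sq.const_mul _),
    integral_add i1 i2, integral_const_mul, integral_const_mul, integral_const_mul,
    hX.integral_mul_linComb, hX.integral_sq]

theorem mul_meanExcess_le_integral_linComb_mul (hb : 0 ≤ b) (hc : IsWeight b c) (u : ℝ) :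
    u * meanExcess P X b u ≤ ∫ ω, linComb X c ω * max (pathMin X b ω - u) 0 ∂P := by
  rw [meanExcess, ← integral_const_mul]
  refine integral_mono ((hX.integrable_excess hb u).const_mul u)
    ((hX.memLp_linComb c).integrable_mul (hX.memLp_excess hb u)) fun ω => ?_
  rcases le_total (pathMin X b ω - u) 0 with h | h
  · simp [max_eq_right h]
  · exact mul_le_mul_of_nonneg_right
      (by linarith [hc.pathMin_le_linComb hX ω]) (le_max_right _ _)

end IsStationaryGaussian
end Estimates

section Asymptotics

variable {R : ℝ → ℝ} {b S : ℝ}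
  {Ω : Type*} [MeasurableSpace Ω] {P : Measure Ω} [IsProbabilityMeasure P] {X : ℝ → Ω → ℝ}

theorem eventually_exp_quadratic_le {ε : ℝ} (hε : 0 < ε) (β γ : ℝ) {κ : ℝ} (hκ : 0 < κ) :
    ∀ᶠ u : ℝ in atTop, Real.exp (-(ε * u ^ 2) + β * u + γ) ≤ κ := by
  have h1 : Tendsto (fun u : ℝ => u * (β - ε * u)) atTop atBot := by
    refine tendsto_id.atTop_mul_atBot₀ ?_
    exact tendsto_atBot_add_const_left _ β
      (tendsto_neg_atTop_atBot.comp (tendsto_id.const_mul_atTop hε))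
  have h2 : Tendsto (fun u : ℝ => u * (β - ε * u) + γ) atTop atBot :=
    tendsto_atBot_add_const_right _ γ h1
  filter_upwards [(Real.tendsto_exp_atBot.comp h2).eventually_le_const hκ] with u hu
  refine le_of_eq_of_le ?_ hu
  simp only [Function.comp]
  ring_nf

theorem rate_pos {y ρ S v w : ℝ} (hS : 0 < S) (hy : 0 < y) (hy4 : y ≤ 1 / 4)
    (hv : v ≤ S * (1 + y)) (hw : w ≤ S * (1 + y + y * ρ)) :
    0 < (1 + y * (4 + ρ / 2)) / S - w / (2 * S ^ 2) - v / (2 * (S * (1 - y)) ^ 2) := by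
  have h1 : w / (2 * S ^ 2) ≤ (1 + y + y * ρ) / (2 * S) := by
    rw [div_le_div_iff₀ (by positivity) (by positivity)]
    nlinarith [mul_le_mul_of_nonneg_left hw (by positivity : 0 ≤ 2 * S)]
  have hy1 : 0 < 1 - y := by linarith
  have h2 : v / (2 * (S * (1 - y)) ^ 2) ≤ (1 + 5 * y) / (2 * S) := by
    have h3 : 1 + y ≤ (1 + 5 * y) * (1 - y) ^ 2 := by nlinarith [mul_pos hy hy, pow_pos hy 3]
    rw [div_le_div_iff₀ (by positivity) (by positivity)]
    calc v * (2 * S) ≤ S * (1 + y) * (2 * S) := by gcongr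
      _ = 2 * S ^ 2 * (1 + y) := by ring
      _ ≤ 2 * S ^ 2 * ((1 + 5 * y) * (1 - y) ^ 2) := by gcongr
      _ = (1 + 5 * y) * (2 * (S * (1 - y)) ^ 2) := by ring
  have h3 : (1 + y * (4 + ρ / 2)) / S - (1 + y + y * ρ) / (2 * S) - (1 + 5 * y) / (2 * S)
      = y / S := by field_simp; ring
  have h4 : 0 < y / S := by positivity
  linarith

theorem IsStationaryGaussian.eventually_integral_mul_excess_le (hX : IsStationaryGaussian P X R)
    (hb : 0 ≤ b) (hS : 0 < S) (happ : ∀ η, 0 < η → ∃ c, IsWeight b c ∧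
      ∀ x ∈ Icc 0 b, |combCov R c x - S| ≤ η)
    (hpos : 0 < P {ω | 1 < pathMin X b ω}) {s : ℝ} (hs : s ∈ Icc 0 b) {τ : ℝ} (hτ : 0 < τ) :
    ∀ᶠ u in atTop, ∫ ω, X s ω * max (pathMin X b ω - u) 0 ∂P
      ≤ (1 + τ) * (u * meanExcess P X b u) := by
  set ρ := R 0 / S with hρ
  have hρ0 : 0 ≤ ρ := div_nonneg hX.cov_zero_nonneg hS.le
  set B := 4 + ρ / 2 with hB
  have hB0 : 0 < B := by positivity
  set θ := min (1 / 2) (τ / (2 * B)) with hθ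
  have hθ0 : 0 < θ := lt_min (by norm_num) (by positivity)
  have hθ2 : θ ≤ 1 / 2 := min_le_left _ _
  have hθτ : 2 * θ * B ≤ τ := by
    have : θ ≤ τ / (2 * B) := min_le_right _ _
    rw [le_div_iff₀ (by positivity)] at this
    linarith
  set y := θ ^ 2 with hy
  have hy0 : 0 < y := by positivity
  have hy4 : y ≤ 1 / 4 := by rw [hy]; nlinarith
  obtain ⟨c, hc, hcS⟩ := happ (y * S) (by positivity)
  have hcov_le : ∀ x ∈ Icc 0 b, combCov R c x ≤ S * (1 + y) := fun x hx => by
    linarith [(abs_le.1 (hcS x hx)).2]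
  have hle_cov : ∀ x ∈ Icc 0 b, S * (1 - y) ≤ combCov R c x := fun x hx => by
    linarith [(abs_le.1 (hcS x hx)).1]
  have hL0 : 0 < S * (1 - y) := mul_pos hS (by linarith)
  obtain ⟨K, p, hp, hlow⟩ := hX.exists_le_meanExcess hb hpos hL0 hle_cov
  have hv := hX.integral_linComb_sq_le hc hcov_le
  set d := (1 - θ) • c + Finsupp.single s θ with hd
  have hwe := hX.integral_mix_sq c θ s
  rw [← hd] at hwe
  set v := ∫ ω, linComb X c ω ^ 2 ∂P
  have hw : ∫ ω, linComb X d ω ^ 2 ∂P ≤ S * (1 + y + y * ρ) := by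
    have h1 : S * ρ = R 0 := by rw [hρ]; field_simp
    have h2 := hcov_le s hs
    have h3 := mul_le_mul_of_nonneg_left hv (sq_nonneg (1 - θ))
    have h4 := mul_le_mul_of_nonneg_left h2 (by nlinarith : 0 ≤ 2 * θ * (1 - θ))
    have h5 : 0 ≤ θ ^ 2 * (S * (1 + y)) := by positivity
    rw [hwe]
    calc _ ≤ (1 - θ) ^ 2 * (S * (1 + y)) + 2 * θ * (1 - θ) * (S * (1 + y)) + θ ^ 2 * R 0 := by
          linarith
      _ = (1 - θ ^ 2) * (S * (1 + y)) + θ ^ 2 * (S * ρ) := by rw [h1]; ring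
      _ ≤ S * (1 + y) + θ ^ 2 * (S * ρ) := by linarith
      _ = _ := by rw [hy]; ring
  set w := ∫ ω, linComb X d ω ^ 2 ∂P
  have hε := rate_pos (ρ := ρ) hS hy0 hy4 hv hw
  set ε := (1 + y * (4 + ρ / 2)) / S - w / (2 * S ^ 2) - v / (2 * (S * (1 - y)) ^ 2)
  have hev := eventually_exp_quadratic_le hε (combCov R d 0 / S + K / (S * (1 - y))) (R 0 / 2)
    (κ := y * B * p / S) (by positivity)
  filter_upwards [hev, eventually_ge_atTop 1] with u hu hu1
  have hu0 : 0 < u := by linarith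
  have hg0 : 0 ≤ meanExcess P X b u := integral_nonneg fun ω => le_max_right _ _
  have h1 := hX.integral_linComb_mul_excess_le hb d (l := u / S) (by positivity) hu0.le
    (u * (1 + y * B))
  have h2 := hlow u hu0.le
  set E1 := -(u / S * (u * (1 + y * B))) + (u / S) ^ 2 * w / 2 + u / S * combCov R d 0 + R 0 / 2
    with hE1
  set E2 := -(u / (S * (1 - y)) * K) - (u / (S * (1 - y))) ^ 2 * v / 2 with hE2
  have hE : -(ε * u ^ 2) + (combCov R d 0 / S + K / (S * (1 - y))) * u + R 0 / 2 = E1 - E2 := by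
    simp only [ε, hE1, hE2, hB]
    have : 1 - y ≠ 0 := by linarith
    field_simp
    ring
  have h3 : (u / S)⁻¹ * Real.exp E1 ≤ y * B * u * meanExcess P X b u := by
    rw [hE, Real.exp_sub, div_le_iff₀ (Real.exp_pos _)] at hu
    calc (u / S)⁻¹ * Real.exp E1 ≤ (u / S)⁻¹ * (y * B * p / S * Real.exp E2) := by gcongr
      _ = u⁻¹ * (y * B) * (p * Real.exp E2) := by field_simp
      _ ≤ u * (y * B) * (p * Real.exp E2) := by
          gcongr
          exact (inv_le_one_of_one_le₀ hu1).trans hu1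
      _ ≤ u * (y * B) * meanExcess P X b u := by gcongr
      _ = _ := by ring
  have h4 : ∫ ω, linComb X d ω * max (pathMin X b ω - u) 0 ∂P
      = (1 - θ) * (∫ ω, linComb X c ω * max (pathMin X b ω - u) 0 ∂P)
        + θ * ∫ ω, X s ω * max (pathMin X b ω - u) 0 ∂P := by
    have i1 : Integrable (fun ω => (1 - θ) * (linComb X c ω * max (pathMin X b ω - u) 0)) P :=
      ((hX.memLp_linComb c).integrable_mul (hX.memLp_excess hb u)).const_mul (1 - θ)
    have i2 : Integrable (fun ω => θ * (X s ω * max (pathMin X b ω - u) 0)) P :=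
      ((hX.memLp s).integrable_mul (hX.memLp_excess hb u)).const_mul θ
    rw [← integral_const_mul, ← integral_const_mul, ← integral_add i1 i2]
    refine integral_congr_ae (.of_forall fun ω => ?_)
    simp only [hd, linComb_add, linComb_smul, linComb_single]
    ring
  have h5 := mul_le_mul_of_nonneg_left (hX.mul_meanExcess_le_integral_linComb_mul hb hc u)
    (by linarith : 0 ≤ 1 - θ)
  rw [h4] at h1
  refine le_of_mul_le_mul_left ?_ hθ0
  have hug : 0 ≤ u * meanExcess P X b u := by positivity
  calc θ * ∫ ω, X s ω * max (pathMin X b ω - u) 0 ∂P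
      ≤ (θ + 2 * (y * B)) * (u * meanExcess P X b u) := by linarith
    _ = θ * ((1 + 2 * θ * B) * (u * meanExcess P X b u)) := by rw [hy]; ring
    _ ≤ _ := by gcongr

theorem IsStationaryGaussian.mul_meanExcess_le (hX : IsStationaryGaussian P X R)
    (hb : 0 ≤ b) (happ : ∀ η, 0 < η → ∃ c, IsWeight b c ∧
      ∀ x ∈ Icc 0 b, |combCov R c x - S| ≤ η) {T : Ω → ℝ}
    (hTm : Measurable T) (hT : ∀ ω, T ω ∈ Icc 0 b) (hTX : ∀ ω, X (T ω) ω = pathMin X b ω) (u : ℝ) :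
    u * meanExcess P X b u ≤ S * P.real {ω | u < pathMin X b ω} := by
  have hm := hX.measurable_pathMin hb
  have hR := hX.continuous_cov
  have hEm : MeasurableSet {ω | u < pathMin X b ω} := measurableSet_lt measurable_const hm
  have key : ∀ η, 0 < η → u * meanExcess P X b u ≤ (S + η) * P.real {ω | u < pathMin X b ω} := by
    intro η hη
    obtain ⟨c, hc, hcS⟩ := happ η hη
    refine (hX.mul_meanExcess_le_integral_linComb_mul hb hc u).trans ?_
    have h1 : ∫ ω, linComb X c ω * max (pathMin X b ω - u) 0 ∂P
        = ∫ ω, (if u < pathMin X b ω then combCov R c (T ω) else 0) ∂P := by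
      have e1 : ∀ ω, linComb X c ω * max (pathMin X b ω - u) 0
          = ∑ s ∈ c.support, c s * (X s ω * max (pathMin X b ω - u) 0) := by
        intro ω
        simp_rw [linComb, Finsupp.sum, Finset.sum_mul, mul_assoc]
      have e2 : ∀ ω, (if u < pathMin X b ω then combCov R c (T ω) else 0)
          = ∑ s ∈ c.support, c s * (if u < pathMin X b ω then R (T ω - s) else 0) := by
        intro ω
        split_ifs
        · rfl
        · simp
      simp_rw [e1, e2]
      have i : ∀ s ∈ c.support,
          Integrable (fun ω => c s * (X s ω * max (pathMin X b ω - u) 0)) P := fun s _ =>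
        ((hX.memLp s).integrable_mul (hX.memLp_excess hb u)).const_mul (c s)
      rw [integral_finsetSum _ i, integral_finsetSum]
      · refine Finset.sum_congr rfl fun s _ => ?_
        rw [integral_const_mul, integral_const_mul]
        exact congrArg _ (hX.integral_mul_excess hb hTm hT hTX s u)
      · intro s _
        refine (Integrable.of_bound (C := R 0) (Measurable.ite hEm (hR.measurable.comp
          (hTm.sub_const s)) measurable_const).aestronglyMeasurable
          (.of_forall fun ω => ?_)).const_mul _
        split_ifs
        · exact hX.abs_cov_le _
        · simpa using hX.cov_zero_nonneg
    rw [h1]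
    calc ∫ ω, (if u < pathMin X b ω then combCov R c (T ω) else 0) ∂P
        ≤ ∫ ω, {ω | u < pathMin X b ω}.indicator (fun _ => S + η) ω ∂P := by
          refine integral_mono (Integrable.of_bound (C := |S| + η) (Measurable.ite hEm
            ((hX.continuous_combCov c).measurable.comp hTm) measurable_const).aestronglyMeasurable
            (.of_forall fun ω => ?_)) ((integrable_const _).indicator hEm) fun ω => ?_
          · split_ifs
            · rw [Real.norm_eq_abs]
              have := abs_sub_abs_le_abs_sub (combCov R c (T ω)) S
              linarith [hcS _ (hT ω)]
            · rw [norm_zero]; positivity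
          · by_cases h : u < pathMin X b ω
            · rw [if_pos h, indicator_of_mem (by exact h)]
              linarith [(abs_le.1 (hcS _ (hT ω))).2]
            · rw [if_neg h, indicator_of_notMem (by exact h)]
      _ = _ := by rw [integral_indicator_const _ hEm, smul_eq_mul, mul_comm]
  refine le_of_forall_pos_le_add fun η hη => ?_
  have h1 := key η hη
  have h2 : P.real {ω | u < pathMin X b ω} ≤ 1 := measureReal_le_one
  nlinarith

/-- Conditionally on a high minimum, the covariance with any fixed point is asymptotically at
most the minimal energy. -/
theorem IsStationaryGaussian.eventually_integral_cov_le (hX : IsStationaryGaussian P X R)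
    (hb : 0 ≤ b) (hS : 0 < S) (happ : ∀ η, 0 < η → ∃ c, IsWeight b c ∧
      ∀ x ∈ Icc 0 b, |combCov R c x - S| ≤ η)
    (hpos : 0 < P {ω | 1 < pathMin X b ω}) {T : Ω → ℝ}
    (hTm : Measurable T) (hT : ∀ ω, T ω ∈ Icc 0 b) (hTX : ∀ ω, X (T ω) ω = pathMin X b ω)
    {s : ℝ} (hs : s ∈ Icc 0 b) {τ : ℝ} (hτ : 0 < τ) :
    ∀ᶠ u in atTop, ∫ ω, (if u < pathMin X b ω then R (T ω - s) else 0) ∂P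
      ≤ (1 + τ) * (S * P.real {ω | u < pathMin X b ω}) := by
  filter_upwards [hX.eventually_integral_mul_excess_le hb hS happ hpos hs hτ] with u hu
  rw [← hX.integral_mul_excess hb hTm hT hTX]
  exact hu.trans (mul_le_mul_of_nonneg_left (hX.mul_meanExcess_le hb happ hTm hT hTX u)
    (by linarith))

end Asymptotics

section Limit

variable {R : ℝ → ℝ} {b S : ℝ} {ν : Measure ℝ}

/-- Probability measures on `[0, b]` whose potentials are asymptotically bounded by the minimal
energy converge to the minimizer. -/
theorem tendsto_integral_of_potential_le {ι : Type*} {l : Filter ι} [l.NeBot]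
    {μ : ι → ProbabilityMeasure (Icc 0 b)} (hR : Continuous R) (hS : 0 ≤ S)
    (hμ : ∀ s ∈ Icc 0 b, ∀ τ : ℝ, 0 < τ →
      ∀ᶠ i in l, ∫ x : Icc 0 b, R (x - s) ∂(μ i : Measure (Icc 0 b)) ≤ (1 + τ) * S)
    (huniq : ∀ κ, IsProbOn b κ → statEnergy R κ ≤ S → κ = ν) {f : ℝ → ℝ} (hf : Continuous f) :
    Tendsto (fun i => ∫ x : Icc 0 b, f x ∂(μ i : Measure (Icc 0 b))) l (nhds (∫ x, f x ∂ν)) := by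
  have hemb : MeasurableEmbedding (Subtype.val : Icc 0 b → ℝ) :=
    MeasurableEmbedding.subtype_coe measurableSet_Icc
  have hcont : ∀ g : ℝ → ℝ, Continuous g →
      Continuous fun κ : ProbabilityMeasure (Icc 0 b) =>
        ∫ x : Icc 0 b, g x ∂(κ : Measure (Icc 0 b)) :=
    fun g hg => ProbabilityMeasure.continuous_integral_continuousMap
      (⟨fun x => g x, hg.comp continuous_subtype_val⟩ : C(Icc 0 b, ℝ))
  have hclu : ∀ κ : ProbabilityMeasure (Icc 0 b), MapClusterPt κ l μ →
      (κ : Measure (Icc 0 b)).map Subtype.val = ν := by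
    intro κ hκ
    have hp : IsProbabilityMeasure ((κ : Measure (Icc 0 b)).map Subtype.val) :=
      Measure.isProbabilityMeasure_map hemb.measurable.aemeasurable
    refine huniq _ ⟨hp, ?_⟩ ?_
    · rw [hemb.map_apply]
      convert measure_empty (μ := (κ : Measure (Icc 0 b)))
      ext x
      simp
    · have hpot : ∀ s ∈ Icc 0 b, ∫ x : Icc 0 b, R (x - s) ∂(κ : Measure (Icc 0 b)) ≤ S := by
        intro s hs
        have h1 : ∀ τ : ℝ, 0 < τ →
            ∫ x : Icc 0 b, R (x - s) ∂(κ : Measure (Icc 0 b)) ≤ (1 + τ) * S := fun τ hτ =>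
          (isClosed_le (hcont (fun x => R (x - s)) (by fun_prop))
            continuous_const).mem_of_mapClusterPt hκ (hμ s hs τ hτ)
        have h2 : Tendsto (fun τ : ℝ => (1 + τ) * S) (nhdsWithin 0 (Ioi 0)) (nhds S) := by
          have : Continuous fun τ : ℝ => (1 + τ) * S := by fun_prop
          simpa using this.continuousWithinAt (s := Ioi 0) (x := (0 : ℝ)) |>.tendsto
        exact ge_of_tendsto h2 (eventually_mem_nhdsWithin.mono h1)
      unfold statEnergy
      rw [hemb.integral_map]
      simp_rw [hemb.integral_map]
      by_cases hi : Integrable (fun s : Icc 0 b =>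
          ∫ t : Icc 0 b, R (t - s) ∂(κ : Measure (Icc 0 b))) (κ : Measure (Icc 0 b))
      · exact (integral_mono hi (integrable_const S) fun s => hpot s s.2).trans (by simp)
      · rwa [integral_undef hi]
  obtain ⟨y, hy⟩ := exists_clusterPt_of_compactSpace (map μ l)
  have huy : ∀ κ : ProbabilityMeasure (Icc 0 b), MapClusterPt κ l μ → κ = y := fun κ hκ =>
    Subtype.ext (by
      have h := congrArg (Measure.comap (Subtype.val : Icc 0 b → ℝ))
        ((hclu κ hκ).trans (hclu y hy).symm)
      rwa [hemb.comap_map, hemb.comap_map] at h)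
  have h := ((hcont f hf).tendsto y).comp (tendsto_nhds_of_unique_mapClusterPt huy)
  rwa [← hemb.integral_map, hclu y hy] at h

variable {Ω : Type*} [MeasurableSpace Ω] {P : Measure Ω} [IsProbabilityMeasure P] {X : ℝ → Ω → ℝ}

theorem IsStationaryGaussian.tendsto_integral_cond (hX : IsStationaryGaussian P X R)
    (hb : 0 ≤ b) (hR : StrictConvexOn ℝ (Icc 0 b) R) (hν : IsProbOn b ν)
    (hopt : ∀ ρ, IsProbOn b ρ → statEnergy R ν ≤ statEnergy R ρ)
    (hpos : ∀ u : ℝ, 0 < u → 0 < P {ω | u < pathMin X b ω}) {T : Ω → ℝ}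
    (hTm : Measurable T) (hT : ∀ ω, T ω ∈ Icc 0 b) (hTX : ∀ ω, X (T ω) ω = pathMin X b ω)
    {f : ℝ → ℝ} (hf : Continuous f) :
    Tendsto (fun u => ∫ ω, f (T ω) ∂(cond P {ω | u < pathMin X b ω})) atTop
      (nhds (∫ x, f x ∂ν)) := by
  have hE : ∀ u, P {ω | u < pathMin X b ω} ≠ 0 := fun u =>
    ((hpos (max u 1) (by positivity)).trans_le
      (measure_mono fun ω (h : max u 1 < _) => (le_max_left u 1).trans_lt h)).ne'
  have hEm : ∀ u, MeasurableSet {ω | u < pathMin X b ω} := fun u =>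
    measurableSet_lt measurable_const (hX.measurable_pathMin hb)
  have hQ : ∀ u, IsProbabilityMeasure (cond P {ω | u < pathMin X b ω}) := fun u =>
    cond_isProbabilityMeasure (hE u)
  have hTs : Measurable fun ω => (⟨T ω, hT ω⟩ : Icc 0 b) := hTm.subtype_mk
  set μ : ℝ → ProbabilityMeasure (Icc 0 b) := fun u =>
    ⟨(cond P {ω | u < pathMin X b ω}).map fun ω => ⟨T ω, hT ω⟩,
      Measure.isProbabilityMeasure_map hTs.aemeasurable⟩
  have hint : ∀ u (g : ℝ → ℝ), Continuous g → ∫ x : Icc 0 b, g x ∂(μ u : Measure (Icc 0 b))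
      = ∫ ω, g (T ω) ∂(cond P {ω | u < pathMin X b ω}) := fun u g hg =>
    integral_map (f := fun x : Icc 0 b => g x) hTs.aemeasurable
      (hg.comp continuous_subtype_val).aestronglyMeasurable
  have hS := hX.statEnergy_pos hν (hpos 1 one_pos)
  have happ : ∀ η, 0 < η → ∃ c, IsWeight b c ∧
      ∀ x ∈ Icc 0 b, |combCov R c x - statEnergy R ν| ≤ η := fun η hη => by
    obtain ⟨c, hc, h⟩ := hX.exists_isWeight hb hν hη
    exact ⟨c, hc, fun x hx => hX.potential_eq_statEnergy hb hR hν hopt hx ▸ h x hx⟩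
  simp_rw [← hint _ f hf]
  refine tendsto_integral_of_potential_le (S := statEnergy R ν) hX.continuous_cov
    hS.le (fun s hs τ hτ => ?_) (fun κ hκ h => ?_) hf
  · filter_upwards [hX.eventually_integral_cov_le hb hS happ (hpos 1 one_pos) hTm hT hTX hs hτ]
      with u hu
    have hR := hX.continuous_cov
    rw [hint u (fun x => R (x - s)) (by fun_prop), ProbabilityTheory.cond, integral_smul_measure,
      ← integral_indicator (hEm u), smul_eq_mul, ENNReal.toReal_inv]
    have h0 : 0 < P.real {ω | u < pathMin X b ω} := ENNReal.toReal_pos (hE u) (measure_ne_top _ _)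
    change (P.real _)⁻¹ * _ ≤ _
    rw [inv_mul_le_iff₀ h0]
    refine le_of_eq_of_le ?_ (hu.trans_eq (by ring))
    refine integral_congr_ae (.of_forall fun ω => ?_)
    simp only [indicator_apply, Set.mem_ofPred_eq]
  · exact hX.eq_of_energy_le hb hR hν hκ hopt h

end Limit

section LeftmostArgmin

/-- The leftmost location of the minimum of `f` on `[0, b]`. -/
noncomputable def leftArgmin (f : ℝ → ℝ) (b : ℝ) : ℝ :=
  sInf {t | t ∈ Icc 0 b ∧ f t = infOn f b}

variable {f : ℝ → ℝ} {a b : ℝ}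

theorem leftArgmin_mem (hf : Continuous f) (hb : 0 ≤ b) :
    leftArgmin f b ∈ Icc 0 b ∧ f (leftArgmin f b) = infOn f b := by
  have hc : IsClosed {t | t ∈ Icc 0 b ∧ f t = infOn f b} :=
    isClosed_Icc.inter (isClosed_eq hf continuous_const)
  obtain ⟨t, ht, e⟩ := exists_eq_infOn hf hb
  exact hc.csInf_mem ⟨t, ht, e⟩ ⟨0, fun x hx => hx.1.1⟩

theorem leftArgmin_le_iff (hf : Continuous f) (ha : 0 ≤ a) (hab : a ≤ b) :
    leftArgmin f b ≤ a ↔ infOn f a ≤ infOn f b := by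
  have hm := leftArgmin_mem hf (ha.trans hab)
  refine ⟨fun h => hm.2 ▸ infOn_le hf ⟨hm.1.1, h⟩, fun h => ?_⟩
  obtain ⟨t, ht, e⟩ := exists_eq_infOn hf ha
  have htb : t ∈ Icc 0 b := ⟨ht.1, ht.2.trans hab⟩
  have hmem : t ∈ {t | t ∈ Icc 0 b ∧ f t = infOn f b} :=
    ⟨htb, (e.trans_le h).antisymm (infOn_le hf htb)⟩
  exact (csInf_le ⟨0, fun x hx => hx.1.1⟩ hmem).trans ht.2

theorem measurable_leftArgmin {Ω : Type*} [MeasurableSpace Ω] {X : ℝ → Ω → ℝ}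
    (hm : ∀ t, Measurable (X t)) (hc : ∀ ω, Continuous fun t => X t ω) (hb : 0 ≤ b) :
    Measurable fun ω => leftArgmin (fun t => X t ω) b := by
  refine measurable_of_Iic fun a => ?_
  rcases lt_or_ge a 0 with ha | ha
  · convert MeasurableSet.empty
    ext ω
    simpa using ha.trans_le (leftArgmin_mem (hc ω) hb).1.1
  rcases le_total a b with hab | hab
  · convert measurableSet_le (measurable_infOn hm hc ha) (measurable_infOn hm hc hb)
    ext ω
    exact leftArgmin_le_iff (hc ω) ha hab
  · convert MeasurableSet.univ
    ext ω
    simpa using (leftArgmin_mem (hc ω) hb).1.2.trans hab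

end LeftmostArgmin

section Modification

variable {Ω : Type*} [MeasurableSpace Ω] {P : Measure Ω} {X : ℝ → Ω → ℝ} {R : ℝ → ℝ}

/-- A centered stationary Gaussian process with continuous paths is almost surely equal to one
whose values are measurable. -/
theorem exists_isStationaryGaussian
    (hGauss : ∀ (n : ℕ) (t : Fin n → ℝ) (c : Fin n → ℝ), ∃ v : NNReal,
      P.map (fun ω => ∑ i, c i * X (t i) ω) = gaussianReal 0 v)
    (hpath : ∀ ω, Continuous fun t => X t ω)
    (hcov : ∀ s t : ℝ, (∫ ω, X s ω * X t ω ∂P) = R (t - s)) :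
    ∃ Y, IsStationaryGaussian P Y R ∧ ∀ᵐ ω ∂P, ∀ t, Y t ω = X t ω := by
  have hae : ∀ t, AEMeasurable (X t) P := fun t => by
    obtain ⟨v, hv⟩ := hGauss 1 (fun _ => t) (fun _ => 1)
    simp only [Fin.sum_univ_one, one_mul] at hv
    by_contra h
    rw [Measure.map_of_not_aemeasurable h] at hv
    exact (IsProbabilityMeasure.ne_zero (gaussianReal 0 v)) hv.symm
  have hq : ∀ᵐ ω ∂P, ∀ q : ℚ, X q ω = (hae q).mk (X q) ω :=
    ae_all_iff.2 fun q => (hae q).ae_eq_mk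
  set N := toMeasurable P {ω | ∀ q : ℚ, X q ω = (hae q).mk (X q) ω}ᶜ with hN
  have hNm : MeasurableSet Nᶜ := (measurableSet_toMeasurable _ _).compl
  have hN0 : Nᶜ ∈ ae P := by
    rw [mem_ae_iff, compl_compl, hN, measure_toMeasurable]
    exact hq
  have hNq : ∀ ω ∈ Nᶜ, ∀ q : ℚ, X q ω = (hae q).mk (X q) ω := fun ω hω => by
    by_contra h
    exact hω (subset_toMeasurable _ _ h)
  have hY : ∀ᵐ ω ∂P, ∀ t, Nᶜ.indicator (X t) ω = X t ω :=
    mem_of_superset hN0 fun ω hω t => indicator_of_mem hω _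
  have hYc : ∀ ω, Continuous fun t => Nᶜ.indicator (X t) ω := fun ω => by
    by_cases h : ω ∈ Nᶜ
    · simpa only [indicator_of_mem h] using hpath ω
    · simpa only [indicator_of_notMem h] using continuous_const
  have hYq : ∀ q : ℚ, Measurable (Nᶜ.indicator (X q)) := fun q => by
    rw [indicator_congr fun ω hω => hNq ω hω q]
    exact (hae q).measurable_mk.indicator hNm
  refine ⟨fun t => Nᶜ.indicator (X t), ⟨fun t => ?_, hYc, fun c => ?_, fun s t => ?_⟩, hY⟩
  · obtain ⟨q, -, -, hq⟩ := Real.exists_seq_rat_strictMono_tendsto t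
    exact measurable_of_tendsto_metrizable (fun n => hYq (q n))
      (tendsto_pi_nhds.2 fun ω => ((hYc ω).tendsto t).comp hq)
  · set e := c.support.equivFin
    obtain ⟨v, hv⟩ := hGauss c.support.card (fun i => e.symm i) (fun i => c (e.symm i))
    refine ⟨v, hv ▸ Measure.map_congr (hY.mono fun ω hω => ?_)⟩
    rw [linComb, Finsupp.sum, ← Finset.sum_coe_sort,
      ← e.symm.sum_comp]
    exact Finset.sum_congr rfl fun i _ => by rw [hω]
  · rw [← hcov s t]
    exact integral_congr_ae (hY.mono fun ω hω => by simp only [hω])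

end Modification

/-- Let `X` be a centered stationary Gaussian process with continuous paths
whose covariance `R` is strictly convex on `[0,b]`, with `P(min_{[0,b]} X > u) > 0` for
all `u > 0`. Let `T*` be the leftmost location of the minimum of `X` on `[0,b]`. Then the
conditional law of `T*` given `min_{[0,b]} X > u` converges weakly, as `u → ∞`, to the
unique minimizer `ν*` of `I(ν) = ∫∫ R(t-s) ν(ds) ν(dt)` over probability measures on
`[0,b]`. -/
theorem conditional_location_of_minimum_converges_to_optimal_measure
    {Ω : Type*} [MeasurableSpace Ω] (P : Measure Ω) [IsProbabilityMeasure P]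
    (X : ℝ → Ω → ℝ) (R : ℝ → ℝ) (b : ℝ) (hb : 0 < b)
    -- centered Gaussian process
    (hGauss : ∀ (n : ℕ) (t : Fin n → ℝ) (c : Fin n → ℝ),
      ∃ v : NNReal,
        Measure.map (fun ω => ∑ i, c i * X (t i) ω) P = gaussianReal 0 v)
    -- continuous sample paths
    (hpath : ∀ ω, Continuous fun t => X t ω)
    -- stationarity: the covariance function is `R(t-s)`
    (hcov : ∀ s t : ℝ, (∫ ω, X s ω * X t ω ∂P) = R (t - s))
    -- strict convexity of the covariance function on `[0,b]`
    (hconv : StrictConvexOn ℝ (Icc 0 b) R)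
    -- the conditioning events have positive probability
    (hpos : ∀ u : ℝ, 0 < u → 0 < P {ω | ∀ t ∈ Icc 0 b, u < X t ω})
    -- the leftmost location of the minimum of X on [0,b]
    (Tstar : Ω → ℝ)
    (hT : ∀ ω, Tstar ω =
      sInf {t | t ∈ Icc (0 : ℝ) b ∧ X t ω = sInf ((fun s => X s ω) '' Icc 0 b)})
    -- ν* is the (necessarily unique) optimal measure
    (νstar : Measure ℝ) (hprob : IsProbabilityMeasure νstar)
    (hsupp : νstar (Icc 0 b)ᶜ = 0)
    (hopt : ∀ ν : Measure ℝ, IsProbabilityMeasure ν → ν (Icc 0 b)ᶜ = 0 →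
      statEnergy R νstar ≤ statEnergy R ν) :
    ∀ f : BoundedContinuousFunction ℝ ℝ,
      Tendsto (fun u : ℝ =>
          ∫ x, f x ∂(Measure.map Tstar
            (ProbabilityTheory.cond P {ω | ∀ t ∈ Icc 0 b, u < X t ω})))
        atTop (nhds (∫ x, f x ∂νstar)) := by
  intro f
  obtain ⟨Y, hY, hYX⟩ := exists_isStationaryGaussian hGauss hpath hcov
  have hT' : ∀ ω, Tstar ω = leftArgmin (fun t => X t ω) b := hT
  have hTm : Measurable fun ω => leftArgmin (fun t => Y t ω) b :=
    measurable_leftArgmin hY.measurable hY.continuous hb.le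
  have hTae : Tstar =ᵐ[P] fun ω => leftArgmin (fun t => Y t ω) b :=
    hYX.mono fun ω hω => by simp only [hT', hω]
  have hE : ∀ u, ({ω | ∀ t ∈ Icc 0 b, u < X t ω} : Set Ω) =ᵐ[P] {ω | u < pathMin Y b ω} :=
    fun u => hYX.mono fun ω hω => propext <| by
      change (∀ t ∈ Icc 0 b, u < X t ω) ↔ u < infOn (fun t => Y t ω) b
      rw [lt_infOn_iff (hY.continuous ω) hb.le]
      simp only [hω]
  have key := hY.tendsto_integral_cond hb.le hconv ⟨hprob, hsupp⟩
    (fun ρ hρ => hopt ρ hρ.1 hρ.2) (fun u hu => measure_congr (hE u) ▸ hpos u hu) hTm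
    (fun ω => (leftArgmin_mem (hY.continuous ω) hb.le).1)
    (fun ω => (leftArgmin_mem (hY.continuous ω) hb.le).2) f.continuous
  refine key.congr fun u => ?_
  have hcond : ProbabilityTheory.cond P {ω | ∀ t ∈ Icc 0 b, u < X t ω}
      = ProbabilityTheory.cond P {ω | u < pathMin Y b ω} := by
    rw [ProbabilityTheory.cond, ProbabilityTheory.cond, measure_congr (hE u),
      Measure.restrict_congr_set (hE u)]
  rw [hcond, Measure.map_congr (cond_absolutelyContinuous.ae_eq hTae),
    integral_map hTm.aemeasurable f.continuous.aestronglyMeasurable]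
end

section
/- Let n ≥ 1, let p₁, …, p_n be strictly positive reals with Σ_{i=1}^n p_i = 1, let x > 0, and for j ∈ {1, …, n} define E_j(x) = { z ∈ (0,∞)^n : z_j < z_i for all i ≠ j, and Σ_{i=1}^n p_i z_i ≤ x }. Then the n-dimensional Lebesgue measure of E_j(x) equals (x^n / n!) · p_j / ∏_{i=1}^n p_i. -/
open MeasureTheory Set

/-- The Lebesgue measure of a corner simplex with positive weights. -/
theorem volume_weighted_simplex (n : ℕ) (a : Fin n → ℝ) (ha : ∀ i, 0 < a i) (x : ℝ)
    (hx : 0 ≤ x) :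
    volume {z : Fin n → ℝ | (∀ i, 0 < z i) ∧ ∑ i, a i * z i ≤ x} =
      ENNReal.ofReal (x ^ n / n.factorial / ∏ i, a i) := by
  induction n generalizing x with
  | zero => simp [hx, volume_pi]
  | succ n ih =>
    have hmeas : MeasurableSet {q : ℝ × (Fin n → ℝ) |
        (0 < q.1 ∧ ∀ i, 0 < q.2 i) ∧ a 0 * q.1 + ∑ i, a i.succ * q.2 i ≤ x} := by
      measurability
    have hpre : {z : Fin (n + 1) → ℝ | (∀ i, 0 < z i) ∧ ∑ i, a i * z i ≤ x} =
        MeasurableEquiv.piFinSuccAbove (fun _ => ℝ) 0 ⁻¹' {q : ℝ × (Fin n → ℝ) |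
          (0 < q.1 ∧ ∀ i, 0 < q.2 i) ∧ a 0 * q.1 + ∑ i, a i.succ * q.2 i ≤ x} := by
      ext z
      simp [Fin.forall_fin_succ, Fin.sum_univ_succ, MeasurableEquiv.piFinSuccAbove,
        Fin.insertNthEquiv, Fin.tail]
    have ha0 := ha 0
    have hslice : ∀ t : ℝ, volume (Prod.mk t ⁻¹' {q : ℝ × (Fin n → ℝ) |
        (0 < q.1 ∧ ∀ i, 0 < q.2 i) ∧ a 0 * q.1 + ∑ i, a i.succ * q.2 i ≤ x}) =
        (Ioc 0 (x / a 0)).indicator (fun t => ENNReal.ofReal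
          ((x - a 0 * t) ^ n / n.factorial / ∏ i : Fin n, a i.succ)) t := by
      intro t
      by_cases ht : t ∈ Ioc 0 (x / a 0)
      · have hle : 0 ≤ x - a 0 * t := by
          have := (le_div_iff₀ ha0).1 ht.2
          linarith
        rw [indicator_of_mem ht, ← ih (fun i => a i.succ) (fun i => ha _) _ hle]
        congr 1
        ext z
        simp [ht.1, le_sub_iff_add_le']
      · rw [indicator_of_notMem ht]
        convert measure_empty (μ := (volume : Measure (Fin n → ℝ)))
        rw [eq_empty_iff_forall_notMem]
        rintro z ⟨⟨h0, hz⟩, hs⟩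
        refine ht ⟨h0, (le_div_iff₀ ha0).2 ?_⟩
        have : 0 ≤ ∑ i, a i.succ * z i :=
          Finset.sum_nonneg fun i _ => (mul_pos (ha _) (hz i)).le
        dsimp only at hs
        linarith
    rw [hpre, (volume_preserving_piFinSuccAbove (fun _ => ℝ) 0).measure_preimage_equiv,
      Measure.volume_eq_prod, Measure.prod_apply hmeas, lintegral_congr hslice,
      lintegral_indicator measurableSet_Ioc, ← ofReal_integral_eq_lintegral_ofReal]
    · congr 1
      rw [← intervalIntegral.integral_of_le (by positivity)]
      have hder : ∀ t ∈ uIcc 0 (x / a 0), HasDerivAt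
          (fun t => -(x - a 0 * t) ^ (n + 1) / (n + 1).factorial / ∏ i, a i)
          ((x - a 0 * t) ^ n / n.factorial / ∏ i : Fin n, a i.succ) t := by
        intro t _
        have h := ((((((hasDerivAt_id t).const_mul (a 0)).const_sub x).pow (n + 1)).neg).div_const
          ((n + 1).factorial : ℝ)).div_const (∏ i, a i)
        refine h.congr_deriv ?_
        have hprod : (∏ i : Fin n, a i.succ) ≠ 0 := Finset.prod_ne_zero_iff.2 fun i _ => (ha _).ne'
        rw [Fin.prod_univ_succ, Nat.factorial_succ]
        have := Nat.factorial_ne_zero n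
        push_cast
        simp only [id]
        field_simp
      rw [intervalIntegral.integral_eq_sub_of_hasDerivAt hder
        (Continuous.intervalIntegrable (by fun_prop) _ _)]
      have : a 0 * (x / a 0) = x := by field_simp
      simp [this]
      ring
    · exact (Continuous.integrableOn_Icc (by fun_prop)).mono_set Ioc_subset_Icc_self
    · refine (ae_restrict_iff' measurableSet_Ioc).2 (Filter.Eventually.of_forall fun t ht => ?_)
      have hle : 0 ≤ x - a 0 * t := by
        have := (le_div_iff₀ ha0).1 ht.2
        linarith
      have := Finset.prod_nonneg fun (i : Fin n) (_ : i ∈ Finset.univ) => (ha i.succ).le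
      dsimp only [Pi.zero_apply]
      positivity

/-- Subtracting one coordinate from all the others preserves Lebesgue measure. -/
theorem volume_preimage_sub_coordinate {n : ℕ} (j : Fin n) (s : Set (Fin n → ℝ)) :
    volume ((fun (z : Fin n → ℝ) i => if i = j then z j else z i - z j) ⁻¹' s) = volume s := by
  let M : Matrix (Fin n) (Fin n) ℝ :=
    1 + Matrix.replicateCol Unit (fun i => if i = j then (0 : ℝ) else -1) *
      Matrix.replicateRow Unit (Pi.single j (1 : ℝ))
  have hdet : LinearMap.det (Matrix.toLin' M) = 1 := by
    rw [LinearMap.det_toLin']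
    dsimp only [M]
    rw [Matrix.det_one_add_replicateCol_mul_replicateRow]
    simp
  have hfun : (fun (z : Fin n → ℝ) i => if i = j then z j else z i - z j) =
      Matrix.toLin' M := by
    ext z i
    simp only [M, Matrix.toLin'_apply, Matrix.add_mulVec, Matrix.one_mulVec, Pi.add_apply,
      ← Matrix.mulVec_mulVec]
    by_cases h : i = j <;>
      simp [h, Matrix.mulVec, dotProduct, Pi.single_apply, sub_eq_add_neg]
  rw [hfun, Measure.addHaar_preimage_linearMap _ (by simp [hdet]), hdet]
  simp

/-- For strictly positive weights `p₁, …, p_n` summing to `1` and `x > 0`,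
the Lebesgue measure of
`E_j(x) = { z ∈ (0,∞)^n : z_j < z_i for i ≠ j, Σ p_i z_i ≤ x }` equals
`(x^n/n!) · p_j / ∏ᵢ p_i`. -/
theorem volume_of_weighted_simplex_with_min_coordinate
    (n : ℕ) (hn : 1 ≤ n) (p : Fin n → ℝ) (hp : ∀ i, 0 < p i)
    (hsum : ∑ i, p i = 1) (x : ℝ) (hx : 0 < x) (j : Fin n) :
    volume {z : Fin n → ℝ |
        (∀ i, 0 < z i) ∧ (∀ i, i ≠ j → z j < z i) ∧ ∑ i, p i * z i ≤ x} =
      ENNReal.ofReal ((x ^ n / n.factorial) * (p j / ∏ i, p i)) := by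
  have hq : ∀ i, 0 < Function.update p j 1 i := by
    intro i
    rcases eq_or_ne i j with rfl | h <;> simp [*]
  have hset : {z : Fin n → ℝ |
        (∀ i, 0 < z i) ∧ (∀ i, i ≠ j → z j < z i) ∧ ∑ i, p i * z i ≤ x} =
      (fun (z : Fin n → ℝ) i => if i = j then z j else z i - z j) ⁻¹'
        {w | (∀ i, 0 < w i) ∧ ∑ i, Function.update p j 1 i * w i ≤ x} := by
    ext z
    have hweights : ∑ i, Function.update p j 1 i * (if i = j then z j else z i - z j) =
        ∑ i, p i * z i := by
      have hterm : ∀ i, Function.update p j 1 i * (if i = j then z j else z i - z j) =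
          p i * z i - p i * z j + if i = j then z j else 0 := by
        intro i
        rcases eq_or_ne i j with rfl | h
        · simp
        · simp [h]
          ring
      simp only [hterm, Finset.sum_add_distrib, Finset.sum_sub_distrib, ← Finset.sum_mul, hsum]
      simp
    simp only [mem_ofPred_eq, mem_preimage, hweights, ← and_assoc]
    refine and_congr_left fun _ => ⟨fun h i => ?_, fun h => ?_⟩
    · split_ifs with hi
      · exact h.1 j
      · exact sub_pos.2 (h.2 i hi)
    · have hj : 0 < z j := by simpa using h j
      have hlt : ∀ i, i ≠ j → z j < z i := fun i hi => by simpa [hi] using h i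
      refine ⟨fun i => ?_, hlt⟩
      rcases eq_or_ne i j with rfl | hi
      · exact hj
      · exact hj.trans (hlt i hi)
  rw [hset, volume_preimage_sub_coordinate, volume_weighted_simplex n _ hq x hx.le]
  congr 1
  rw [Finset.prod_update_of_mem (Finset.mem_univ j), one_mul,
    ← Finset.mul_prod_erase Finset.univ p (Finset.mem_univ j), Finset.sdiff_singleton_eq_erase]
  have := (hp j).ne'
  have : (∏ i ∈ Finset.univ.erase j, p i) ≠ 0 := Finset.prod_ne_zero_iff.2 fun i _ => (hp i).ne'
  field_simp
end
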